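/- Let H ⊂ ℂ^N be a Levi-flat local real-hypervariety. Suppose E = (closure(H*) ∩ U)_s is a connected generic real-analytic submanifold. Then E is a generic Levi-flat submanifold of real dimension 2N−2. -/

import Mathlib

/- Common definitions: real-analytic and complex-analytic subvarieties of ℂ^N,
Levi-flat hypervarieties, CR submanifolds, Segre varieties, etc. -/

open Complex Set Topology Filter
open scoped ENNReal

noncomputable section

abbrev CN (N : ℕ) := Fin N → ℂ

/-- `X` is a (relatively closed) real-analytic subvariety of the open set `U ⊆ ℂ^N`. -/
def IsRealSubvariety (N : ℕ) (U X : Set (CN N)) : Prop :=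
  X ⊆ U ∧ closure X ∩ U ⊆ X ∧
    ∀ p ∈ U, ∃ V : Set (CN N), IsOpen V ∧ p ∈ V ∧ V ⊆ U ∧
      ∃ (k : ℕ) (f : Fin k → CN N → ℝ),
        (∀ i, AnalyticOn ℝ (f i) V) ∧ X ∩ V = {z ∈ V | ∀ i, f i z = 0}

/-- `X` is a (relatively closed) complex-analytic subvariety of the open set `U ⊆ ℂ^N`. -/
def IsComplexSubvariety (N : ℕ) (U X : Set (CN N)) : Prop :=
  X ⊆ U ∧ closure X ∩ U ⊆ X ∧
    ∀ p ∈ U, ∃ V : Set (CN N), IsOpen V ∧ p ∈ V ∧ V ⊆ U ∧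
      ∃ (k : ℕ) (f : Fin k → CN N → ℂ),
        (∀ i, AnalyticOn ℂ (f i) V) ∧ X ∩ V = {z ∈ V | ∀ i, f i z = 0}

/-- `X` is a real-analytic subvariety of the (not necessarily open) set `V`. -/
def IsRealSubvarietyIn (N : ℕ) (V X : Set (CN N)) : Prop :=
  X ⊆ V ∧ closure X ∩ V ⊆ X ∧
    ∀ p ∈ V, ∃ W : Set (CN N), IsOpen W ∧ p ∈ W ∧
      ∃ (k : ℕ) (f : Fin k → CN N → ℝ),
        (∀ i, AnalyticOn ℝ (f i) W) ∧ X ∩ W = {z ∈ V ∩ W | ∀ i, f i z = 0}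

/-- `X` is a complex-analytic subvariety of the (not necessarily open) set `V`. -/
def IsComplexSubvarietyIn (N : ℕ) (V X : Set (CN N)) : Prop :=
  X ⊆ V ∧ closure X ∩ V ⊆ X ∧
    ∀ p ∈ V, ∃ W : Set (CN N), IsOpen W ∧ p ∈ W ∧
      ∃ (k : ℕ) (f : Fin k → CN N → ℂ),
        (∀ i, AnalyticOn ℂ (f i) W) ∧ X ∩ W = {z ∈ V ∩ W | ∀ i, f i z = 0}

/-- Near `p`, `X` is a real-analytic submanifold of ℂ^N of real dimension `d`,
cut out by `2N - d` real-analytic functions with linearly independent differentials. -/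
def IsSubmanifoldAtDim (N d : ℕ) (X : Set (CN N)) (p : CN N) : Prop :=
  ∃ (V : Set (CN N)) (f : Fin (2 * N - d) → CN N → ℝ),
    IsOpen V ∧ p ∈ V ∧ (∀ i, AnalyticOn ℝ (f i) V) ∧
    (∀ z ∈ V, LinearIndependent ℝ fun i => fderiv ℝ (f i) z) ∧
    X ∩ V = {z ∈ V | ∀ i, f i z = 0}

/-- Near `p`, `X` is a complex submanifold of ℂ^N of complex dimension `d`. -/
def IsCxSubmanifoldAtDim (N d : ℕ) (X : Set (CN N)) (p : CN N) : Prop :=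
  ∃ (V : Set (CN N)) (f : Fin (N - d) → CN N → ℂ),
    IsOpen V ∧ p ∈ V ∧ (∀ i, AnalyticOn ℂ (f i) V) ∧
    (∀ z ∈ V, LinearIndependent ℂ fun i => fderiv ℂ (f i) z) ∧
    X ∩ V = {z ∈ V | ∀ i, f i z = 0}

/-- Points near which `X` is a real-analytic submanifold of some dimension. -/
def regPts (N : ℕ) (X : Set (CN N)) : Set (CN N) :=
  {p ∈ X | ∃ d, IsSubmanifoldAtDim N d X p}

/-- The singular set `X_s` of a real-analytic subvariety. -/
def singSet (N : ℕ) (X : Set (CN N)) : Set (CN N) := X \ regPts N X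

/-- `H*`: the points near which `H` is a nonsingular real-analytic hypersurface. -/
def hypStar (N : ℕ) (H : Set (CN N)) : Set (CN N) :=
  {p ∈ H | IsSubmanifoldAtDim N (2 * N - 1) H p}

/-- Near `p` the hypersurface `H` is given by `Im f = 0` for a holomorphic `f` with
nonvanishing differential (the local model of a nonsingular Levi-flat hypersurface). -/
def IsLeviFlatHypAt (N : ℕ) (H : Set (CN N)) (p : CN N) : Prop :=
  ∃ (V : Set (CN N)) (f : CN N → ℂ),
    IsOpen V ∧ p ∈ V ∧ AnalyticOn ℂ f V ∧ (∀ z ∈ V, fderiv ℂ f z ≠ 0) ∧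
    H ∩ V = {z ∈ V | (f z).im = 0}

/-- A Levi-flat real-hypervariety `H` of the open set `U`: a relatively closed
real-analytic subvariety of real dimension `2N - 1` whose regular hypersurface
part `H*` is Levi-flat. -/
def IsLeviFlatHypervariety (N : ℕ) (U H : Set (CN N)) : Prop :=
  IsOpen U ∧ IsRealSubvariety N U H ∧ dimH H = ((2 * N - 1 : ℕ) : ℝ≥0∞) ∧
    ∀ p ∈ hypStar N H, IsLeviFlatHypAt N H p

/-- Near `p`, in suitable local holomorphic coordinates `Φ`, the set `M` is given by
`Im z₁ = ⋯ = Im z_j = 0`, `z_{j+1} = ⋯ = z_k = 0`: `M` is a Levi-flat CR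
submanifold at `p`. -/
def IsLeviFlatCRAt (N : ℕ) (M : Set (CN N)) (p : CN N) : Prop :=
  ∃ (V : Set (CN N)) (Φ : CN N → CN N) (j k : ℕ),
    j ≤ k ∧ k ≤ N ∧ IsOpen V ∧ p ∈ V ∧
    AnalyticOn ℂ Φ V ∧ InjOn Φ V ∧
    (∀ z ∈ V, Function.Bijective ⇑(fderiv ℂ Φ z)) ∧
    M ∩ V = {z ∈ V | (∀ i : Fin N, (i : ℕ) < j → (Φ z i).im = 0) ∧
      ∀ i : Fin N, j ≤ (i : ℕ) → (i : ℕ) < k → Φ z i = 0}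

/-- The holomorphic part `∂r` of the differential of a real function `r` at `z`,
as a complex-valued form: `∂r(v) = dr(v) - i · dr(i·v)` (up to a factor `2`). -/
def delForm (N : ℕ) (r : CN N → ℝ) (z : CN N) : CN N → ℂ := fun v =>
  Complex.ofReal (fderiv ℝ r z v) -
    Complex.I * Complex.ofReal (fderiv ℝ r z (Complex.I • v))

/-- `M` is a generic submanifold near `p`: locally cut out by real-analytic
`r₁, …, r_k` with `∂r₁, …, ∂r_k` linearly independent. -/
def IsGenericSubmanifoldAt (N : ℕ) (M : Set (CN N)) (p : CN N) : Prop :=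
  ∃ (V : Set (CN N)) (k : ℕ) (r : Fin k → CN N → ℝ),
    IsOpen V ∧ p ∈ V ∧ (∀ i, AnalyticOn ℝ (r i) V) ∧
    (∀ z ∈ V, LinearIndependent ℝ fun i => fderiv ℝ (r i) z) ∧
    (∀ z ∈ V, LinearIndependent ℂ fun i => delForm N (r i) z) ∧
    M ∩ V = {z ∈ V | ∀ i, r i z = 0}

/-- Near `p`, in suitable local holomorphic coordinates, `M` is `{Im z₁ = Im z₂ = 0}`:
the local model of a generic Levi-flat submanifold of real dimension `2N - 2`. -/
def IsGenericLeviFlat2At (N : ℕ) (M : Set (CN N)) (p : CN N) : Prop :=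
  ∃ (V : Set (CN N)) (Φ : CN N → CN N),
    IsOpen V ∧ p ∈ V ∧ AnalyticOn ℂ Φ V ∧ InjOn Φ V ∧
    (∀ z ∈ V, Function.Bijective ⇑(fderiv ℂ Φ z)) ∧
    M ∩ V = {z ∈ V | ∀ i : Fin N, (i : ℕ) < 2 → (Φ z i).im = 0}

/-- The complex-tangent (CR) vectors to `M` at `p`. -/
def crTangent (N : ℕ) (M : Set (CN N)) (p : CN N) : Set (CN N) :=
  {v | v ∈ tangentConeAt ℝ M p ∧ Complex.I • v ∈ tangentConeAt ℝ M p}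

/-- The CR dimension of `M` at `p`. -/
def crDim (N : ℕ) (M : Set (CN N)) (p : CN N) : ℕ :=
  Module.finrank ℂ (Submodule.span ℂ (crTangent N M p))

/-- `M` is a real-analytic CR submanifold: a real-analytic submanifold with
constant CR dimension. -/
def IsCRSubmanifold (N : ℕ) (M : Set (CN N)) : Prop :=
  (∃ d, ∀ p ∈ M, IsSubmanifoldAtDim N d M p) ∧ ∃ m, ∀ p ∈ M, crDim N M p = m

/-- Coordinatewise complex conjugation. -/
def conjPt (N : ℕ) (z : CN N) : CN N := fun i => starRingEnd ℂ (z i)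

/-- `R` is the complexification `r(z, w̄)` of the real-analytic function `r` on `U`:
it is holomorphic on `U × *U` (where `*U` is the conjugate of `U`) and `R(z, z̄) = r(z)`. -/
def IsComplexification (N : ℕ) (U : Set (CN N)) (r : CN N → ℝ)
    (R : CN N → CN N → ℂ) : Prop :=
  AnalyticOn ℂ (fun zw : CN N × CN N => R zw.1 zw.2) (U ×ˢ (conjPt N '' U)) ∧
    ∀ z ∈ U, R z (conjPt N z) = Complex.ofReal (r z)

/-- The Segre variety `Σ_p(U, r) = {z ∈ U : r(z, p̄) = 0}`, for `R` the
complexification of `r`. -/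
def segreSet (N : ℕ) (U : Set (CN N)) (R : CN N → CN N → ℂ) (p : CN N) : Set (CN N) :=
  {z ∈ U | R z (conjPt N p) = 0}

/-- `p` is a Segre-degenerate singularity of `H`: for every local defining function `r` of
`H` at `p`, the function `z ↦ r(z, p̄)` vanishes identically near `p`. -/
def IsSegreDegenerateAt (N : ℕ) (H : Set (CN N)) (p : CN N) : Prop :=
  ∀ (V : Set (CN N)) (r : CN N → ℝ) (R : CN N → CN N → ℂ),
    IsOpen V → p ∈ V → AnalyticOn ℝ r V → IsComplexification N V r R →
    H ∩ V = {z ∈ V | r z = 0} → ∀ᶠ z in nhds p, R z (conjPt N p) = 0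

/-- `Σ'`: the union of all complex subvarieties of `V` of complex dimension `N - 1`
contained in `H`. -/
def sigmaPrime (N : ℕ) (H V : Set (CN N)) : Set (CN N) :=
  ⋃₀ {W | IsComplexSubvariety N V W ∧ W ⊆ H ∧ dimH W = ((2 * N - 2 : ℕ) : ℝ≥0∞)}

/-- `p` is a leaf-degenerate point of `H`: the germ `Σ'_p(H)` is not a complex variety of
dimension `N - 1`, i.e. there is no single complex subvariety `W ∋ p` of dimension `N - 1`
inside `H` containing all complex hypervarieties of `H` near `p`. -/
def IsLeafDegenerateAt (N : ℕ) (H : Set (CN N)) (p : CN N) : Prop :=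
  ¬∃ (V W : Set (CN N)), IsOpen V ∧ p ∈ V ∧ p ∈ W ∧ W ⊆ H ∧
    IsComplexSubvariety N V W ∧ dimH W = ((2 * N - 2 : ℕ) : ℝ≥0∞) ∧
    ∀ V' : Set (CN N), IsOpen V' → V' ⊆ V → sigmaPrime N H V' ⊆ W

/-- An irreducible complex subvariety of `U`. -/
def IsIrreducibleCxSubvariety (N : ℕ) (U W : Set (CN N)) : Prop :=
  IsComplexSubvariety N U W ∧ W.Nonempty ∧
    ∀ W₁ W₂ : Set (CN N), IsComplexSubvariety N U W₁ → IsComplexSubvariety N U W₂ →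
      W = W₁ ∪ W₂ → W = W₁ ∨ W = W₂

/-- The germ of the real-analytic variety `H` at `p` is irreducible: in any decomposition
of `H` near `p` into two real-analytic subvarieties, one of them contains `H` near `p`. -/
def IsIrreducibleGermAt (N : ℕ) (H : Set (CN N)) (p : CN N) : Prop :=
  ∀ V H₁ H₂ : Set (CN N), IsOpen V → p ∈ V →
    IsRealSubvariety N V H₁ → IsRealSubvariety N V H₂ → H ∩ V = H₁ ∪ H₂ →
    ∃ V' : Set (CN N), IsOpen V' ∧ p ∈ V' ∧ (H ∩ V' ⊆ H₁ ∨ H ∩ V' ⊆ H₂)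

/-- `M` is minimal at `p`: every (real-analytic) CR submanifold of `M` through `p` with
the same CR dimension contains a neighborhood of `p` in `M`. -/
def IsMinimalAt (N : ℕ) (M : Set (CN N)) (p : CN N) : Prop :=
  ∀ M' : Set (CN N), p ∈ M' → M' ⊆ M →
    (∃ d, ∀ q ∈ M', IsSubmanifoldAtDim N d M' q) →
    (∀ q ∈ M', crDim N M' q = crDim N M p) →
    ∃ V : Set (CN N), IsOpen V ∧ p ∈ V ∧ M ∩ V ⊆ M'

/-- `O` is (a representative of) the local CR orbit of `M` at `p`, of dimension `d`:
the smallest CR submanifold of `M` through `p` of the same CR dimension as `M` at `p`. -/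
def IsCROrbitAt (N d : ℕ) (M O : Set (CN N)) (p : CN N) : Prop :=
  p ∈ O ∧ O ⊆ M ∧ (∀ q ∈ O, IsSubmanifoldAtDim N d O q) ∧
    (∀ q ∈ O, crDim N O q = crDim N M p) ∧
    ∀ O' : Set (CN N), p ∈ O' → O' ⊆ M →
      (∃ d', ∀ q ∈ O', IsSubmanifoldAtDim N d' O' q) →
      (∀ q ∈ O', crDim N O' q = crDim N M p) →
      ∃ V : Set (CN N), IsOpen V ∧ p ∈ V ∧ O ∩ V ⊆ O'

/-- `r` generates the ideal of germs at `p` of real-analytic functions vanishing on `H`. -/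
def GeneratesVanishingIdealAt (N : ℕ) (H V : Set (CN N)) (r : CN N → ℝ) (p : CN N) :
    Prop :=
  (∀ z ∈ H ∩ V, r z = 0) ∧
    ∀ (V' : Set (CN N)) (g : CN N → ℝ), IsOpen V' → p ∈ V' → AnalyticOn ℝ g V' →
      (∀ z ∈ H ∩ V', g z = 0) →
      ∃ (V'' : Set (CN N)) (q : CN N → ℝ), IsOpen V'' ∧ p ∈ V'' ∧ V'' ⊆ V ∩ V' ∧
        AnalyticOn ℝ q V'' ∧ ∀ z ∈ V'', g z = q z * r z

/-- The exterior derivative of a one-form `ω`, evaluated at `z` on `(u, v)`. -/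
def oneFormD (N : ℕ) (ω : CN N → (CN N →L[ℂ] ℂ)) (z u v : CN N) : ℂ :=
  fderiv ℂ ω z u v - fderiv ℂ ω z v u

/-- `(ω ∧ dω)(u, v, w)` at `z`; its vanishing is complete integrability of `ω`. -/
def integrabilityWedge (N : ℕ) (ω : CN N → (CN N →L[ℂ] ℂ)) (z u v w : CN N) : ℂ :=
  ω z u * oneFormD N ω z v w - ω z v * oneFormD N ω z u w + ω z w * oneFormD N ω z u v

/-! ### Conjugation and complexification of analytic maps -/

section Conj

variable {E F : Type*} [NormedAddCommGroup E] [NormedSpace ℂ E] [StarAddMonoid E]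
  [NormedStarGroup E] [StarModule ℂ E] [NormedAddCommGroup F] [NormedSpace ℂ F] [StarAddMonoid F]
  [NormedStarGroup F] [StarModule ℂ F]

/-- The conjugate `v ↦ star (p (star v))` of a continuous multilinear map. -/
def ContinuousMultilinearMap.starConj {n : ℕ}
    (p : ContinuousMultilinearMap ℂ (fun _ : Fin n => E) F) :
    ContinuousMultilinearMap ℂ (fun _ : Fin n => E) F :=
  MultilinearMap.mkContinuous
    { toFun := fun v => star (p fun i => star (v i))
      map_update_add' := by
        intro _ v i x y
        have h : ∀ z : E, (fun j => star (Function.update v i z j)) =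
            Function.update (fun j => star (v j)) i (star z) := by
          intro z
          funext j
          by_cases hj : j = i
          · subst hj; simp
          · simp [hj]
        convert congrArg star (p.map_update_add (fun j => star (v j)) i (star x) (star y)) using 1
        · rw [← star_add, ← h]
        · rw [star_add, ← h, ← h]
      map_update_smul' := by
        intro _ v i c x
        have h : ∀ z : E, (fun j => star (Function.update v i z j)) =
            Function.update (fun j => star (v j)) i (star z) := by
          intro z
          funext j
          by_cases hj : j = i
          · subst hj; simp
          · simp [hj]
        convert congrArg star (p.map_update_smul (fun j => star (v j)) i (star c) (star x)) using 1
        · rw [← star_smul, ← h]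
        · rw [star_smul, star_star, ← h] }
    ‖p‖ (by
      intro v
      simp only [MultilinearMap.coe_mk, norm_star]
      refine (p.le_opNorm _).trans ?_
      simp [norm_star])

theorem ContinuousMultilinearMap.starConj_apply {n : ℕ}
    (p : ContinuousMultilinearMap ℂ (fun _ : Fin n => E) F) (v : Fin n → E) :
    p.starConj v = star (p fun i => star (v i)) := rfl

theorem ContinuousMultilinearMap.norm_starConj_le {n : ℕ}
    (p : ContinuousMultilinearMap ℂ (fun _ : Fin n => E) F) : ‖p.starConj‖ ≤ ‖p‖ :=
  MultilinearMap.mkContinuous_norm_le _ (norm_nonneg _) _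

theorem AnalyticAt.star_comp_star {f : E → F} {z : E} (hf : AnalyticAt ℂ f (star z)) :
    AnalyticAt ℂ (fun w => star (f (star w))) z := by
  obtain ⟨p, r, hp⟩ := hf
  refine ⟨fun n => (p n).starConj, r, ?_⟩
  refine ⟨?_, hp.r_pos, ?_⟩
  · refine hp.r_le.trans ?_
    refine FormalMultilinearSeries.radius_le_of_le (fun n => ?_)
    exact (p n).norm_starConj_le
  · intro y hy
    have hy' : star y ∈ Metric.eball (0 : E) r := by
      simpa [Metric.mem_eball, edist_eq_enorm_sub, enorm_eq_nnnorm] using hy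
    have := (hp.hasSum hy').star
    simpa [ContinuousMultilinearMap.starConj_apply, star_add] using this

end Conj

section Complexify

variable {G : Type*} [NormedAddCommGroup G] [NormedSpace ℂ G]

/-- The complexification of a real multilinear map on `ℝᵃ`. -/
def ContinuousMultilinearMap.complexify {a n : ℕ}
    (p : ContinuousMultilinearMap ℝ (fun _ : Fin n => Fin a → ℝ) G) :
    ContinuousMultilinearMap ℂ (fun _ : Fin n => Fin a → ℂ) G :=
  ∑ σ : Fin n → Fin a,
    ((ContinuousMultilinearMap.mkPiAlgebra ℂ (Fin n) ℂ).compContinuousLinearMap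
      (fun i => ContinuousLinearMap.proj (R := ℂ) (φ := fun _ : Fin a => ℂ) (σ i))).smulRight
      (p fun i => Pi.single (σ i) 1)

theorem ContinuousMultilinearMap.complexify_apply {a n : ℕ}
    (p : ContinuousMultilinearMap ℝ (fun _ : Fin n => Fin a → ℝ) G) (v : Fin n → Fin a → ℂ) :
    p.complexify v = ∑ σ : Fin n → Fin a, (∏ i, v i (σ i)) • p fun i => Pi.single (σ i) 1 := by
  simp [complexify]

theorem ContinuousMultilinearMap.complexify_ofReal {a n : ℕ}
    (p : ContinuousMultilinearMap ℝ (fun _ : Fin n => Fin a → ℝ) G) (v : Fin n → Fin a → ℝ) :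
    p.complexify (fun i j => (v i j : ℂ)) = p v := by
  rw [complexify_apply]
  have h : p v = p fun i => ∑ j, (v i j) • (Pi.single j (1 : ℝ) : Fin a → ℝ) := by
    congr 1
    funext i
    exact pi_eq_sum_univ' (v i)
  rw [h, ContinuousMultilinearMap.map_sum]
  refine Finset.sum_congr rfl fun σ _ => ?_
  rw [ContinuousMultilinearMap.map_smul_univ]
  rw [← Complex.ofReal_prod]
  exact Complex.coe_smul _ _

theorem ContinuousMultilinearMap.norm_complexify_le {a n : ℕ}
    (p : ContinuousMultilinearMap ℝ (fun _ : Fin n => Fin a → ℝ) G) :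
    ‖p.complexify‖ ≤ (a : ℝ) ^ n * ‖p‖ := by
  refine ContinuousMultilinearMap.opNorm_le_bound (by positivity) fun v => ?_
  rw [complexify_apply]
  refine (norm_sum_le _ _).trans ?_
  have : ∀ σ ∈ (Finset.univ : Finset (Fin n → Fin a)),
      ‖(∏ i, v i (σ i)) • p fun i => Pi.single (σ i) 1‖ ≤ ‖p‖ * ∏ i, ‖v i‖ := by
    intro σ _
    rw [norm_smul, mul_comm]
    refine mul_le_mul ?_ ?_ (norm_nonneg _) (norm_nonneg _)
    · refine (p.le_opNorm _).trans ?_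
      simp [Pi.norm_single]
    · rw [norm_prod]
      exact Finset.prod_le_prod (fun _ _ => norm_nonneg _) fun i _ => norm_le_pi_norm _ _
  refine (Finset.sum_le_card_nsmul _ _ _ this).trans ?_
  simp [mul_assoc]

theorem AnalyticAt.exists_complexification [CompleteSpace G] {a : ℕ} {f : (Fin a → ℝ) → G} {x : Fin a → ℝ}
    (hf : AnalyticAt ℝ f x) :
    ∃ F : (Fin a → ℂ) → G, AnalyticAt ℂ F (fun i => (x i : ℂ)) ∧
      ∀ᶠ y in 𝓝 x, F (fun i => (y i : ℂ)) = f y := by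
  obtain ⟨p, r, hp⟩ := hf
  let q : FormalMultilinearSeries ℂ (Fin a → ℂ) G := fun n => (p n).complexify
  obtain ⟨r0, hr0, hr0p⟩ := ENNReal.lt_iff_exists_nnreal_btwn.1 (hp.r_pos.trans_le hp.r_le)
  obtain ⟨C, hC, hpC⟩ := p.norm_mul_pow_le_of_lt_radius hr0p
  have hr0' : 0 < r0 := by exact_mod_cast hr0
  let s : NNReal := r0 / (a + 1)
  have hs : 0 < s := by positivity
  have hq : (s : ℝ≥0∞) ≤ q.radius := by
    refine q.le_radius_of_bound C fun n => ?_
    calc ‖q n‖ * (s : ℝ) ^ n ≤ ((a : ℝ) ^ n * ‖p n‖) * (s : ℝ) ^ n := by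
          gcongr
          exact (p n).norm_complexify_le
      _ = ‖p n‖ * r0 ^ n * (a / (a + 1)) ^ n := by
          simp only [s, NNReal.coe_div, NNReal.coe_add, NNReal.coe_natCast, NNReal.coe_one, div_pow]
          ring
      _ ≤ ‖p n‖ * r0 ^ n * 1 := by
          gcongr
          refine pow_le_one₀ (by positivity) ?_
          rw [div_le_one (by positivity)]
          linarith
      _ ≤ C := by simpa using hpC n
  have hqpos : 0 < q.radius := lt_of_lt_of_le (by exact_mod_cast hs) hq
  have hF := q.hasFPowerSeriesOnBall hqpos
  refine ⟨fun z => q.sum (z - fun i => (x i : ℂ)), ?_, ?_⟩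
  · refine AnalyticAt.fun_comp (g := q.sum) ?_ (analyticAt_id.sub analyticAt_const)
    simpa using hF.analyticAt
  · have h1 : Metric.eball x r ∈ 𝓝 x := Metric.eball_mem_nhds _ hp.r_pos
    filter_upwards [h1] with y hy
    have hyr : y - x ∈ Metric.eball (0 : Fin a → ℝ) r := by
      simpa [Metric.mem_eball, edist_eq_enorm_sub] using hy
    have := (hp.hasSum hyr).tsum_eq
    rw [add_sub_cancel] at this
    rw [← this]
    refine tsum_congr fun n => ?_
    have h2 : (fun i => (y i : ℂ)) - (fun i => (x i : ℂ)) = fun i => ((y - x) i : ℂ) := by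
      funext i; simp
    rw [h2]
    exact (p n).complexify_ofReal fun _ => y - x

end Complexify

/-! ### Uniqueness for holomorphic functions of several variables -/

section Uniqueness

variable {E F : Type*} [NormedAddCommGroup E] [NormedSpace ℂ E]
  [NormedAddCommGroup F] [NormedSpace ℂ F] [CompleteSpace F]

theorem DifferentiableOn.eq_zero_of_frequently_eq_zero_line {C : Set E} {K : E → F}
    (hC : Convex ℝ C) (hCo : IsOpen C) (hK : DifferentiableOn ℂ K C) {a b : E} {σ : ℂ}
    (ha : a ∈ C) (hb : a + σ • b ∈ C) (h : ∃ᶠ τ : ℂ in 𝓝[≠] 0, K (a + τ • b) = 0) :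
    K (a + σ • b) = 0 := by
  set S : Set ℂ := (fun τ : ℂ => a + τ • b) ⁻¹' C with hS
  have hSo : IsOpen S := hCo.preimage (by fun_prop)
  have hSc : Convex ℝ S := by
    have h1 : S = (fun τ : ℂ => τ • b) ⁻¹' ((fun x => a + x) ⁻¹' C) := rfl
    rw [h1]
    exact (hC.translate_preimage_right a).is_linear_preimage
      ⟨fun x y => add_smul x y b, fun c x => smul_assoc c x b⟩
  have hd : DifferentiableOn ℂ (fun τ : ℂ => K (a + τ • b)) S :=
    hK.comp (f := fun τ : ℂ => a + τ • b) (by fun_prop) fun _ h => h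
  have := (hd.analyticOnNhd hSo).eqOn_zero_of_preconnected_of_frequently_eq_zero
    hSc.isPreconnected (z₀ := 0) (by simpa [hS] using ha) h
  exact this (by exact hb)

theorem frequently_nhdsNE_of_eventually_real {p : ℂ → Prop} (h : ∀ᶠ t : ℝ in 𝓝 0, p t) :
    ∃ᶠ τ : ℂ in 𝓝[≠] 0, p τ := by
  have ht : Tendsto (fun t : ℝ => (t : ℂ)) (𝓝[≠] 0) (𝓝[≠] 0) := by
    refine tendsto_nhdsWithin_of_tendsto_nhds_of_eventually_within _ ?_ ?_
    · have : Tendsto (fun t : ℝ => (t : ℂ)) (𝓝 0) (𝓝 ((0 : ℝ) : ℂ)) :=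
        Complex.continuous_ofReal.tendsto 0
      simpa using this.mono_left nhdsWithin_le_nhds
    · filter_upwards [self_mem_nhdsWithin] with t ht
      simpa using ht
  exact ht.frequently ((h.filter_mono nhdsWithin_le_nhds).frequently)

theorem DifferentiableOn.eqOn_zero_of_eventually_eq_zero {C : Set E} {K : E → F}
    (hC : Convex ℝ C) (hCo : IsOpen C) (hK : DifferentiableOn ℂ K C) {a : E}
    (ha : a ∈ C) (h : ∀ᶠ z in 𝓝 a, K z = 0) : EqOn K 0 C := by
  intro z hz
  have h1 := hK.eq_zero_of_frequently_eq_zero_line hC hCo (a := a) (b := z - a) (σ := 1) ha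
    (by simpa using hz) ?_
  · simpa using h1
  · have : Tendsto (fun τ : ℂ => a + τ • (z - a)) (𝓝[≠] 0) (𝓝 a) := by
      have : Continuous (fun τ : ℂ => a + τ • (z - a)) := by fun_prop
      simpa using (this.tendsto 0).mono_left (nhdsWithin_le_nhds (s := {0}ᶜ))
    exact (this.eventually h).frequently

variable [StarAddMonoid E] [StarModule ℂ E]

theorem DifferentiableOn.eqOn_zero_of_real {C : Set E} {K : E → F}
    (hC : Convex ℝ C) (hCo : IsOpen C) (hCs : ∀ z ∈ C, star z ∈ C) (hK : DifferentiableOn ℂ K C)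
    (h : ∀ z ∈ C, star z = z → K z = 0) : EqOn K 0 C := by
  intro z hz
  set a : E := (2⁻¹ : ℂ) • (z + star z) with ha
  set b : E := (-(2⁻¹ : ℂ) * I) • (z - star z) with hb
  have has : star a = a := by
    rw [ha, star_smul, star_add, star_star, add_comm (star z)]
    simp
  have hbs : star b = b := by
    rw [hb, star_smul, star_sub, star_star, ← neg_sub z, smul_neg, ← neg_smul]
    simp
  have haC : a ∈ C := by
    have := hC hz (hCs z hz) (a := 2⁻¹) (b := 2⁻¹) (by norm_num) (by norm_num) (by norm_num)
    convert this using 1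
    rw [ha, smul_add, ← Complex.coe_smul, ← Complex.coe_smul]
    norm_num
  have hzab : z = a + I • b := by
    rw [ha, hb, smul_smul]
    have : I * (-(2⁻¹ : ℂ) * I) = 2⁻¹ := by
      linear_combination (-(2⁻¹ : ℂ)) * I_mul_I
    rw [this]
    module
  rw [hzab]
  refine hK.eq_zero_of_frequently_eq_zero_line hC hCo haC (hzab ▸ hz) ?_
  refine frequently_nhdsNE_of_eventually_real (p := fun τ => K (a + τ • b) = 0) ?_
  have hc : Continuous fun t : ℝ => a + (t : ℂ) • b := by fun_prop
  have : ∀ᶠ t : ℝ in 𝓝 0, a + (t : ℂ) • b ∈ C :=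
    hc.continuousAt.eventually_mem (hCo.mem_nhds (by simpa using haC))
  filter_upwards [this] with t ht
  refine h _ ht ?_
  rw [star_add a, star_smul (t : ℂ), has, hbs]
  simp

theorem DifferentiableOn.eqOn_zero_of_antidiagonal {D : Set (E × E)} {K : E × E → F}
    (hD : Convex ℝ D) (hDo : IsOpen D) (hDs : ∀ u v, (u, v) ∈ D → (star v, star u) ∈ D)
    (hK : DifferentiableOn ℂ K D) (h : ∀ u, (u, star u) ∈ D → K (u, star u) = 0) :
    EqOn K 0 D := by
  let L : E × E → E × E := fun p => (p.1 + I • p.2, p.1 - I • p.2)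
  have hL : Differentiable ℂ L := by fun_prop
  have hLc : Continuous L := hL.continuous
  have key := DifferentiableOn.eqOn_zero_of_real (C := L ⁻¹' D) (K := K ∘ L) ?_
    (hDo.preimage hLc) ?_ (hK.comp hL.differentiableOn fun _ h => h) ?_
  · rintro ⟨u, v⟩ huv
    have hL1 : L ((2⁻¹ : ℂ) • (u + v), (-(2⁻¹ : ℂ) * I) • (u - v)) = (u, v) := by
      have : I * (-(2⁻¹ : ℂ) * I) = 2⁻¹ := by
        linear_combination (-(2⁻¹ : ℂ)) * I_mul_I
      simp only [L, smul_smul, this, Prod.mk.injEq]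
      constructor <;> module
    have := key (show _ ∈ L ⁻¹' D by rw [mem_preimage, hL1]; exact huv)
    rwa [Function.comp_apply, hL1] at this
  · refine hD.is_linear_preimage ⟨fun x y => ?_, fun c x => ?_⟩
    · simp only [L, Prod.fst_add, Prod.snd_add, Prod.mk_add_mk, smul_add, Prod.mk.injEq]
      constructor <;> abel
    · simp only [L, Prod.smul_fst, Prod.smul_snd, Prod.smul_mk, smul_add, smul_sub,
        smul_comm I c]
  · rintro ⟨x, y⟩ hxy
    have := hDs _ _ hxy
    simpa [L, star_smul, sub_eq_add_neg] using this
  · rintro ⟨x, y⟩ hxy hs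
    rw [Prod.star_def, Prod.mk.injEq] at hs
    have h1 : L (x, y) = (x + I • y, star (x + I • y)) := by
      simp [L, star_smul, hs.1, hs.2, sub_eq_add_neg]
    have h2 := h (x + I • y) (by rw [← h1]; exact hxy)
    simp only [Function.comp]
    rw [h1, h2]

end Uniqueness

/-! ### Real-analytic functions near the hyperplane `s = 0` -/

section Rolle

variable {𝕜 Y : Type*} [RCLike 𝕜] [NormedAddCommGroup Y] [NormedSpace 𝕜 Y]

/-- The derivative in the last variable. -/
def lastDeriv (F : Y × 𝕜 → 𝕜) (q : Y × 𝕜) : 𝕜 := fderiv 𝕜 F q (0, 1)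

theorem AnalyticAt.lastDeriv {F : Y × 𝕜 → 𝕜} {q : Y × 𝕜} (hF : AnalyticAt 𝕜 F q) :
    AnalyticAt 𝕜 (lastDeriv F) q :=
  (ContinuousLinearMap.analyticAt (ContinuousLinearMap.apply 𝕜 𝕜 ((0 : Y), (1 : 𝕜))) _).fun_comp
    hF.fderiv

theorem AnalyticOnNhd.lastDeriv {F : Y × 𝕜 → 𝕜} {W : Set (Y × 𝕜)} (hF : AnalyticOnNhd 𝕜 F W) :
    AnalyticOnNhd 𝕜 (lastDeriv F) W := fun q hq => (hF q hq).lastDeriv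

theorem AnalyticAt.lastDeriv_iterate {F : Y × 𝕜 → 𝕜} {q : Y × 𝕜} (hF : AnalyticAt 𝕜 F q) (d : ℕ) :
    AnalyticAt 𝕜 (_root_.lastDeriv^[d] F) q := by
  induction d with
  | zero => exact hF
  | succ d ih => rw [Function.iterate_succ_apply']; exact ih.lastDeriv

theorem hasDerivAt_lastDeriv {F : Y × 𝕜 → 𝕜} {y : Y} {s : 𝕜} (hF : AnalyticAt 𝕜 F (y, s)) :
    HasDerivAt (fun t => F (y, t)) (lastDeriv F (y, s)) s := by
  have h1 : HasDerivAt (fun t : 𝕜 => (y, t)) ((0 : Y), (1 : 𝕜)) s :=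
    (hasDerivAt_const s y).prodMk (hasDerivAt_id s)
  exact hF.differentiableAt.hasFDerivAt.comp_hasDerivAt s h1

theorem iteratedDeriv_eq_lastDeriv_iterate {F : Y × 𝕜 → 𝕜} {y : Y} (d : ℕ) {s : 𝕜}
    (hF : ∀ᶠ t in 𝓝 s, AnalyticAt 𝕜 F (y, t)) :
    iteratedDeriv d (fun t => F (y, t)) s = lastDeriv^[d] F (y, s) := by
  induction d generalizing s with
  | zero => simp
  | succ d ih =>
    rw [iteratedDeriv_succ, Function.iterate_succ_apply']
    rw [← (hasDerivAt_lastDeriv (hF.self_of_nhds.lastDeriv_iterate d)).deriv]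
    refine Filter.EventuallyEq.deriv_eq ?_
    filter_upwards [hF.eventually_nhds] with u hu
    exact ih hu

variable {Y : Type*} [NormedAddCommGroup Y] [NormedSpace ℝ Y]

theorem exists_zero_subset_of_lastDeriv_iterate_ne_zero {W : Set (Y × ℝ)} (hW : IsOpen W) (d : ℕ) :
    ∀ (F : Y × ℝ → ℝ), AnalyticOnNhd ℝ F W → (∃ y, (y, (0 : ℝ)) ∈ W ∧ lastDeriv^[d] F (y, 0) ≠ 0) →
      ∃ y0, (y0, (0 : ℝ)) ∈ W ∧ ∀ᶠ q in 𝓝 (y0, (0 : ℝ)), F q = 0 → q.2 = 0 := by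
  have base : ∀ (F : Y × ℝ → ℝ), AnalyticOnNhd ℝ F W → (∃ y, (y, (0 : ℝ)) ∈ W ∧ F (y, 0) ≠ 0) →
      ∃ y0, (y0, (0 : ℝ)) ∈ W ∧ ∀ᶠ q in 𝓝 (y0, (0 : ℝ)), F q = 0 → q.2 = 0 := by
    rintro F hF ⟨y, hy, hne⟩
    refine ⟨y, hy, ?_⟩
    filter_upwards [(hF _ hy).continuousAt.eventually_ne hne] with q hq h0
    exact absurd h0 hq
  induction d with
  | zero => exact base
  | succ d ih =>
    intro F hF hex
    obtain ⟨y0, hy0, hev⟩ := ih (lastDeriv F) hF.lastDeriv hex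
    obtain ⟨ε, hε, hball⟩ := Metric.eventually_nhds_iff_ball.1 (hev.and (hW.mem_nhds hy0))
    by_cases hz : ∃ y, y ∈ Metric.ball y0 ε ∧ F (y, 0) ≠ 0
    · obtain ⟨y, hy, hne⟩ := hz
      refine base F hF ⟨y, (hball (y, 0) ?_).2, hne⟩
      rw [Metric.mem_ball, Prod.dist_eq, max_lt_iff]
      exact ⟨hy, by simpa using hε⟩
    · push Not at hz
      refine ⟨y0, hy0, ?_⟩
      filter_upwards [Metric.ball_mem_nhds _ hε] with q hq hq0
      obtain ⟨y, s⟩ := q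
      rw [Metric.mem_ball, Prod.dist_eq, max_lt_iff] at hq
      by_contra hs
      replace hs : s ≠ 0 := hs
      have hmem : ∀ t ∈ uIcc 0 s, (y, t) ∈ Metric.ball (y0, (0 : ℝ)) ε := by
        intro t ht
        rw [Metric.mem_ball, Prod.dist_eq, max_lt_iff]
        refine ⟨hq.1, lt_of_le_of_lt ?_ hq.2⟩
        have := abs_sub_left_of_mem_uIcc ht
        simpa [Real.dist_eq] using this
      have hder : ∀ t ∈ uIcc 0 s, HasDerivAt (fun t => F (y, t)) (lastDeriv F (y, t)) t :=
        fun t ht => hasDerivAt_lastDeriv (hF _ (hball _ (hmem t ht)).2)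
      have h00 : F (y, 0) = 0 := hz y hq.1
      have hlt : min 0 s < max 0 s := min_lt_max.2 hs.symm
      have hends : F (y, min 0 s) = F (y, max 0 s) := by
        rcases le_total 0 s with h | h <;> simp [h, h00, hq0]
      obtain ⟨c, hc, hc0⟩ := exists_hasDerivAt_eq_zero (f := fun t => F (y, t))
        (f' := fun t => lastDeriv F (y, t)) hlt
        (fun t ht => (hder t ht).continuousAt.continuousWithinAt) hends
        (fun t ht => hder t (Ioo_subset_Icc_self ht))
      have := (hball _ (hmem c (Ioo_subset_Icc_self hc))).1 hc0
      replace this : c = 0 := this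
      subst this
      rcases le_total 0 s with h | h <;> simp [h] at hc

theorem exists_zero_subset_hyperplane {W : Set (Y × ℝ)} (hW : IsOpen W) (hWc : IsPreconnected W)
    {F : Y × ℝ → ℝ} (hF : AnalyticOnNhd ℝ F W) {y1 : Y} (hy1 : (y1, (0 : ℝ)) ∈ W)
    (hne : ∃ q ∈ W, F q ≠ 0) :
    ∃ y0, (y0, (0 : ℝ)) ∈ W ∧ ∀ᶠ q in 𝓝 (y0, (0 : ℝ)), F q = 0 → q.2 = 0 := by
  by_contra hcon
  have hall : ∀ d y, (y, (0 : ℝ)) ∈ W → lastDeriv^[d] F (y, 0) = 0 := by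
    intro d y hy
    by_contra h
    exact hcon (exists_zero_subset_of_lastDeriv_iterate_ne_zero hW d F hF ⟨y, hy, h⟩)
  obtain ⟨q, hq, hqne⟩ := hne
  refine hqne (hF.eqOn_zero_of_preconnected_of_eventuallyEq_zero hWc hy1 ?_ hq)
  obtain ⟨ε, hε, hball⟩ := Metric.eventually_nhds_iff_ball.1 (hW.mem_nhds hy1)
  filter_upwards [Metric.ball_mem_nhds _ hε] with q hq
  obtain ⟨y, s⟩ := q
  rw [Metric.mem_ball, Prod.dist_eq, max_lt_iff] at hq
  have hmem : ∀ t ∈ Metric.ball (0 : ℝ) ε, (y, t) ∈ W := by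
    intro t ht
    refine hball _ ?_
    rw [Metric.mem_ball, Prod.dist_eq, max_lt_iff]
    exact ⟨hq.1, ht⟩
  have han : AnalyticOnNhd ℝ (fun t => F (y, t)) (Metric.ball (0 : ℝ) ε) := fun t ht =>
    (hF _ (hmem t ht)).fun_comp (analyticAt_const.prod analyticAt_id)
  have hiter : ∀ d, ∀ t ∈ Metric.ball (0 : ℝ) ε,
      iteratedDeriv d (fun t => F (y, t)) t = lastDeriv^[d] F (y, t) := by
    intro d t ht
    refine iteratedDeriv_eq_lastDeriv_iterate d ?_
    filter_upwards [Metric.isOpen_ball.mem_nhds ht] with u hu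
    exact hF _ (hmem u hu)
  have h0 : (0 : ℝ) ∈ Metric.ball (0 : ℝ) ε := Metric.mem_ball_self hε
  have hzero : (fun t => F (y, t)) =ᶠ[𝓝 0] 0 := by
    have h1 := (han 0 h0).hasFPowerSeriesAt
    have h2 : FormalMultilinearSeries.ofScalars ℝ
        (fun n => iteratedDeriv n (fun t => F (y, t)) 0 / n.factorial) = 0 := by
      ext n
      simp [hiter n 0 h0, hall n y (hmem 0 h0)]
    rw [h2] at h1
    exact h1.eventually_eq_zero
  exact han.eqOn_zero_of_preconnected_of_eventuallyEq_zero
    (convex_ball _ _).isPreconnected h0 hzero hq.2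

end Rolle

/-! ### Zeros in a disc, power sums and Hankel determinants -/

section Zeros

theorem AnalyticOnNhd.finite_zeros_closedBall {f : ℂ → ℂ} {c : ℂ} {r : ℝ} (hr : 0 < r)
    (hf : AnalyticOnNhd ℂ f (Metric.closedBall c r)) (hne : ∀ z ∈ Metric.sphere c r, f z ≠ 0) :
    {z ∈ Metric.closedBall c r | f z = 0}.Finite := by
  by_contra hinf
  obtain ⟨x, hx, hacc⟩ := Set.Infinite.exists_accPt_of_subset_isCompact hinf
    (isCompact_closedBall c r) fun z hz => hz.1
  have hfr : ∃ᶠ z in 𝓝[≠] x, f z = 0 :=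
    (accPt_iff_frequently_nhdsNE.1 hacc).mono fun z hz => hz.2
  have h0 := hf.eqOn_zero_of_preconnected_of_frequently_eq_zero
    (convex_closedBall c r).isPreconnected hx hfr
  have hz : c + r ∈ Metric.sphere c r := by simp [abs_of_pos hr]
  exact hne _ hz (h0 (Metric.sphere_subset_closedBall hz))

theorem exists_eq_pow_mul_of_not_eventually_zero {g : ℂ → ℂ} {a : ℂ} {K : Set ℂ}
    (hg : AnalyticOnNhd ℂ g K) (ha : a ∈ K) (hz : ¬ ∀ᶠ z in 𝓝 a, g z = 0) :
    ∃ (k : ℕ) (g' : ℂ → ℂ), AnalyticOnNhd ℂ g' K ∧ g' a ≠ 0 ∧ ∀ z, g z = (z - a) ^ k * g' z := by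
  obtain ⟨k, g1, hg1, hne, hev⟩ := (hg a ha).exists_eventuallyEq_pow_smul_nonzero_iff.2 hz
  have hga : g a = (a - a) ^ k * g1 a := hev.self_of_nhds
  refine ⟨k, Function.update (fun z => g z / (z - a) ^ k) a (g1 a), ?_, by simpa using hne, ?_⟩
  · intro z hz
    by_cases hza : z = a
    · subst hza
      refine hg1.congr ?_
      filter_upwards [hev] with w hw
      by_cases hwz : w = z
      · subst hwz; simp
      · have : (w - z) ^ k ≠ 0 := pow_ne_zero _ (sub_ne_zero.2 hwz)
        simp [hwz, hw, this]
    · have : AnalyticAt ℂ (fun w => g w / (w - a) ^ k) z :=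
        (hg z hz).div (by fun_prop) (pow_ne_zero _ (sub_ne_zero.2 hza))
      refine this.congr ?_
      filter_upwards [eventually_ne_nhds hza] with w hw
      simp [hw]
  · intro z
    by_cases hza : z = a
    · subst hza; simpa using hga
    · have : (z - a) ^ k ≠ 0 := pow_ne_zero _ (sub_ne_zero.2 hza)
      simp [hza]
      field_simp

/-- The zeros of a holomorphic function in a disc can be factored out. -/
theorem AnalyticOnNhd.exists_factorization_closedBall {f : ℂ → ℂ} {c : ℂ} {r : ℝ} (hr : 0 < r)
    (hf : AnalyticOnNhd ℂ f (Metric.closedBall c r)) (hne : ∀ z ∈ Metric.sphere c r, f z ≠ 0) :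
    ∃ (S : Finset ℂ) (m : ℂ → ℕ) (g : ℂ → ℂ),
      (∀ z, z ∈ S ↔ z ∈ Metric.closedBall c r ∧ f z = 0) ∧ (∀ a ∈ S, 0 < m a) ∧
      AnalyticOnNhd ℂ g (Metric.closedBall c r) ∧ (∀ z ∈ Metric.closedBall c r, g z ≠ 0) ∧
      ∀ z, f z = (∏ a ∈ S, (z - a) ^ m a) * g z := by
  classical
  have hfin := hf.finite_zeros_closedBall hr hne
  have hsph : c + r ∈ Metric.sphere c r := by simp [abs_of_pos hr]
  have key : ∀ T : Finset ℂ, (∀ a ∈ T, a ∈ Metric.closedBall c r) → ∃ (m : ℂ → ℕ) (g : ℂ → ℂ),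
      AnalyticOnNhd ℂ g (Metric.closedBall c r) ∧ (∀ z ∈ T, g z ≠ 0) ∧
      ∀ z, f z = (∏ a ∈ T, (z - a) ^ m a) * g z := by
    intro T
    induction T using Finset.induction_on with
    | empty => intro _; exact ⟨fun _ => 0, f, hf, by simp, by simp⟩
    | insert b T hb ih =>
      intro hT
      obtain ⟨m, g, hg, hgT, hfg⟩ := ih fun a ha => hT a (Finset.mem_insert_of_mem ha)
      have hbK := hT b (Finset.mem_insert_self _ _)
      obtain ⟨k, g', hg', hne', heq⟩ := exists_eq_pow_mul_of_not_eventually_zero hg hbK (by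
        intro h
        have := hg.eqOn_zero_of_preconnected_of_eventuallyEq_zero
          (convex_closedBall c r).isPreconnected hbK h (Metric.sphere_subset_closedBall hsph)
        exact hne _ hsph (by rw [hfg, this]; simp))
      refine ⟨Function.update m b k, g', hg', ?_, ?_⟩
      · intro z hz
        rcases Finset.mem_insert.1 hz with rfl | hz
        · exact hne'
        · intro h
          exact hgT z hz (by rw [heq, h, mul_zero])
      · intro z
        rw [Finset.prod_insert hb, hfg, heq]
        simp only [Function.update_self]
        have : ∏ a ∈ T, (z - a) ^ Function.update m b k a = ∏ a ∈ T, (z - a) ^ m a :=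
          Finset.prod_congr rfl fun a ha => by
            rw [Function.update_of_ne (ne_of_mem_of_not_mem ha hb)]
        rw [this]
        ring
  obtain ⟨m, g, hg, hgT, hfg⟩ := key hfin.toFinset fun a ha => by
    exact ((hfin.mem_toFinset).1 ha).1
  refine ⟨hfin.toFinset, m, g, fun z => by simp, ?_, hg, ?_, hfg⟩
  · intro a ha
    rw [Nat.pos_iff_ne_zero]
    intro h0
    have hfa : f a = 0 := ((hfin.mem_toFinset).1 ha).2
    rw [hfg, mul_eq_zero, Finset.prod_eq_zero_iff] at hfa
    rcases hfa with ⟨b, hb, hab⟩ | h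
    · by_cases hba : a = b
      · subst hba; simp [h0] at hab
      · exact pow_ne_zero _ (sub_ne_zero.2 hba) hab
    · exact hgT a ha h
  · intro z hz h
    refine hgT z ?_ h
    rw [hfin.mem_toFinset]
    exact ⟨hz, by rw [hfg, h, mul_zero]⟩

/-- The `k`-th power sum of the zeros of `f` in a disc, as a contour integral. -/
def zeroPowerSum (c : ℂ) (r : ℝ) (f : ℂ → ℂ) (k : ℕ) : ℂ :=
  (2 * Real.pi * I)⁻¹ * ∮ z in C(c, r), z ^ k * logDeriv f z

theorem zeroPowerSum_eq {f g : ℂ → ℂ} {c : ℂ} {r : ℝ} (hr : 0 < r) {S : Finset ℂ} {m : ℂ → ℕ}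
    (hS : ∀ a ∈ S, a ∈ Metric.ball c r)
    (hg : AnalyticOnNhd ℂ g (Metric.closedBall c r)) (hgne : ∀ z ∈ Metric.closedBall c r, g z ≠ 0)
    (hfg : ∀ z, f z = (∏ a ∈ S, (z - a) ^ m a) * g z) (k : ℕ) :
    zeroPowerSum c r f k = ∑ a ∈ S, (m a : ℂ) * a ^ k := by
  have hlog : EqOn (fun z => z ^ k * logDeriv f z)
      (fun z => (∑ a ∈ S, (m a : ℂ) * ((z - a)⁻¹ * z ^ k)) + z ^ k * logDeriv g z)
      (Metric.sphere c r) := by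
    intro z hz
    have hza : ∀ a ∈ S, z - a ≠ 0 := by
      intro a ha h
      rw [sub_eq_zero] at h
      subst h
      exact absurd (Metric.mem_ball.1 (hS z ha)) (by rw [Metric.mem_sphere.1 hz]; exact lt_irrefl _)
    have hzK := Metric.sphere_subset_closedBall hz
    have hf' : f = fun z => (∏ a ∈ S, (z - a) ^ m a) * g z := funext hfg
    have h1 : logDeriv f z = logDeriv (fun z => ∏ a ∈ S, (z - a) ^ m a) z + logDeriv g z := by
      rw [hf']
      refine logDeriv_mul z ?_ (hgne z hzK) ?_ (hg z hzK).differentiableAt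
      · exact Finset.prod_ne_zero_iff.2 fun a ha => pow_ne_zero _ (hza a ha)
      · fun_prop
    have h2 : logDeriv (fun z => ∏ a ∈ S, (z - a) ^ m a) z = ∑ a ∈ S, (m a : ℂ) * (z - a)⁻¹ := by
      rw [logDeriv_prod]
      · refine Finset.sum_congr rfl fun a _ => ?_
        rw [logDeriv_fun_pow (by fun_prop)]
        simp [logDeriv]
      · exact fun a ha => pow_ne_zero _ (hza a ha)
      · intro a _; fun_prop
    simp only [h1, h2, mul_add, Finset.mul_sum]
    congr 1
    refine Finset.sum_congr rfl fun a _ => by ring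
  have hci : ∀ a ∈ S, CircleIntegrable (fun z => (m a : ℂ) * ((z - a)⁻¹ * z ^ k)) c r := by
    intro a ha
    refine ContinuousOn.circleIntegrable hr.le ?_
    refine continuousOn_const.mul (ContinuousOn.mul (ContinuousOn.inv₀ (by fun_prop) ?_)
      (by fun_prop))
    intro z hz h
    rw [sub_eq_zero] at h
    subst h
    exact absurd (Metric.mem_ball.1 (hS z ha)) (by rw [Metric.mem_sphere.1 hz]; exact lt_irrefl _)
  have hlg : AnalyticOnNhd ℂ (fun z => z ^ k * logDeriv g z) (Metric.closedBall c r) := by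
    intro z hz
    refine AnalyticAt.mul (by fun_prop) ?_
    exact (hg z hz).deriv.div (hg z hz) (hgne z hz)
  have hcg : CircleIntegrable (fun z => z ^ k * logDeriv g z) c r :=
    ContinuousOn.circleIntegrable hr.le
      (hlg.continuousOn.mono Metric.sphere_subset_closedBall)
  have hcg0 : (∮ z in C(c, r), z ^ k * logDeriv g z) = 0 :=
    Complex.circleIntegral_eq_zero_of_differentiable_on_off_countable hr.le countable_empty
      hlg.continuousOn fun z hz => (hlg z (Metric.ball_subset_closedBall hz.1)).differentiableAt
  have hcS : ∀ a ∈ S, (∮ z in C(c, r), (m a : ℂ) * ((z - a)⁻¹ * z ^ k)) =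
      (m a : ℂ) * ((2 * Real.pi * I) * a ^ k) := by
    intro a ha
    rw [circleIntegral.integral_const_mul]
    congr 1
    have := Complex.circleIntegral_sub_inv_smul_of_differentiable_on_off_countable
      (f := fun z : ℂ => z ^ k) countable_empty (hS a ha) (by fun_prop)
      fun z _ => by fun_prop
    simpa using this
  rw [zeroPowerSum, circleIntegral.integral_congr hr.le hlog, circleIntegral.integral_add
    (CircleIntegrable.fun_sum _ hci) hcg, hcg0, add_zero, circleIntegral.integral_fun_sum hci,
    Finset.sum_congr rfl hcS, Finset.mul_sum]
  refine Finset.sum_congr rfl fun a _ => ?_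
  have : (2 * Real.pi * I : ℂ) ≠ 0 := by simp [Real.pi_ne_zero]
  field_simp

/-- The Hankel determinant of the power sums. -/
def zeroHankel (c : ℂ) (r : ℝ) (f : ℂ → ℂ) (n : ℕ) : ℂ :=
  (Matrix.of fun i j : Fin n => zeroPowerSum c r f (i + j)).det

theorem det_powerSums_eq_zero {S : Finset ℂ} {m : ℂ → ℂ} {n : ℕ} (h : S.card < n) :
    (Matrix.of fun i j : Fin n => ∑ a ∈ S, m a * a ^ ((i : ℕ) + j)).det = 0 := by
  let V : Matrix S (Fin n) ℂ := Matrix.of fun a j => (a : ℂ) ^ (j : ℕ)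
  obtain ⟨v, hv, hv0⟩ := (Submodule.ne_bot_iff _).1
    (LinearMap.ker_ne_bot_of_finrank_lt (f := V.mulVecLin) (by simpa using h))
  replace hv : V.mulVec v = 0 := hv
  rw [← Matrix.exists_mulVec_eq_zero_iff]
  refine ⟨v, hv0, ?_⟩
  funext i
  simp only [Matrix.mulVec, dotProduct, Matrix.of_apply, Finset.sum_mul, Pi.zero_apply]
  rw [Finset.sum_comm]
  refine Finset.sum_eq_zero fun a ha => ?_
  have := congrFun hv ⟨a, ha⟩
  simp only [Matrix.mulVec, dotProduct, Matrix.of_apply, V, Pi.zero_apply] at this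
  calc ∑ j : Fin n, m a * a ^ ((i : ℕ) + j) * v j
      = m a * a ^ (i : ℕ) * ∑ j : Fin n, a ^ (j : ℕ) * v j := by
        rw [Finset.mul_sum]; exact Finset.sum_congr rfl fun j _ => by rw [pow_add]; ring
    _ = 0 := by rw [this, mul_zero]

theorem det_powerSums_ne_zero {S : Finset ℂ} {m : ℂ → ℂ} {n : ℕ} (h : S.card = n)
    (hm : ∀ a ∈ S, m a ≠ 0) :
    (Matrix.of fun i j : Fin n => ∑ a ∈ S, m a * a ^ ((i : ℕ) + j)).det ≠ 0 := by
  let e : Fin n ≃ S := (S.equivFinOfCardEq h).symm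
  have hM : (Matrix.of fun i j : Fin n => ∑ a ∈ S, m a * a ^ ((i : ℕ) + j)) =
      (Matrix.vandermonde fun i => (e i : ℂ)).transpose * Matrix.diagonal (fun i => m (e i)) *
        Matrix.vandermonde fun i => (e i : ℂ) := by
    ext i j
    rw [Matrix.mul_apply]
    simp only [Matrix.of_apply, Matrix.mul_diagonal, Matrix.transpose_apply,
      Matrix.vandermonde_apply]
    rw [← Finset.sum_coe_sort S, ← e.sum_comp]
    refine Finset.sum_congr rfl fun a _ => by rw [pow_add]; ring
  rw [hM, Matrix.det_mul, Matrix.det_mul, Matrix.det_transpose, Matrix.det_diagonal]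
  have hV : (Matrix.vandermonde fun i => (e i : ℂ)).det ≠ 0 :=
    Matrix.det_vandermonde_ne_zero_iff.2 (Subtype.val_injective.comp e.injective)
  exact mul_ne_zero (mul_ne_zero hV (Finset.prod_ne_zero_iff.2 fun i _ => hm _ (e i).2)) hV

end Zeros

/-! ### Holomorphic families of zeros -/

section ZeroFamilies

variable {E : Type*} [NormedAddCommGroup E] [NormedSpace ℂ E]

theorem differentiableAt_circleIntegral {G : E × ℂ → ℂ} {P : Set E} (hP : IsOpen P)
    {c : ℂ} {r : ℝ} (hr : 0 ≤ r) (hG : ∀ y ∈ P, ∀ z ∈ Metric.sphere c r, AnalyticAt ℂ G (y, z))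
    {y0 : E} (hy0 : y0 ∈ P) : DifferentiableAt ℂ (fun y => ∮ z in C(c, r), G (y, z)) y0 := by
  have hcm : Continuous (circleMap c r) := continuous_circleMap c r
  have hdm : Continuous (deriv (circleMap c r)) := by
    simp only [funext (deriv_circleMap c r)]
    fun_prop
  set g : E → ℝ → ℂ := fun y θ => deriv (circleMap c r) θ • G (y, circleMap c r θ) with hg
  set g' : E → ℝ → (E →L[ℂ] ℂ) := fun y θ => deriv (circleMap c r) θ •
    (fderiv ℂ G (y, circleMap c r θ)).comp (ContinuousLinearMap.inl ℂ E ℂ) with hg'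
  have hsph : ∀ θ, circleMap c r θ ∈ Metric.sphere c r := circleMap_mem_sphere c hr
  have hcont : ∀ y ∈ P, Continuous (g y) := by
    intro y hy
    rw [continuous_iff_continuousAt]
    intro θ
    refine hdm.continuousAt.smul ?_
    exact ContinuousAt.comp (g := G) (f := fun θ => (y, circleMap c r θ))
      (hG y hy _ (hsph θ)).continuousAt (by fun_prop)
  have hcont' : ∀ y ∈ P, ∀ θ, ContinuousAt (fun q : E × ℝ => g' q.1 q.2) (y, θ) := by
    intro y hy θ
    refine ContinuousAt.smul (hdm.continuousAt.comp continuousAt_snd) ?_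
    refine ContinuousAt.clm_comp ?_ continuousAt_const
    exact ContinuousAt.comp (g := fderiv ℂ G) (f := fun q : E × ℝ => (q.1, circleMap c r q.2))
      (hG y hy _ (hsph θ)).fderiv.continuousAt (by fun_prop)
  have hder : ∀ y ∈ P, ∀ θ, HasFDerivAt (fun y => g y θ) (g' y θ) y := by
    intro y hy θ
    have h1 : HasFDerivAt (fun y : E => (y, circleMap c r θ)) (ContinuousLinearMap.inl ℂ E ℂ) y :=
      (hasFDerivAt_id y).prodMk (hasFDerivAt_const _ _)
    have h2 : HasFDerivAt (fun y : E => G (y, circleMap c r θ))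
        ((fderiv ℂ G (y, circleMap c r θ)).comp (ContinuousLinearMap.inl ℂ E ℂ)) y :=
      ((hG y hy _ (hsph θ)).differentiableAt.hasFDerivAt).comp y h1
    exact h2.const_smul (deriv (circleMap c r) θ)
  have hc0 : Continuous (g' y0) := continuous_iff_continuousAt.2 fun θ =>
    ContinuousAt.comp (g := fun q : E × ℝ => g' q.1 q.2) (f := fun θ => (y0, θ))
      (hcont' y0 hy0 θ) (by fun_prop)
  obtain ⟨M, hM⟩ := (isCompact_Icc (a := (0 : ℝ)) (b := 2 * Real.pi)).exists_bound_of_continuousOn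
    hc0.continuousOn
  have hev : ∀ᶠ y in 𝓝 y0, ∀ θ ∈ Icc (0 : ℝ) (2 * Real.pi), ‖g' y θ‖ < M + 1 := by
    refine (isCompact_Icc (a := (0 : ℝ)) (b := 2 * Real.pi)).eventually_forall_of_forall_eventually ?_
    intro θ hθ
    exact (hcont' y0 hy0 θ).norm.eventually_lt_const
      (by have := hM θ hθ; simp only; linarith)
  have key := intervalIntegral.hasFDerivAt_integral_of_dominated_of_fderiv_le
    (𝕜 := ℂ) (μ := MeasureTheory.volume) (F := g) (F' := g') (x₀ := y0) (a := 0)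
    (b := 2 * Real.pi) (bound := fun _ => M + 1)
    (hev.and (hP.mem_nhds hy0))
    (by filter_upwards [hP.mem_nhds hy0] with y hy
        exact (hcont y hy).aestronglyMeasurable)
    ((hcont y0 hy0).intervalIntegrable _ _)
    hc0.aestronglyMeasurable
    (by
      refine Filter.Eventually.of_forall fun θ hθ y hy => (hy.1 θ ?_).le
      rw [uIoc_of_le (by positivity)] at hθ
      exact ⟨hθ.1.le, hθ.2⟩)
    intervalIntegrable_const
    (Filter.Eventually.of_forall fun θ _ y hy => hder y hy.2 θ)
  exact key.differentiableAt

variable {F : E × ℂ → ℂ} {P : Set E} {c : ℂ} {r : ℝ}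

/-- `F (y, ·)` is holomorphic near a fixed closed disc, without zeros on its boundary, for
parameters `y ∈ P`. -/
structure IsZeroFamily (F : E × ℂ → ℂ) (P : Set E) (c : ℂ) (r : ℝ) : Prop where
  isOpen : IsOpen P
  pos : 0 < r
  analyticAt : ∀ y ∈ P, ∀ z ∈ Metric.closedBall c r, AnalyticAt ℂ F (y, z)
  ne_zero : ∀ y ∈ P, ∀ z ∈ Metric.sphere c r, F (y, z) ≠ 0

/-- The number of distinct zeros of `f` in a closed disc. -/
def zeroCount (c : ℂ) (r : ℝ) (f : ℂ → ℂ) : ℕ := {z ∈ Metric.closedBall c r | f z = 0}.ncard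

theorem zeroHankel_eq_zero_of_lt {f : ℂ → ℂ} (hr : 0 < r)
    (hf : AnalyticOnNhd ℂ f (Metric.closedBall c r)) (hne : ∀ z ∈ Metric.sphere c r, f z ≠ 0)
    {n : ℕ} : (zeroCount c r f < n → zeroHankel c r f n = 0) ∧
      (zeroCount c r f = n → zeroHankel c r f n ≠ 0) := by
  obtain ⟨S, m, g, hS, hm, hg, hgne, hfg⟩ := hf.exists_factorization_closedBall hr hne
  have hSb : ∀ a ∈ S, a ∈ Metric.ball c r := by
    intro a ha
    obtain ⟨h1, h2⟩ := (hS a).1 ha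
    rcases (Metric.mem_closedBall.1 h1).lt_or_eq with h | h
    · exact h
    · exact absurd h2 (hne a h)
  have hcard : zeroCount c r f = S.card := by
    rw [zeroCount, ← Set.ncard_coe_finset]
    congr 1
    ext z
    simp [hS]
  simp only [zeroHankel, zeroPowerSum_eq hr hSb hg hgne hfg, hcard]
  exact ⟨det_powerSums_eq_zero, fun h => det_powerSums_ne_zero h fun a ha => by
    simpa using (hm a ha).ne'⟩

namespace IsZeroFamily

theorem analyticOnNhd (h : IsZeroFamily F P c r) {y : E} (hy : y ∈ P) :
    AnalyticOnNhd ℂ (fun z => F (y, z)) (Metric.closedBall c r) := fun z hz =>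
  AnalyticAt.fun_comp (g := F) (f := fun z => (y, z)) (h.analyticAt y hy z hz) (by fun_prop)

theorem finite_zeros (h : IsZeroFamily F P c r) {y : E} (hy : y ∈ P) :
    {z ∈ Metric.closedBall c r | F (y, z) = 0}.Finite :=
  (h.analyticOnNhd hy).finite_zeros_closedBall h.pos (h.ne_zero y hy)

theorem mem_ball (h : IsZeroFamily F P c r) {y : E} (hy : y ∈ P) {z : ℂ}
    (hz : z ∈ Metric.closedBall c r) (h0 : F (y, z) = 0) : z ∈ Metric.ball c r := by
  rcases (Metric.mem_closedBall.1 hz).lt_or_eq with h1 | h1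
  · exact h1
  · exact absurd h0 (h.ne_zero y hy z h1)

theorem differentiableOn_zeroPowerSum (h : IsZeroFamily F P c r) (k : ℕ) :
    DifferentiableOn ℂ (fun y => zeroPowerSum c r (fun z => F (y, z)) k) P := by
  intro y0 hy0
  refine DifferentiableAt.differentiableWithinAt ?_
  have h1 := differentiableAt_circleIntegral (G := fun q => q.2 ^ k * (lastDeriv F q / F q))
    h.isOpen h.pos.le (fun y hy z hz => by
      have ha := h.analyticAt y hy z (Metric.sphere_subset_closedBall hz)
      exact (analyticAt_snd.pow k).mul (ha.lastDeriv.div ha (h.ne_zero y hy z hz))) hy0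
  refine (h1.const_mul (2 * Real.pi * I)⁻¹).congr_of_eventuallyEq ?_
  filter_upwards [h.isOpen.mem_nhds hy0] with y hy
  rw [zeroPowerSum]
  congr 1
  refine circleIntegral.integral_congr h.pos.le fun z hz => ?_
  simp only [logDeriv, Pi.div_apply]
  rw [(hasDerivAt_lastDeriv (h.analyticAt y hy z (Metric.sphere_subset_closedBall hz))).deriv]

theorem differentiableOn_zeroHankel (h : IsZeroFamily F P c r) (n : ℕ) :
    DifferentiableOn ℂ (fun y => zeroHankel c r (fun z => F (y, z)) n) P := by
  simp only [zeroHankel, Matrix.det_apply']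
  refine DifferentiableOn.fun_sum fun σ _ => (differentiableOn_const _).mul ?_
  intro y hy
  have h1 := HasFDerivWithinAt.finsetProd (u := Finset.univ) (x := y) (s := P)
    (g := fun i : Fin n => fun y : E => zeroPowerSum c r (fun z => F (y, z)) (σ i + i))
    fun i _ => (h.differentiableOn_zeroPowerSum _ y hy).hasFDerivWithinAt
  refine h1.differentiableWithinAt.congr_of_eventuallyEq ?_ ?_ <;> simp

theorem le_zeroCount (h : IsZeroFamily F P c r) {y : E} (hy : y ∈ P) {n : ℕ}
    (hn : zeroHankel c r (fun z => F (y, z)) n ≠ 0) : n ≤ zeroCount c r fun z => F (y, z) := by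
  by_contra hlt
  exact hn ((zeroHankel_eq_zero_of_lt h.pos (h.analyticOnNhd hy) (h.ne_zero y hy)).1
    (not_le.1 hlt))

theorem zeroHankel_ne_zero (h : IsZeroFamily F P c r) {y : E} (hy : y ∈ P) :
    zeroHankel c r (fun z => F (y, z)) (zeroCount c r fun z => F (y, z)) ≠ 0 :=
  (zeroHankel_eq_zero_of_lt h.pos (h.analyticOnNhd hy) (h.ne_zero y hy)).2 rfl

end IsZeroFamily

end ZeroFamilies

/-! ### Holomorphic branches of zeros -/

section ZeroBranches

variable {E : Type*} [NormedAddCommGroup E] [NormedSpace ℂ E]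

theorem AnalyticAt.exists_implicit [CompleteSpace E] {f : E × ℂ → ℂ} {y0 : E} {a : ℂ}
    (hf : AnalyticAt ℂ f (y0, a)) (h0 : f (y0, a) = 0) (hd : _root_.lastDeriv f (y0, a) ≠ 0) :
    ∃ φ : E → ℂ, AnalyticAt ℂ φ y0 ∧ φ y0 = a ∧
      ∀ᶠ q in 𝓝 (y0, a), f q = 0 ↔ φ q.1 = q.2 := by
  have cdf : ContDiffAt ℂ ⊤ f (y0, a) := hf.contDiffAt
  have hinv : (fderiv ℂ f (y0, a) ∘L .inr ℂ E ℂ).IsInvertible := by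
    refine ⟨ContinuousLinearEquiv.unitsEquivAut ℂ (Units.mk0 _ hd), ?_⟩
    ext
    simp [_root_.lastDeriv]
  refine ⟨cdf.implicitFunction (by simp) hinv, ?_, cdf.implicitFunction_apply_self _ _, ?_⟩
  · exact (cdf.contDiffAt_implicitFunction (by simp) hinv).analyticAt
  · simpa [h0] using cdf.eventually_apply_eq_iff_implicitFunction (by simp) hinv

theorem iteratedDeriv_of_eq_pow_mul {f g : ℂ → ℂ} {a : ℂ} {m : ℕ} (hf : AnalyticAt ℂ f a)
    (hg : AnalyticAt ℂ g a) (hga : g a ≠ 0) (hfg : ∀ z, f z = (z - a) ^ m * g z) :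
    (∀ k < m, iteratedDeriv k f a = 0) ∧ iteratedDeriv m f a ≠ 0 := by
  refine (_root_.analyticOrderAt_eq_nat_iff_iteratedDeriv_eq_zero hf).1 ?_
  exact hf.analyticOrderAt_eq_natCast.2 ⟨g, hg, hga, Filter.Eventually.of_forall hfg⟩

namespace IsZeroFamily

variable {F : E × ℂ → ℂ} {P : Set E} {c : ℂ} {r : ℝ}

theorem exists_shrink (h : IsZeroFamily F P c r) {y0 : E} (hy0 : y0 ∈ P) {a : ℂ}
    (ha : a ∈ Metric.closedBall c r) (h0 : F (y0, a) = 0) {V : Set ℂ} (hV : V ∈ 𝓝 a) :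
    ∃ P' ρ, y0 ∈ P' ∧ IsZeroFamily F P' a ρ ∧ Metric.closedBall a ρ ⊆ V ∩ Metric.ball c r ∧
      ∀ z ∈ Metric.closedBall a ρ, F (y0, z) = 0 → z = a := by
  have hball := h.mem_ball hy0 ha h0
  have hiso : ∀ᶠ z in 𝓝 a, F (y0, z) = 0 → z = a := by
    have hfin := (h.finite_zeros hy0).subset
      (t := {z ∈ Metric.closedBall c r | F (y0, z) = 0} \ {a}) sdiff_subset
    filter_upwards [hfin.isClosed.isOpen_compl.mem_nhds (x := a) (by simp),
      Metric.isOpen_ball.mem_nhds hball] with z hz hzb h0z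
    by_contra hza
    exact hz ⟨⟨Metric.ball_subset_closedBall hzb, h0z⟩, hza⟩
  obtain ⟨ρ, hρ, hsub⟩ := Metric.nhds_basis_closedBall.mem_iff.1
    (Filter.inter_mem (Filter.inter_mem hV (Metric.isOpen_ball.mem_nhds hball)) hiso)
  have hev : ∀ᶠ y in 𝓝 y0, ∀ z ∈ Metric.sphere a ρ, F (y, z) ≠ 0 := by
    refine (isCompact_sphere a ρ).eventually_forall_of_forall_eventually fun z hz => ?_
    have hzc := hsub (Metric.sphere_subset_closedBall hz)
    refine ((h.analyticAt y0 hy0 z (Metric.ball_subset_closedBall hzc.1.2)).continuousAt).eventually_ne ?_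
    intro h0z
    have := hzc.2 h0z
    subst this
    rw [mem_sphere_iff_norm, sub_self, norm_zero] at hz
    exact hρ.ne hz
  obtain ⟨P', hP'sub, hP'o, hyP'⟩ := mem_nhds_iff.1 (Filter.inter_mem hev (h.isOpen.mem_nhds hy0))
  refine ⟨P', ρ, hyP', ⟨hP'o, hρ, ?_, fun y hy => (hP'sub hy).1⟩, fun z hz => (hsub hz).1,
    fun z hz => (hsub hz).2⟩
  exact fun y hy z hz => h.analyticAt y (hP'sub hy).2 z
    (Metric.ball_subset_closedBall (hsub hz).1.2)

theorem eventually_exists_zero (h : IsZeroFamily F P c r) {y0 : E} (hy0 : y0 ∈ P) {a : ℂ}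
    (ha : a ∈ Metric.closedBall c r) (h0 : F (y0, a) = 0)
    (huniq : ∀ z ∈ Metric.closedBall c r, F (y0, z) = 0 → z = a) :
    ∀ᶠ y in 𝓝 y0, ∃ z ∈ Metric.closedBall c r, F (y, z) = 0 := by
  have hcount : zeroCount c r (fun z => F (y0, z)) = 1 := by
    rw [zeroCount, Set.ncard_eq_one]
    refine ⟨a, Set.Subset.antisymm (fun z hz => huniq z hz.1 hz.2) ?_⟩
    rintro z rfl
    exact ⟨ha, h0⟩
  have hne := h.zeroHankel_ne_zero hy0
  rw [hcount] at hne
  have hc := ((h.differentiableOn_zeroHankel 1).continuousOn.continuousAt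
    (h.isOpen.mem_nhds hy0)).eventually_ne hne
  filter_upwards [hc, h.isOpen.mem_nhds hy0] with y hy hyP
  have := h.le_zeroCount hyP hy
  have h1 : {z ∈ Metric.closedBall c r | F (y, z) = 0}.Nonempty :=
    (Set.ncard_pos (h.finite_zeros hyP)).1 this
  exact h1

theorem analyticAt_of_unique [CompleteSpace E] (h : IsZeroFamily F P c r) {y0 : E} (hy0 : y0 ∈ P)
    {ψ : E → ℂ} (hψ : ∀ᶠ y in 𝓝 y0, ψ y ∈ Metric.closedBall c r ∧ F (y, ψ y) = 0 ∧
      ∀ z ∈ Metric.closedBall c r, F (y, z) = 0 → z = ψ y) : AnalyticAt ℂ ψ y0 := by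
  have hfac : ∀ᶠ y in 𝓝 y0, ∃ (m : ℕ) (g : ℂ → ℂ), 0 < m ∧
      (∀ z ∈ Metric.closedBall c r, AnalyticAt ℂ g z) ∧ (∀ z ∈ Metric.closedBall c r, g z ≠ 0) ∧
      (∀ z, F (y, z) = (z - ψ y) ^ m * g z) ∧
      ∀ k, zeroPowerSum c r (fun z => F (y, z)) k = m * ψ y ^ k := by
    filter_upwards [hψ, h.isOpen.mem_nhds hy0] with y hy hyP
    obtain ⟨S, m, g, hS, hm, hg, hgne, hfg⟩ :=
      (h.analyticOnNhd hyP).exists_factorization_closedBall h.pos (h.ne_zero y hyP)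
    have hS1 : S = {ψ y} := by
      ext z
      rw [hS, Finset.mem_singleton]
      exact ⟨fun hz => hy.2.2 z hz.1 hz.2, by rintro rfl; exact ⟨hy.1, hy.2.1⟩⟩
    have hp := zeroPowerSum_eq h.pos (fun a ha => h.mem_ball hyP ((hS a).1 ha).1 ((hS a).1 ha).2)
      hg hgne hfg
    subst hS1
    exact ⟨m (ψ y), g, hm _ (by simp), hg, hgne, by simpa using hfg, by simpa using hp⟩
  obtain ⟨m, g, hm, hg, hgne, hfg, hp⟩ := hfac.self_of_nhds
  have hcont : ∀ k, ContinuousAt (fun y => zeroPowerSum c r (fun z => F (y, z)) k) y0 := fun k =>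
    (h.differentiableOn_zeroPowerSum k).continuousOn.continuousAt (h.isOpen.mem_nhds hy0)
  have hconst : ∀ᶠ y in 𝓝 y0, ∃ g : ℂ → ℂ,
      (∀ z ∈ Metric.closedBall c r, AnalyticAt ℂ g z) ∧ (∀ z ∈ Metric.closedBall c r, g z ≠ 0) ∧
      (∀ z, F (y, z) = (z - ψ y) ^ m * g z) ∧
      ∀ k, zeroPowerSum c r (fun z => F (y, z)) k = m * ψ y ^ k := by
    filter_upwards [hfac, Metric.tendsto_nhds.1 (hcont 0) 1 one_pos] with y hy hdist
    obtain ⟨m', g', hm', hg', hgne', hfg', hp'⟩ := hy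
    rw [hp', hp, pow_zero, pow_zero, mul_one, mul_one] at hdist
    have : m' = m := by
      rw [dist_eq_norm] at hdist
      have h1 : ‖(((m' : ℤ) - (m : ℤ) : ℤ) : ℂ)‖ < 1 := by push_cast; exact hdist
      rw [Complex.norm_intCast] at h1
      have h2 : |(m' : ℤ) - m| < 1 := by exact_mod_cast h1
      have := abs_lt.1 h2
      omega
    subst this
    exact ⟨g', hg', hgne', hfg', hp'⟩
  have hm0 : (m : ℂ) ≠ 0 := by exact_mod_cast hm.ne'
  have hψc : ContinuousAt ψ y0 := by
    have : ContinuousAt (fun y => zeroPowerSum c r (fun z => F (y, z)) 1 / m) y0 :=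
      (hcont 1).div_const _
    refine this.congr ?_
    filter_upwards [hconst] with y hy
    obtain ⟨g', -, -, -, hp'⟩ := hy
    rw [hp', pow_one]
    field_simp
  have hder : ∀ᶠ y in 𝓝 y0, (∀ k < m, lastDeriv^[k] F (y, ψ y) = 0) ∧
      lastDeriv^[m] F (y, ψ y) ≠ 0 := by
    filter_upwards [hconst, hψ, h.isOpen.mem_nhds hy0] with y hy hyψ hyP
    obtain ⟨g', hg', hgne', hfg', -⟩ := hy
    have hFy : ∀ᶠ t in 𝓝 (ψ y), AnalyticAt ℂ F (y, t) := by
      filter_upwards [Metric.isOpen_ball.mem_nhds (h.mem_ball hyP hyψ.1 hyψ.2.1)] with t ht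
      exact h.analyticAt y hyP t (Metric.ball_subset_closedBall ht)
    have := iteratedDeriv_of_eq_pow_mul (h.analyticOnNhd hyP _ hyψ.1) (hg' _ hyψ.1)
      (hgne' _ hyψ.1) hfg'
    simpa only [iteratedDeriv_eq_lastDeriv_iterate _ hFy] using this
  obtain ⟨d, rfl⟩ : ∃ d, m = d + 1 := ⟨m - 1, by omega⟩
  have han : AnalyticAt ℂ F (y0, ψ y0) := h.analyticAt y0 hy0 _ hψ.self_of_nhds.1
  obtain ⟨φ, hφ, -, hiff⟩ := (han.lastDeriv_iterate d).exists_implicit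
    (hder.self_of_nhds.1 d (by omega))
    (by simpa only [Function.iterate_succ_apply'] using hder.self_of_nhds.2)
  refine hφ.congr ?_
  have ht : Tendsto (fun y => (y, ψ y)) (𝓝 y0) (𝓝 (y0, ψ y0)) :=
    (continuousAt_id.prodMk hψc)
  filter_upwards [ht.eventually hiff, hder] with y hy hyd
  exact hy.1 (hyd.1 d (by omega))

/-- Where the number of distinct zeros has a local maximum, the zeros are given by holomorphic
functions of the parameter. -/
theorem exists_branches [CompleteSpace E] (h : IsZeroFamily F P c r) {y0 : E} (hy0 : y0 ∈ P)
    (hmax : ∀ᶠ y in 𝓝 y0, zeroCount c r (fun z => F (y, z)) ≤ zeroCount c r fun z => F (y0, z)) :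
    ∃ (S : Finset ℂ) (ψ : ℂ → E → ℂ), (∀ a ∈ S, AnalyticAt ℂ (ψ a) y0) ∧
      ∀ᶠ y in 𝓝 y0, (∀ a ∈ S, ψ a y ∈ Metric.ball c r ∧ F (y, ψ a y) = 0) ∧
        ∀ z ∈ Metric.closedBall c r, F (y, z) = 0 → ∃ a ∈ S, z = ψ a y := by
  classical
  set S := (h.finite_zeros hy0).toFinset with hS
  have hmem : ∀ a, a ∈ S ↔ a ∈ Metric.closedBall c r ∧ F (y0, a) = 0 := fun a => by simp [hS]
  obtain ⟨V, hV, hdisj⟩ := (h.finite_zeros hy0).t2_separation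
  have hsh : ∀ a, ∃ P' ρ, a ∈ S → y0 ∈ P' ∧ IsZeroFamily F P' a ρ ∧
      Metric.closedBall a ρ ⊆ V a ∩ Metric.ball c r ∧
      ∀ z ∈ Metric.closedBall a ρ, F (y0, z) = 0 → z = a := by
    intro a
    by_cases ha : a ∈ S
    · obtain ⟨P', ρ, hh⟩ := h.exists_shrink hy0 ((hmem a).1 ha).1 ((hmem a).1 ha).2
        ((hV a).2.mem_nhds (hV a).1)
      exact ⟨P', ρ, fun _ => hh⟩
    · exact ⟨∅, 0, fun h => absurd h ha⟩
  choose P' ρ hP' using hsh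
  let ψ : ℂ → E → ℂ := fun a y =>
    if hz : ∃ z ∈ Metric.closedBall a (ρ a), F (y, z) = 0 then hz.choose else a
  have hex : ∀ᶠ y in 𝓝 y0, ∀ a ∈ S, ψ a y ∈ Metric.closedBall a (ρ a) ∧ F (y, ψ a y) = 0 := by
    rw [Filter.eventually_all_finset]
    intro a ha
    obtain ⟨h1, h2, h3, h4⟩ := hP' a ha
    filter_upwards [h2.eventually_exists_zero h1 (Metric.mem_closedBall_self h2.pos.le)
      ((hmem a).1 ha).2 h4] with y hy
    have : ψ a y = hy.choose := dif_pos hy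
    rw [this]
    exact hy.choose_spec
  have hall : ∀ᶠ y in 𝓝 y0, (∀ a ∈ S, ψ a y ∈ Metric.closedBall a (ρ a) ∧ F (y, ψ a y) = 0) ∧
      ∀ z ∈ Metric.closedBall c r, F (y, z) = 0 → ∃ a ∈ S, z = ψ a y := by
    filter_upwards [hex, hmax, h.isOpen.mem_nhds hy0] with y hy hle hyP
    refine ⟨hy, ?_⟩
    have hfin := h.finite_zeros hyP
    have hcS : S.card = zeroCount c r fun z => F (y0, z) := by
      rw [zeroCount, Set.ncard_eq_toFinset_card _ (h.finite_zeros hy0)]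
    have hcy : hfin.toFinset.card = zeroCount c r fun z => F (y, z) := by
      rw [zeroCount, Set.ncard_eq_toFinset_card _ hfin]
    have hinj : Set.InjOn (fun a => ψ a y) S := by
      intro a ha b hb hab
      by_contra hne
      have h1 := ((hP' a ha).2.2.1 (hy a ha).1).1
      have h2 := ((hP' b hb).2.2.1 (hy b hb).1).1
      simp only at hab
      rw [← hab] at h2
      exact Set.disjoint_left.1 (hdisj ((hmem a).1 ha) ((hmem b).1 hb) hne) h1 h2
    have hmaps : Set.MapsTo (fun a => ψ a y) S hfin.toFinset := by
      intro a ha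
      simp only [Set.Finite.coe_toFinset]
      exact ⟨Metric.ball_subset_closedBall ((hP' a ha).2.2.1 (hy a ha).1).2, (hy a ha).2⟩
    have hsurj := Finset.surjOn_of_injOn_of_card_le _ hmaps hinj (by rw [hcS, hcy]; exact hle)
    intro z hz hz0
    obtain ⟨a, ha, haz⟩ := hsurj (a := z) (by simpa using ⟨by simpa using hz, hz0⟩)
    exact ⟨a, ha, haz.symm⟩
  refine ⟨S, ψ, fun a ha => ?_, ?_⟩
  · obtain ⟨h1, h2, h3, h4⟩ := hP' a ha
    refine h2.analyticAt_of_unique h1 ?_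
    filter_upwards [hall] with y hy
    refine ⟨(hy.1 a ha).1, (hy.1 a ha).2, fun z hz hz0 => ?_⟩
    obtain ⟨b, hb, rfl⟩ := hy.2 z (Metric.ball_subset_closedBall (h3 hz).2) hz0
    by_contra hne
    have hab : a ≠ b := by rintro rfl; exact hne rfl
    exact Set.disjoint_left.1 (hdisj ((hmem a).1 ha) ((hmem b).1 hb) hab) (h3 hz).1
      ((hP' b hb).2.2.1 (hy.1 b hb).1).1
  · filter_upwards [hall] with y hy
    exact ⟨fun a ha => ⟨((hP' a ha).2.2.1 (hy.1 a ha).1).2, (hy.1 a ha).2⟩, hy.2⟩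

end IsZeroFamily

end ZeroBranches

theorem Convex.isPreconnected_diff_countable {D S : Set ℂ} (hD : Convex ℝ D) (hDo : IsOpen D)
    (hS : S.Countable) : IsPreconnected (D \ S) := by
  refine isPreconnected_of_forall_pair fun a ha b hb => ?_
  rcases eq_or_ne a b with rfl | hab
  · exact ⟨{a}, by simpa using ha, rfl, rfl, isPreconnected_singleton⟩
  let c := (2 : ℝ)⁻¹ • (a + b)
  let x := (2 : ℝ)⁻¹ • (b - a)
  have Ia : c - x = a := by simp only [c, x]; module
  have Ib : c + x = b := by simp only [c, x]; module
  have x_ne_zero : x ≠ 0 := by simpa [x] using sub_ne_zero.2 hab.symm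
  obtain ⟨y, hy⟩ : ∃ y, LinearIndependent ℝ ![x, y] :=
    exists_linearIndependent_pair_of_one_lt_rank (by rw [Complex.rank_real_complex]; norm_num)
      x_ne_zero
  have A : Set.Countable {t : ℝ | (segment ℝ (c + x) (c + t • y) ∩ S).Nonempty} := by
    apply countable_ofPred_nonempty_of_disjoint _ (fun t ↦ inter_subset_right) hS
    intro t t' htt'
    apply disjoint_iff_inter_eq_empty.2
    have N : {c + x} ∩ S = ∅ := by
      simpa only [singleton_inter_eq_empty, mem_compl_iff, Ib] using hb.2
    rw [inter_assoc, inter_comm S, inter_assoc, inter_self, ← inter_assoc, ← subset_empty_iff, ← N]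
    apply inter_subset_inter_left
    apply Eq.subset
    apply segment_inter_eq_endpoint_of_linearIndependent_of_ne hy htt'.symm
  have B : Set.Countable {t : ℝ | (segment ℝ (c - x) (c + t • y) ∩ S).Nonempty} := by
    apply countable_ofPred_nonempty_of_disjoint _ (fun t ↦ inter_subset_right) hS
    intro t t' htt'
    apply disjoint_iff_inter_eq_empty.2
    have N : {c - x} ∩ S = ∅ := by
      simpa only [singleton_inter_eq_empty, mem_compl_iff, Ia] using ha.2
    rw [inter_assoc, inter_comm S, inter_assoc, inter_self, ← inter_assoc, ← subset_empty_iff, ← N]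
    apply inter_subset_inter_left
    rw [sub_eq_add_neg _ x]
    apply Eq.subset
    apply segment_inter_eq_endpoint_of_linearIndependent_of_ne _ htt'.symm
    convert! hy.units_smul ![-1, 1]
    simp [← List.ofFn_inj]
  have hcD : c ∈ D := by
    have := hD ha.1 hb.1 (a := 2⁻¹) (b := 2⁻¹) (by norm_num) (by norm_num) (by norm_num)
    simpa only [c, smul_add] using this
  have hopen : IsOpen {t : ℝ | c + t • y ∈ D} := hDo.preimage (by fun_prop)
  obtain ⟨t, htD, ht⟩ := ((A.union B).dense_compl ℝ).inter_open_nonempty _ hopen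
    ⟨0, by simpa using hcD⟩
  simp only [compl_union, mem_inter_iff, mem_compl_iff, mem_ofPred_eq, not_nonempty_iff_eq_empty]
    at ht
  have ha' : segment ℝ (c - x) (c + t • y) ⊆ D \ S := fun z hz =>
    ⟨hD.segment_subset (by rw [Ia]; exact ha.1) htD hz, fun hzS => by
      have : z ∈ (∅ : Set ℂ) := ht.2 ▸ ⟨hz, hzS⟩
      exact this⟩
  have hb' : segment ℝ (c + x) (c + t • y) ⊆ D \ S := fun z hz =>
    ⟨hD.segment_subset (by rw [Ib]; exact hb.1) htD hz, fun hzS => by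
      have : z ∈ (∅ : Set ℂ) := ht.1 ▸ ⟨hz, hzS⟩
      exact this⟩
  refine ⟨segment ℝ (c - x) (c + t • y) ∪ segment ℝ (c + x) (c + t • y), union_subset ha' hb',
    .inl (Ia ▸ left_mem_segment ℝ _ _), .inr (Ib ▸ left_mem_segment ℝ _ _), ?_⟩
  exact IsPreconnected.union (c + t • y) (right_mem_segment ℝ _ _) (right_mem_segment ℝ _ _)
    (convex_segment _ _).isPreconnected (convex_segment _ _).isPreconnected

theorem exists_subset_of_subset_iUnion_inter {X ι : Type*} [TopologicalSpace X] (S : Finset ι)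
    (C O : ι → Set X) {N : Set X} (hN : IsOpen N) (hne : N.Nonempty)
    (hC : ∀ a ∈ S, IsOpen (N \ C a)) (hO : ∀ a ∈ S, IsOpen (N ∩ O a))
    (hcov : ∀ x ∈ N, ∃ a ∈ S, x ∈ C a ∧ x ∈ O a) :
    ∃ a ∈ S, ∃ M ⊆ N, IsOpen M ∧ M.Nonempty ∧ M ⊆ C a ∩ O a := by
  classical
  induction S using Finset.induction_on generalizing N with
  | empty => obtain ⟨x, hx⟩ := hne; simpa using hcov x hx
  | insert a S _ ih =>
    have hCa := hC a (Finset.mem_insert_self a S)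
    have hOa := hO a (Finset.mem_insert_self a S)
    by_cases h1 : (N ∩ O a).Nonempty
    · by_cases h2 : ((N ∩ O a) \ C a).Nonempty
      · have hN'eq : (N ∩ O a) \ C a = (N ∩ O a) ∩ (N \ C a) := by
          ext x; simp only [Set.mem_sdiff, Set.mem_inter_iff]; tauto
        have hN' : IsOpen ((N ∩ O a) \ C a) := hN'eq ▸ hOa.inter hCa
        have hsub : (N ∩ O a) \ C a ⊆ N := fun x hx => hx.1.1
        obtain ⟨b, hb, M, hM, h⟩ := ih hN' h2
          (fun b hb => by
            have : ((N ∩ O a) \ C a) \ C b = ((N ∩ O a) \ C a) ∩ (N \ C b) := by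
              ext x; simp only [Set.mem_sdiff, Set.mem_inter_iff]; tauto
            rw [this]; exact hN'.inter (hC b (Finset.mem_insert_of_mem hb)))
          (fun b hb => by
            have : ((N ∩ O a) \ C a) ∩ O b = ((N ∩ O a) \ C a) ∩ (N ∩ O b) := by
              ext x; simp only [Set.mem_sdiff, Set.mem_inter_iff]; tauto
            rw [this]; exact hN'.inter (hO b (Finset.mem_insert_of_mem hb)))
          (fun x hx => by
            obtain ⟨b, hb, hxb⟩ := hcov x (hsub hx)
            rcases Finset.mem_insert.1 hb with rfl | hb
            · exact absurd hxb.1 hx.2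
            · exact ⟨b, hb, hxb⟩)
        exact ⟨b, Finset.mem_insert_of_mem hb, M, hM.trans hsub, h⟩
      · refine ⟨a, Finset.mem_insert_self a S, N ∩ O a, inter_subset_left, hOa, h1, fun x hx => ?_⟩
        refine ⟨?_, hx.2⟩
        by_contra hxC
        exact h2 ⟨x, hx, hxC⟩
    · obtain ⟨b, hb, h⟩ := ih hN hne (fun b hb => hC b (Finset.mem_insert_of_mem hb))
        (fun b hb => hO b (Finset.mem_insert_of_mem hb)) (fun x hx => by
          obtain ⟨b, hb, hxb⟩ := hcov x hx
          rcases Finset.mem_insert.1 hb with rfl | hb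
          · exact absurd ⟨x, hx, hxb.2⟩ h1
          · exact ⟨b, hb, hxb⟩)
      exact ⟨b, Finset.mem_insert_of_mem hb, h⟩

theorem AnalyticAt.exists_local_inverse {𝕜 E F : Type*} [RCLike 𝕜] [NormedAddCommGroup E]
    [NormedSpace 𝕜 E] [CompleteSpace E] [NormedAddCommGroup F] [NormedSpace 𝕜 F]
    [CompleteSpace F] {Φ : E → F} {z0 : E} (hΦ : AnalyticAt 𝕜 Φ z0) {L : E ≃L[𝕜] F}
    (hL : HasFDerivAt Φ (L : E →L[𝕜] F) z0) :
    ∃ Ψ : F → E, AnalyticAt 𝕜 Ψ (Φ z0) ∧ Ψ (Φ z0) = z0 ∧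
      HasFDerivAt Ψ (L.symm : F →L[𝕜] E) (Φ z0) ∧
      (∀ᶠ y in 𝓝 (Φ z0), Φ (Ψ y) = y) ∧ ∀ᶠ x in 𝓝 z0, Ψ (Φ x) = x := by
  have hc : ContDiffAt 𝕜 ⊤ Φ z0 := hΦ.contDiffAt
  have hs : HasStrictFDerivAt Φ (L : E →L[𝕜] F) z0 := hc.hasStrictFDerivAt' hL (by simp)
  refine ⟨hs.localInverse Φ L z0, ?_, hs.localInverse_apply_image, ?_,
    hs.eventually_right_inverse, hs.eventually_left_inverse⟩
  · exact (hc.to_localInverse hL (by simp)).analyticAt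
  · exact hs.to_localInverse.hasFDerivAt

theorem AnalyticAt.exists_linear_straightening {𝕜 E F : Type*} [RCLike 𝕜] [NormedAddCommGroup E]
    [NormedSpace 𝕜 E] [CompleteSpace E] [NormedAddCommGroup F] [NormedSpace 𝕜 F] {f : E → F}
    {z0 : E} (hf : AnalyticAt 𝕜 f z0) {S : F →L[𝕜] E} (hS : ∀ w, fderiv 𝕜 f z0 (S w) = w) :
    ∃ Ψ Χ : E → E, AnalyticAt 𝕜 Ψ z0 ∧ AnalyticAt 𝕜 Χ z0 ∧ Ψ z0 = z0 ∧ Χ z0 = z0 ∧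
      HasFDerivAt Ψ (.id 𝕜 E) z0 ∧ HasFDerivAt Χ (.id 𝕜 E) z0 ∧
      (∀ᶠ y in 𝓝 z0, Χ (Ψ y) = y) ∧ (∀ᶠ z in 𝓝 z0, Ψ (Χ z) = z) ∧
      (∀ᶠ y in 𝓝 z0, f (Ψ y) = f z0 + fderiv 𝕜 f z0 (y - z0)) ∧
      ∀ z, fderiv 𝕜 f z0 (Χ z - z0) = f z - f z0 := by
  set l := fderiv 𝕜 f z0 with hl
  set Φ : E → E := fun z => z + S (f z - f z0 - l (z - z0)) with hΦdef
  have hΦ0 : Φ z0 = z0 := by simp [hΦdef]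
  have hlan : AnalyticAt 𝕜 (fun z => l (z - z0)) z0 :=
    (l.analyticAt _).comp (analyticAt_id.sub analyticAt_const)
  have hΦ : AnalyticAt 𝕜 Φ z0 :=
    analyticAt_id.add ((S.analyticAt _).comp ((hf.sub analyticAt_const).sub hlan))
  have hder : HasFDerivAt Φ ((ContinuousLinearEquiv.refl 𝕜 E : E ≃L[𝕜] E) : E →L[𝕜] E) z0 := by
    have h1 : HasFDerivAt (fun z => l (z - z0)) l z0 :=
      l.hasFDerivAt.comp z0 ((hasFDerivAt_id z0).sub_const z0)
    have h2 := S.hasFDerivAt.comp z0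
      ((hf.differentiableAt.hasFDerivAt.sub_const (f z0)).sub h1)
    have h3 := (hasFDerivAt_id z0).add h2
    refine h3.congr_fderiv ?_
    ext u
    simp [hl]
  obtain ⟨Ψ, hΨ, hΨ0, hΨd, hr, hli⟩ := hΦ.exists_local_inverse hder
  rw [hΦ0] at hΨ hΨ0 hΨd hr
  have hlΦ : ∀ z, l (Φ z - z0) = f z - f z0 := fun z => by
    have : Φ z - z0 = (z - z0) + S (f z - f z0 - l (z - z0)) := by simp only [hΦdef]; abel
    rw [this, map_add, hS]
    abel
  refine ⟨Ψ, Φ, hΨ, hΦ, hΨ0, hΦ0, hΨd, hder, hr, hli, ?_, hlΦ⟩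
  filter_upwards [hr] with y hy
  have := hlΦ (Ψ y)
  rw [hy] at this
  rw [this]; abel

theorem AnalyticAt.exists_straightening {E : Type*} [NormedAddCommGroup E]
    [NormedSpace ℂ E] [CompleteSpace E] {f : E → ℂ} {z0 : E} (hf : AnalyticAt ℂ f z0)
    (hd : fderiv ℂ f z0 ≠ 0) :
    ∃ Ψ : E → E, AnalyticAt ℂ Ψ z0 ∧ Ψ z0 = z0 ∧ HasFDerivAt Ψ (.id ℂ E) z0 ∧
      (∀ᶠ y in 𝓝 z0, f (Ψ y) = f z0 + fderiv ℂ f z0 (y - z0)) ∧ map Ψ (𝓝 z0) = 𝓝 z0 := by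
  obtain ⟨v, hv⟩ : ∃ v, fderiv ℂ f z0 v = 1 := by
    obtain ⟨u, hu⟩ : ∃ u, fderiv ℂ f z0 u ≠ 0 := by
      by_contra! h
      exact hd (ContinuousLinearMap.ext h)
    exact ⟨(fderiv ℂ f z0 u)⁻¹ • u, by simp [hu]⟩
  obtain ⟨Ψ, -, hΨ, -, hΨ0, -, hΨd, -, -, -, hfΨ, -⟩ :=
    hf.exists_linear_straightening (S := (ContinuousLinearMap.id ℂ ℂ).smulRight v)
      (fun w => by simp [hv])
  refine ⟨Ψ, hΨ, hΨ0, hΨd, hfΨ, ?_⟩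
  have hs : HasStrictFDerivAt Ψ (ContinuousLinearMap.id ℂ E) z0 :=
    (hΨ.contDiffAt (n := ⊤)).hasStrictFDerivAt' hΨd (by simp)
  rw [hs.map_nhds_eq_of_surj (LinearMap.range_eq_top.2 Function.surjective_id), hΨ0]

/-- A holomorphic map vanishing on a smooth Levi-flat hypersurface vanishes. -/
theorem AnalyticAt.eventually_eq_zero_of_im_eq_zero {E G : Type*} [NormedAddCommGroup E]
    [NormedSpace ℂ E] [CompleteSpace E] [NormedAddCommGroup G] [NormedSpace ℂ G] [CompleteSpace G]
    {f : E → ℂ} {K : E → G} {z0 : E} (hf : AnalyticAt ℂ f z0) (hd : fderiv ℂ f z0 ≠ 0)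
    (h0 : (f z0).im = 0) (hK : ∀ᶠ z in 𝓝 z0, DifferentiableAt ℂ K z)
    (h : ∀ᶠ z in 𝓝 z0, (f z).im = 0 → K z = 0) : ∀ᶠ z in 𝓝 z0, K z = 0 := by
  obtain ⟨Ψ, hΨ, hΨ0, hΨd, hfΨ, hmap⟩ := hf.exists_straightening hd
  have hlim : Tendsto Ψ (𝓝 z0) (𝓝 z0) := hmap.le
  suffices hs : ∀ᶠ y in 𝓝 z0, K (Ψ y) = 0 by
    rw [← hmap]; exact hs
  set l := fderiv ℂ f z0
  obtain ⟨v, hv⟩ : ∃ v, l v = 1 := by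
    obtain ⟨u, hu⟩ : ∃ u, l u ≠ 0 := by
      by_contra! h
      exact hd (ContinuousLinearMap.ext h)
    exact ⟨(l u)⁻¹ • u, by simp [hu]⟩
  have hKΨ : ∀ᶠ y in 𝓝 z0, DifferentiableAt ℂ (K ∘ Ψ) y := by
    filter_upwards [hΨ.eventually_analyticAt, hlim.eventually hK] with y h1 h2
    exact h2.comp y h1.differentiableAt
  obtain ⟨ε, hε, hb⟩ := Metric.eventually_nhds_iff_ball.1
    (hKΨ.and (hfΨ.and (hlim.eventually h)))
  have hdiff : DifferentiableOn ℂ (K ∘ Ψ) (Metric.ball z0 ε) := fun y hy =>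
    (hb y hy).1.differentiableWithinAt
  have hreal : ∀ y ∈ Metric.ball z0 ε, (l (y - z0)).im = 0 → K (Ψ y) = 0 := fun y hy him =>
    (hb y hy).2.2 (by rw [(hb y hy).2.1, Complex.add_im, h0, him, add_zero])
  have hsmall : ∀ᶠ y in 𝓝 z0, y ∈ Metric.ball z0 ε ∧ y - l (y - z0) • v ∈ Metric.ball z0 ε := by
    have hcont : ContinuousAt (fun y => y - l (y - z0) • v) z0 := by fun_prop
    exact Filter.Eventually.and (Metric.isOpen_ball.mem_nhds (Metric.mem_ball_self hε))
      (hcont.eventually (Metric.isOpen_ball.mem_nhds (by simpa using hε)))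
  filter_upwards [hsmall] with y hy
  have key := DifferentiableOn.eq_zero_of_frequently_eq_zero_line (K := K ∘ Ψ)
    (convex_ball z0 ε) Metric.isOpen_ball hdiff (a := y - l (y - z0) • v) (b := v)
    (σ := l (y - z0)) hy.2 (by simpa using hy.1) ?_
  · simpa using key
  · refine frequently_nhdsNE_of_eventually_real
      (p := fun τ => (K ∘ Ψ) (y - l (y - z0) • v + τ • v) = 0) ?_
    have hc : ContinuousAt (fun t : ℝ => y - l (y - z0) • v + (t : ℂ) • v) 0 := by fun_prop
    filter_upwards [hc.eventually (Metric.isOpen_ball.mem_nhds (by simpa using hy.2))] with t ht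
    refine hreal _ ht ?_
    have : y - l (y - z0) • v + (t : ℂ) • v - z0 = (y - z0) - l (y - z0) • v + (t : ℂ) • v := by
      abel
    rw [this]
    simp [hv]

theorem AnalyticAt.eventually_segre_eq_zero {E : Type*} [NormedAddCommGroup E]
    [NormedSpace ℂ E] [CompleteSpace E] [StarAddMonoid E] [NormedStarGroup E] [StarModule ℂ E]
    {f : E → ℂ} {R : E × E → ℂ} {q : E} (hf : AnalyticAt ℂ f q) (hd : fderiv ℂ f q ≠ 0)
    (h0 : (f q).im = 0) (hR : AnalyticAt ℂ R (q, star q))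
    (h : ∀ᶠ z in 𝓝 q, (f z).im = 0 → R (z, star z) = 0) :
    ∀ᶠ z in 𝓝 q, f z = f q → R (z, star q) = 0 := by
  obtain ⟨Ψ, hΨ, hΨ0, -, hfΨ, hmap⟩ := hf.exists_straightening hd
  have hlim : Tendsto Ψ (𝓝 q) (𝓝 q) := hmap.le
  set l := fderiv ℂ f q
  obtain ⟨v, hv⟩ : ∃ v, l v = 1 := by
    obtain ⟨u, hu⟩ : ∃ u, l u ≠ 0 := by
      by_contra! h
      exact hd (ContinuousLinearMap.ext h)
    exact ⟨(l u)⁻¹ • u, by simp [hu]⟩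
  set π : E →L[ℂ] E := .id ℂ E - l.smulRight v with hπ
  have hlπ : ∀ u, l (π u) = 0 := fun u => by simp [hπ, hv]
  have hπ0 : ∀ u, l u = 0 → π u = u := fun u hu => by simp [hπ, hu]
  set G : E → E := fun u => Ψ (q + π u) with hG
  have hG0 : G 0 = q := by simp [hG, hΨ0]
  have hGan : AnalyticAt ℂ G 0 := by
    refine AnalyticAt.fun_comp (g := Ψ) (f := fun u => q + π u) (by simpa using hΨ) ?_
    exact analyticAt_const.add (π.analyticAt 0)
  have hGstar : AnalyticAt ℂ (fun b => star (G (star b))) 0 :=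
    AnalyticAt.star_comp_star (by simpa using hGan)
  set K : E × E → ℂ := fun w => R (G w.1, star (G (star w.2))) with hK
  have hKan : AnalyticAt ℂ K ((0 : E), (0 : E)) := by
    refine AnalyticAt.fun_comp (g := R) (f := fun w : E × E => (G w.1, star (G (star w.2)))) ?_ ?_
    · simpa [hG0] using hR
    · exact (AnalyticAt.fun_comp (f := Prod.fst) hGan analyticAt_fst).prod
        (AnalyticAt.fun_comp (g := fun b => star (G (star b))) (f := Prod.snd) hGstar
          analyticAt_snd)
  have hreal : ∀ᶠ u in 𝓝 (0 : E), K (u, star u) = 0 := by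
    have hc : Tendsto (fun u => q + π u) (𝓝 0) (𝓝 q) := by
      have : ContinuousAt (fun u => q + π u) 0 := by fun_prop
      simpa [ContinuousAt] using this
    filter_upwards [hc.eventually hfΨ, hc.eventually (hlim.eventually h)] with u h1 h2
    simp only [hK, star_star]
    exact h2 (by rw [h1]; simp [hlπ, h0])
  obtain ⟨ε, hε, hb⟩ := Metric.eventually_nhds_iff_ball.1 hreal
  obtain ⟨δ, hδ, hb2⟩ := Metric.eventually_nhds_iff_ball.1 hKan.eventually_analyticAt
  set s := min ε δ
  have hs : 0 < s := lt_min hε hδ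
  have hzero : EqOn K 0 (Metric.ball (0 : E) s ×ˢ Metric.ball (0 : E) s) := by
    refine DifferentiableOn.eqOn_zero_of_antidiagonal
      ((convex_ball _ _).prod (convex_ball _ _)) (Metric.isOpen_ball.prod Metric.isOpen_ball)
      ?_ (fun w hw => ?_) ?_
    · rintro u w ⟨h1, h2⟩
      simp only [Metric.mem_ball, dist_zero_right] at h1 h2
      exact ⟨by simpa using h2, by simpa using h1⟩
    · refine (hb2 w ?_).differentiableAt.differentiableWithinAt
      rw [show ((0 : E), (0 : E)) = 0 from rfl]
      have : w ∈ Metric.ball (0 : E × E) s := by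
        rw [← Prod.mk_zero_zero, ← ball_prod_same]; exact hw
      exact Metric.ball_subset_ball (min_le_right _ _) this
    · rintro u ⟨h1, -⟩
      exact hb u (Metric.ball_subset_ball (min_le_left _ _) h1)
  have hev : ∀ᶠ y in 𝓝 q, f (Ψ y) = f q → R (Ψ y, star q) = 0 := by
    have hball : ∀ᶠ y in 𝓝 q, y - q ∈ Metric.ball (0 : E) s := by
      have : ContinuousAt (fun y => y - q) q := by fun_prop
      exact this.eventually (Metric.isOpen_ball.mem_nhds (by simpa using hs))
    filter_upwards [hfΨ, hball] with y hy hyb hfy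
    have hl0 : l (y - q) = 0 := by rw [hy] at hfy; simpa using hfy
    have := hzero (x := (y - q, 0)) ⟨hyb, Metric.mem_ball_self hs⟩
    simpa [hK, hG, hπ0 _ hl0, hΨ0] using this
  rw [← hmap]
  exact hev

theorem exists_isZeroFamily {E : Type*} [NormedAddCommGroup E] [NormedSpace ℂ E]
    {F : E × ℂ → ℂ} {y0 : E} {a : ℂ} (hF : AnalyticAt ℂ F (y0, a))
    (hne : ∃ᶠ z in 𝓝 a, F (y0, z) ≠ 0) {V : Set ℂ} (hV : V ∈ 𝓝 a) :
    ∃ P ρ, y0 ∈ P ∧ IsZeroFamily F P a ρ ∧ Metric.closedBall a ρ ⊆ V ∧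
      ∀ z ∈ Metric.closedBall a ρ, F (y0, z) = 0 → z = a := by
  have hslice : AnalyticAt ℂ (fun z => F (y0, z)) a :=
    AnalyticAt.fun_comp (f := fun z => (y0, z)) hF (analyticAt_const.prod analyticAt_id)
  have hiso : ∀ᶠ z in 𝓝 a, F (y0, z) = 0 → z = a := by
    rcases hslice.eventually_eq_zero_or_eventually_ne_zero with h | h
    · exact absurd h (by simpa [Filter.not_eventually] using hne)
    · filter_upwards [eventually_nhdsWithin_iff.1 h] with z hz h0
      by_contra hza
      exact hz hza h0
  have hpair : Tendsto (fun z => (y0, z)) (𝓝 a) (𝓝 (y0, a)) :=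
    (Continuous.prodMk_right y0).tendsto a
  obtain ⟨ρ, hρ, hb⟩ := Metric.nhds_basis_closedBall.mem_iff.1
    ((hiso.and (hpair.eventually hF.eventually_analyticAt)).and hV)
  have hev : ∀ᶠ y in 𝓝 y0, (∀ z ∈ Metric.closedBall a ρ, AnalyticAt ℂ F (y, z)) ∧
      ∀ z ∈ Metric.sphere a ρ, F (y, z) ≠ 0 := by
    refine Filter.Eventually.and ?_ ?_
    · refine (isCompact_closedBall a ρ).eventually_forall_of_forall_eventually fun z hz => ?_
      exact (hb hz).1.2.eventually_analyticAt
    · refine (isCompact_sphere a ρ).eventually_forall_of_forall_eventually fun z hz => ?_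
      have hz' := Metric.sphere_subset_closedBall hz
      refine (hb hz').1.2.continuousAt.eventually_ne fun h0 => ?_
      have := (hb hz').1.1 h0
      rw [Metric.mem_sphere, this, dist_self] at hz
      exact hρ.ne hz
  obtain ⟨P, hP, hPo, hy0⟩ := mem_nhds_iff.1 hev
  exact ⟨P, ρ, hy0, ⟨hPo, hρ, fun y hy => (hP hy).1, fun y hy => (hP hy).2⟩,
    fun z hz => (hb hz).2, fun z hz => (hb hz).1.1⟩

theorem IsZeroFamily.exists_zeroCount_le {E : Type*} [NormedAddCommGroup E] [NormedSpace ℂ E]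
    {F : E × ℂ → ℂ} {P : Set E} {c : ℂ} {r : ℝ} (h : IsZeroFamily F P c r) {y0 : E}
    (hy0 : y0 ∈ P) : ∃ M : ℕ, ∀ᶠ y in 𝓝 y0, zeroCount c r (fun z => F (y, z)) ≤ M := by
  have hc := (h.differentiableOn_zeroPowerSum 0).continuousOn.continuousAt
    (h.isOpen.mem_nhds hy0)
  obtain ⟨M, hM⟩ := exists_nat_gt ‖zeroPowerSum c r (fun z => F (y0, z)) 0‖
  refine ⟨M, ?_⟩
  filter_upwards [hc.norm.eventually_lt_const hM, h.isOpen.mem_nhds hy0] with y hy hyP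
  obtain ⟨S, m, g, hS, hm, hg, hgne, hfg⟩ :=
    (h.analyticOnNhd hyP).exists_factorization_closedBall h.pos (h.ne_zero y hyP)
  rw [zeroPowerSum_eq h.pos (fun a ha => h.mem_ball hyP ((hS a).1 ha).1 ((hS a).1 ha).2) hg hgne
    hfg] at hy
  have hcard : zeroCount c r (fun z => F (y, z)) = S.card := by
    rw [zeroCount, ← Set.ncard_coe_finset]
    congr 1
    ext z
    exact (hS z).symm
  have hsum : S.card ≤ ∑ a ∈ S, m a := by
    rw [Finset.card_eq_sum_ones]
    exact Finset.sum_le_sum hm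
  rw [hcard]
  have : ‖∑ a ∈ S, (m a : ℂ) * a ^ 0‖ = ((∑ a ∈ S, m a : ℕ) : ℝ) := by
    simp only [pow_zero, mul_one, ← Nat.cast_sum]
    exact Complex.norm_natCast _
  rw [this] at hy
  exact hsum.trans (by exact_mod_cast hy.le)

theorem DifferentiableOn.countable_zeros {g : ℂ → ℂ} {D : Set ℂ} (hg : DifferentiableOn ℂ g D)
    (hDo : IsOpen D) (hD : IsPreconnected D) {a : ℂ} (ha : a ∈ D) (hga : g a ≠ 0) :
    {z ∈ D | g z = 0}.Countable := by
  have han : AnalyticOnNhd ℂ g D := hg.analyticOnNhd hDo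
  have hd : DiscreteTopology {z ∈ D | g z = 0} := by
    rw [discreteTopology_subtype_iff]
    rintro x ⟨hx, hx0⟩
    have h1 : ∀ᶠ z in 𝓝[≠] x, g z ≠ 0 := by
      by_contra h
      refine hga (han.eqOn_zero_of_preconnected_of_frequently_eq_zero hD hx ?_ ha)
      simpa [Filter.not_eventually] using h
    rw [Filter.inf_principal_eq_bot]
    filter_upwards [h1] with z hz h
    exact hz h.2
  have := TopologicalSpace.separableSpace_iff_countable.1
    (inferInstance : TopologicalSpace.SeparableSpace {z ∈ D | g z = 0})
  exact this

theorem hasFDerivAt_zero_star_comp_star {E : Type*} [NormedAddCommGroup E]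
    [NormedSpace ℂ E] [StarAddMonoid E] [NormedStarGroup E] {f : E → ℂ} {z : E}
    (h : HasFDerivAt f (0 : E →L[ℂ] ℂ) (star z)) :
    HasFDerivAt (fun w => star (f (star w))) (0 : E →L[ℂ] ℂ) z := by
  rw [hasFDerivAt_iff_isLittleO] at h ⊢
  have hs : Tendsto (star : E → E) (𝓝 z) (𝓝 (star z)) := continuous_star.tendsto z
  have := h.comp_tendsto hs
  refine Asymptotics.IsLittleO.of_norm_norm ((this.norm_norm).congr (fun w => ?_) fun w => ?_)
  · simp only [Function.comp_apply, _root_.zero_apply, sub_zero, ← star_sub, norm_star]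
  · simp only [Function.comp_apply, ← star_sub, norm_star]

theorem AnalyticAt.fderiv_star_comp_star_ne_zero {E : Type*} [NormedAddCommGroup E]
    [NormedSpace ℂ E] [StarAddMonoid E] [NormedStarGroup E] [StarModule ℂ E] {f : E → ℂ} {z : E}
    (hf : AnalyticAt ℂ f (star z)) (hd : fderiv ℂ f (star z) ≠ 0) :
    fderiv ℂ (fun w => star (f (star w))) z ≠ 0 := by
  intro h0
  have h1 := (hf.star_comp_star.differentiableAt.hasFDerivAt).congr_fderiv h0
  have h2 := hasFDerivAt_zero_star_comp_star (z := star z)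
    (f := fun w => star (f (star w))) (by simpa using h1)
  exact hd (by simpa using h2.fderiv)

theorem IsZeroFamily.exists_discriminant {E : Type*} [NormedAddCommGroup E] [NormedSpace ℂ E]
    [CompleteSpace E] {F : E × ℂ → ℂ} {P : Set E} {c : ℂ} {r : ℝ} (h : IsZeroFamily F P c r)
    (hne : P.Nonempty) {M : ℕ} (hM : ∀ y ∈ P, zeroCount c r (fun z => F (y, z)) ≤ M) :
    ∃ D : E → ℂ, DifferentiableOn ℂ D P ∧ (∃ y ∈ P, D y ≠ 0) ∧ ∀ y0 ∈ P, D y0 ≠ 0 →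
      ∃ (S : Finset ℂ) (ψ : ℂ → E → ℂ), (∀ a ∈ S, AnalyticAt ℂ (ψ a) y0) ∧
      ∀ᶠ y in 𝓝 y0, (∀ a ∈ S, ψ a y ∈ Metric.ball c r ∧ F (y, ψ a y) = 0) ∧
        ∀ z ∈ Metric.closedBall c r, F (y, z) = 0 → ∃ a ∈ S, z = ψ a y := by
  obtain ⟨n, ⟨ys, hys, hn⟩, hmax⟩ : ∃ n, (∃ y ∈ P, zeroCount c r (fun z => F (y, z)) = n) ∧
      ∀ y ∈ P, zeroCount c r (fun z => F (y, z)) ≤ n := by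
    have hbdd : BddAbove ((fun y => zeroCount c r (fun z => F (y, z))) '' P) :=
      ⟨M, by rintro _ ⟨y, hy, rfl⟩; exact hM y hy⟩
    obtain ⟨y, hy, hyn⟩ := Nat.sSup_mem (hne.image _) hbdd
    exact ⟨_, ⟨y, hy, hyn⟩, fun y hy => le_csSup hbdd ⟨y, hy, rfl⟩⟩
  refine ⟨fun y => zeroHankel c r (fun z => F (y, z)) n, h.differentiableOn_zeroHankel n,
    ⟨ys, hys, by simpa [hn] using h.zeroHankel_ne_zero hys⟩, fun y0 hy0 hD => ?_⟩
  refine h.exists_branches hy0 ?_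
  filter_upwards [h.isOpen.mem_nhds hy0] with y hy
  exact (hmax y hy).trans (h.le_zeroCount hy0 hD)

section Reflection

set_option linter.unusedSectionVars false

instance Prod.normedStarGroup {E F : Type*} [SeminormedAddCommGroup E] [StarAddMonoid E]
    [NormedStarGroup E] [SeminormedAddCommGroup F] [StarAddMonoid F] [NormedStarGroup F] :
    NormedStarGroup (E × F) :=
  ⟨fun x => by simp [Prod.norm_def]⟩

theorem AnalyticAt.diag_star {E : Type*} [NormedAddCommGroup E] [NormedSpace ℂ E]
    [StarAddMonoid E] [NormedStarGroup E] [StarModule ℂ E] {R : E × E → ℂ} {q : E}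
    (hR : AnalyticAt ℂ R (q, star q)) : AnalyticAt ℝ (fun z => R (z, star z)) q :=
  AnalyticAt.fun_comp (g := R) (f := fun z : E => (z, star z)) hR.restrictScalars
    (analyticAt_id.prod (((starL' ℝ : E ≃L[ℝ] E) : E →L[ℝ] E).analyticAt q))

/-- `q` lies on a smooth Levi-flat hypersurface `Im f = 0` contained in `R (z, z̄) = 0`. -/
def IsLeviPoint {E : Type*} [NormedAddCommGroup E] [NormedSpace ℂ E] [Star E]
    (R : E × E → ℂ) (q : E) : Prop :=
  ∃ f : E → ℂ, AnalyticAt ℂ f q ∧ fderiv ℂ f q ≠ 0 ∧ (f q).im = 0 ∧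
    ∀ᶠ z in 𝓝 q, (f z).im = 0 → R (z, star z) = 0

theorem AnalyticAt.eventually_fderiv_ne_zero {𝕜 E F : Type*} [NontriviallyNormedField 𝕜]
    [NormedAddCommGroup E] [NormedSpace 𝕜 E] [NormedAddCommGroup F] [NormedSpace 𝕜 F]
    [CompleteSpace F] {f : E → F} {q : E} (hf : AnalyticAt 𝕜 f q) (hd : fderiv 𝕜 f q ≠ 0) :
    ∀ᶠ z in 𝓝 q, fderiv 𝕜 f z ≠ 0 :=
  hf.fderiv.continuousAt.eventually_ne hd

theorem eventually_isLeviPoint {E : Type*} [NormedAddCommGroup E] [NormedSpace ℂ E] [Star E]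
    {R : E × E → ℂ} {q : E} {f : E → ℂ} (hf : AnalyticAt ℂ f q) (hd : fderiv ℂ f q ≠ 0)
    (h : ∀ᶠ z in 𝓝 q, (f z).im = 0 → R (z, star z) = 0) :
    ∀ᶠ z in 𝓝 q, (f z).im = 0 → IsLeviPoint R z := by
  filter_upwards [hf.eventually_analyticAt, hf.eventually_fderiv_ne_zero hd,
    h.eventually_nhds] with z h1 h2 h3 h4
  exact ⟨f, h1, h2, h4, h3⟩

variable {Xb : Type*} [NormedAddCommGroup Xb] [NormedSpace ℂ Xb] [StarAddMonoid Xb]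

/-- A family of one-variable zero sets `ζ ↦ R ((x, ζ), w)` near a real point `(b, ω)`, with a
discriminant `D` off which the zeros are given by holomorphic branches. -/
structure ReflectionFamily (R : (Xb × ℂ) × (Xb × ℂ) → ℂ) (Ω : Set (Xb × ℂ)) (b : Xb) (ω : ℂ)
    (η r : ℝ) (D : Xb × (Xb × ℂ) → ℂ) : Prop where
  star_fst : star b = b
  star_snd : star ω = ω
  pos : 0 < η
  le : η ≤ r
  isOpen : IsOpen Ω
  convex : Convex ℝ Ω
  analytic : AnalyticOnNhd ℂ R (Ω ×ˢ Ω)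
  star_mem : ∀ z ∈ Ω, star z ∈ Ω
  mem : ∀ x ∈ Metric.ball b η, ∀ ζ ∈ Metric.closedBall ω r, (x, ζ) ∈ Ω
  nonconst : ∀ x ∈ Metric.ball b η, ∀ ζ ∈ Metric.closedBall ω r, ∃ w ∈ Ω, R ((x, ζ), w) ≠ 0
  family : IsZeroFamily (fun q : (Xb × (Xb × ℂ)) × ℂ => R ((q.1.1, q.2), q.1.2))
    (Metric.ball b η ×ˢ Metric.ball (b, ω) η) ω r
  differentiableOn : DifferentiableOn ℂ D (Metric.ball b η ×ˢ Metric.ball (b, ω) η)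
  exists_ne_zero : ∃ y ∈ Metric.ball b η ×ˢ Metric.ball (b, ω) η, D y ≠ 0
  branches : ∀ y0 ∈ Metric.ball b η ×ˢ Metric.ball (b, ω) η, D y0 ≠ 0 →
    ∃ (S : Finset ℂ) (ψ : ℂ → Xb × (Xb × ℂ) → ℂ), (∀ a ∈ S, AnalyticAt ℂ (ψ a) y0) ∧
      ∀ᶠ y in 𝓝 y0, (∀ a ∈ S, ψ a y ∈ Metric.ball ω r ∧ R ((y.1, ψ a y), y.2) = 0) ∧
        ∀ z ∈ Metric.closedBall ω r, R ((y.1, z), y.2) = 0 → ∃ a ∈ S, z = ψ a y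

/-- The points over which some branch over `star q` meets `R (z, z̄) = 0` with `Q ≠ 0`. -/
def reflSet (R : (Xb × ℂ) × (Xb × ℂ) → ℂ) (Q : Xb × ℂ → ℝ) (ω : ℂ) (r : ℝ) (q : Xb × ℂ) :
    Set Xb :=
  {x | ∃ ζ ∈ Metric.closedBall ω r, R ((x, ζ), star q) = 0 ∧ R ((x, ζ), star (x, ζ)) = 0 ∧
    Q (x, ζ) ≠ 0}

variable [NormedStarGroup Xb] [StarModule ℂ Xb]

theorem exists_branch_of_reflSet {R : (Xb × ℂ) × (Xb × ℂ) → ℂ} {Ω : Set (Xb × ℂ)}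
    {Q : Xb × ℂ → ℝ} {ω : ℂ} {r : ℝ} {q : Xb × ℂ}
    (hR : AnalyticOnNhd ℂ R (Ω ×ˢ Ω)) (hΩ : ∀ z ∈ Ω, star z ∈ Ω) (hQ : AnalyticOnNhd ℝ Q Ω)
    {N : Set Xb} (hNo : IsOpen N) (hNp : IsPreconnected N) (S : Finset ℂ) (ψ : ℂ → Xb → ℂ)
    (hψ : ∀ a ∈ S, AnalyticOnNhd ℂ (ψ a) N) (hψΩ : ∀ a ∈ S, ∀ x ∈ N, (x, ψ a x) ∈ Ω)
    (hcov : ∀ x ∈ N, ∀ z ∈ Metric.closedBall ω r, R ((x, z), star q) = 0 → ∃ a ∈ S, z = ψ a x)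
    (hne : (N ∩ interior (reflSet R Q ω r q)).Nonempty) :
    ∃ a ∈ S, (∀ x ∈ N, R ((x, ψ a x), star (x, ψ a x)) = 0) ∧ (∃ x ∈ N, Q (x, ψ a x) ≠ 0) ∧
      AnalyticOnNhd ℝ (fun x => Q (x, ψ a x)) N := by
  have hg : ∀ a ∈ S, AnalyticOnNhd ℂ (fun x => (x, ψ a x)) N := fun a ha x hx =>
    analyticAt_id.prod (hψ a ha x hx)
  have hρ : ∀ a ∈ S, AnalyticOnNhd ℝ (fun x => R ((x, ψ a x), star (x, ψ a x))) N := by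
    intro a ha x hx
    have h1 : AnalyticAt ℝ (fun z => R (z, star z)) (x, ψ a x) :=
      AnalyticAt.diag_star (hR _ ⟨hψΩ a ha x hx, hΩ _ (hψΩ a ha x hx)⟩)
    exact AnalyticAt.fun_comp (g := fun z => R (z, star z)) (f := fun x => (x, ψ a x)) h1
      (hg a ha x hx).restrictScalars
  have hQa : ∀ a ∈ S, AnalyticOnNhd ℝ (fun x => Q (x, ψ a x)) N := fun a ha x hx =>
    AnalyticAt.fun_comp (g := Q) (f := fun x => (x, ψ a x)) (hQ _ (hψΩ a ha x hx))
      (hg a ha x hx).restrictScalars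
  have hN0 : IsOpen (N ∩ interior (reflSet R Q ω r q)) := hNo.inter isOpen_interior
  obtain ⟨a, ha, M, hMN, hMo, ⟨x, hx⟩, hM⟩ := exists_subset_of_subset_iUnion_inter S
    (fun a => {x | R ((x, ψ a x), star (x, ψ a x)) = 0}) (fun a => {x | Q (x, ψ a x) ≠ 0})
    hN0 hne
    (fun a ha => by
      have := ((hρ a ha).continuousOn.mono inter_subset_left).isOpen_inter_preimage hN0
        (isOpen_compl_singleton (x := (0 : ℂ)))
      exact this)
    (fun a ha => by
      have := ((hQa a ha).continuousOn.mono inter_subset_left).isOpen_inter_preimage hN0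
        (isOpen_compl_singleton (x := (0 : ℝ)))
      exact this)
    (fun x hx => by
      obtain ⟨ζ, hζ, h1, h2, h3⟩ := interior_subset hx.2
      obtain ⟨a, ha, rfl⟩ := hcov x hx.1 ζ hζ h1
      exact ⟨a, ha, h2, h3⟩)
  refine ⟨a, ha, fun z hz => ?_, ⟨x, (hMN hx).1, (hM hx).2⟩, hQa a ha⟩
  exact (hρ a ha).eqOn_zero_of_preconnected_of_eventuallyEq_zero hNp (hMN hx).1
    (by filter_upwards [hMo.mem_nhds hx] with y hy using (hM hy).1) hz

namespace ReflectionFamily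

variable {R : (Xb × ℂ) × (Xb × ℂ) → ℂ} {Ω : Set (Xb × ℂ)} {b : Xb} {ω : ℂ} {η r : ℝ}
  {D : Xb × (Xb × ℂ) → ℂ} {Q : Xb × ℂ → ℝ}

theorem star_mem_ball (H : ReflectionFamily R Ω b ω η r D) {q : Xb × ℂ}
    (hq : q ∈ Metric.ball (b, ω) η) : star q ∈ Metric.ball (b, ω) η := by
  have : star q - (b, ω) = star (q - (b, ω)) := by
    rw [star_sub, Prod.star_def, Prod.star_def, H.star_fst, H.star_snd]
  rw [mem_ball_iff_norm, this, norm_star, ← mem_ball_iff_norm]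
  exact hq

theorem fst_mem_ball (_H : ReflectionFamily R Ω b ω η r D) {q : Xb × ℂ}
    (hq : q ∈ Metric.ball (b, ω) η) : q.1 ∈ Metric.ball b η := by
  rw [← ball_prod_same] at hq
  exact hq.1

theorem snd_mem_ball (H : ReflectionFamily R Ω b ω η r D) {q : Xb × ℂ}
    (hq : q ∈ Metric.ball (b, ω) η) : q.2 ∈ Metric.ball ω r := by
  rw [← ball_prod_same] at hq
  exact Metric.ball_subset_ball H.le hq.2

theorem ball_subset (H : ReflectionFamily R Ω b ω η r D) : Metric.ball (b, ω) η ⊆ Ω :=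
  fun _ hq => H.mem _ (H.fst_mem_ball hq) _ (Metric.ball_subset_closedBall (H.snd_mem_ball hq))

theorem analyticAt_diag (H : ReflectionFamily R Ω b ω η r D) {q : Xb × ℂ}
    (hq : q ∈ Metric.ball (b, ω) η) : AnalyticAt ℂ R (q, star q) :=
  H.analytic _ ⟨H.ball_subset hq, H.star_mem _ (H.ball_subset hq)⟩

variable [CompleteSpace Xb]

theorem fst_mem_interior_reflSet (H : ReflectionFamily R Ω b ω η r D)
    (hQ : AnalyticOnNhd ℝ Q Ω) {q : Xb × ℂ} (hq : q ∈ Metric.ball (b, ω) η)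
    (hL : IsLeviPoint R q) (hQq : Q q ≠ 0) : q.1 ∈ interior (reflSet R Q ω r q) := by
  obtain ⟨f, hf, hd, h0, h⟩ := hL
  have hseg := hf.eventually_segre_eq_zero hd h0 (H.analyticAt_diag hq) h
  have hQev : ∀ᶠ z in 𝓝 q, Q z ≠ 0 := (hQ q (H.ball_subset hq)).continuousAt.eventually_ne hQq
  have hball : ∀ᶠ z : Xb × ℂ in 𝓝 q, z.2 ∈ Metric.closedBall ω r :=
    continuous_snd.continuousAt.eventually
      (Filter.mem_of_superset (Metric.isOpen_ball.mem_nhds (H.snd_mem_ball hq))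
        Metric.ball_subset_closedBall)
  have hall := (hseg.and h).and (hQev.and hball)
  rw [show q = (q.1, q.2) from rfl, nhds_prod_eq] at hall
  obtain ⟨pU, hpU, pV, hpV, hUV⟩ := Filter.eventually_prod_iff.1 hall
  have hF' : AnalyticAt ℂ (fun z : Xb × ℂ => f z - f q) (q.1, q.2) := hf.sub analyticAt_const
  have hne : ∃ᶠ ζ in 𝓝 q.2, (fun z : Xb × ℂ => f z - f q) (q.1, ζ) ≠ 0 := by
    intro hcon
    have hfin := H.family.finite_zeros (y := (q.1, star q))
      ⟨H.fst_mem_ball hq, H.star_mem_ball hq⟩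
    refine (infinite_of_mem_nhds q.2 (s := {z ∈ Metric.closedBall ω r |
      R ((q.1, z), star q) = 0}) ?_) hfin
    filter_upwards [hcon, hpV] with ζ h1 h2
    have h3 := hUV hpU.self_of_nhds h2
    exact ⟨h3.2.2, h3.1.1 (by simpa [sub_eq_zero] using h1)⟩
  obtain ⟨P, ρ, hP, hfam, hV, huniq⟩ := exists_isZeroFamily hF' hne hpV
  have hex := hfam.eventually_exists_zero hP (Metric.mem_closedBall_self hfam.pos.le)
    (by simp) huniq
  rw [mem_interior_iff_mem_nhds]
  filter_upwards [hex, hpU] with x ⟨ζ, hζ, hζ0⟩ hx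
  have hfq : f (x, ζ) = f q := by simpa [sub_eq_zero] using hζ0
  have h3 := hUV hx (hV hζ)
  exact ⟨ζ, h3.2.2, h3.1.1 hfq, h3.1.2 (by rw [hfq, h0]), h3.2.1⟩

theorem exists_nhds_subset_closure (H : ReflectionFamily R Ω b ω η r D)
    (hQ : AnalyticOnNhd ℝ Q Ω) {q : Xb × ℂ} (hq : q ∈ Metric.ball (b, ω) η) {x : Xb}
    (hx : x ∈ Metric.ball b η) (hD : D (x, star q) ≠ 0) :
    ∃ N, IsOpen N ∧ x ∈ N ∧ ((N ∩ interior (reflSet R Q ω r q)).Nonempty →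
      N ⊆ closure (interior (reflSet R Q ω r q))) := by
  obtain ⟨S, ψ, hψ, hbr⟩ := H.branches (x, star q) ⟨hx, H.star_mem_ball hq⟩ hD
  have hpair : Tendsto (fun x' => (x', star q)) (𝓝 x) (𝓝 (x, star q)) :=
    (Continuous.prodMk_left (star q)).tendsto x
  have hanS : ∀ᶠ y in 𝓝 (x, star q), ∀ a ∈ S, AnalyticAt ℂ (ψ a) y :=
    (Filter.eventually_all_finset S).2 fun a ha => (hψ a ha).eventually_analyticAt
  obtain ⟨ε, hε, hb⟩ := Metric.eventually_nhds_iff_ball.1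
    ((hpair.eventually (hanS.and hbr)).and (Metric.isOpen_ball.mem_nhds hx))
  refine ⟨Metric.ball x ε, Metric.isOpen_ball, Metric.mem_ball_self hε, fun hne => ?_⟩
  have hψΩ : ∀ a ∈ S, ∀ x' ∈ Metric.ball x ε, (x', ψ a (x', star q)) ∈ Ω := fun a ha x' hx' =>
    H.mem _ (hb x' hx').2 _ (Metric.ball_subset_closedBall ((hb x' hx').1.2.1 a ha).1)
  obtain ⟨a, ha, hρ, ⟨x0, hx0, hx0Q⟩, hQa⟩ := exists_branch_of_reflSet H.analytic H.star_mem hQ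
    Metric.isOpen_ball (convex_ball x ε).isPreconnected S (fun a x' => ψ a (x', star q))
    (fun a ha x' hx' => AnalyticAt.fun_comp (g := ψ a) (f := fun x' => (x', star q))
      ((hb x' hx').1.1 a ha) (analyticAt_id.prod analyticAt_const))
    hψΩ (fun x' hx' z hz h0 => (hb x' hx').1.2.2 z hz h0) hne
  intro x' hx'
  rw [mem_closure_iff_frequently]
  have hfreq : ∃ᶠ y in 𝓝 x', Q (y, ψ a (y, star q)) ≠ 0 := by
    intro hcon
    refine hx0Q (hQa.eqOn_zero_of_preconnected_of_eventuallyEq_zero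
      (convex_ball x ε).isPreconnected hx' ?_ hx0)
    filter_upwards [hcon] with y hy
    simpa using hy
  refine (hfreq.and_eventually (Metric.isOpen_ball.mem_nhds hx')).mono fun y hy => ?_
  rw [mem_interior_iff_mem_nhds]
  filter_upwards [(hQa y hy.2).continuousAt.eventually_ne hy.1,
    Metric.isOpen_ball.mem_nhds hy.2] with z hz1 hz2
  have h4 := (hb z hz2).1.2.1 a ha
  exact ⟨_, Metric.ball_subset_closedBall h4.1, h4.2, hρ z hz2, hz1⟩

theorem mem_closure_interior_reflSet (H : ReflectionFamily R Ω b ω η r D)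
    (hQ : AnalyticOnNhd ℝ Q Ω) {q : Xb × ℂ} (hq : q ∈ Metric.ball (b, ω) η)
    (hL : IsLeviPoint R q) (hQq : Q q ≠ 0) {x : Xb} (hx : x ∈ Metric.ball b η)
    (hD : D (x, star q) ≠ 0) : x ∈ closure (interior (reflSet R Q ω r q)) := by
  set A := interior (reflSet R Q ω r q) with hA
  have hq1 : q.1 ∈ A := H.fst_mem_interior_reflSet hQ hq hL hQq
  set γ : ℂ → Xb := fun σ => q.1 + σ • (x - q.1) with hγ
  have hγc : Continuous γ := by fun_prop
  set D0 : Set ℂ := γ ⁻¹' Metric.ball b η with hD0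
  have hD0o : IsOpen D0 := Metric.isOpen_ball.preimage hγc
  have hD0c : Convex ℝ D0 := by
    intro s hs t ht α β hα hβ hαβ
    have := convex_ball b η hs ht hα hβ hαβ
    rw [hD0, Set.mem_preimage]
    convert! this using 1
    simp only [hγ, smul_add]
    rw [add_add_add_comm, ← add_smul α β, hαβ, one_smul, add_smul, smul_assoc, smul_assoc]
  have h1 : (1 : ℂ) ∈ D0 := by simpa [hD0, hγ] using hx
  have h0 : (0 : ℂ) ∈ D0 := by simpa [hD0, hγ] using H.fst_mem_ball hq
  set g : ℂ → ℂ := fun σ => D (γ σ, star q) with hg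
  have hgd : DifferentiableOn ℂ g D0 := by
    refine H.differentiableOn.comp (t := Metric.ball b η ×ˢ Metric.ball (b, ω) η)
      (f := fun σ => (γ σ, star q)) ?_ fun σ hσ => ⟨hσ, H.star_mem_ball hq⟩
    fun_prop
  have hg1 : g 1 ≠ 0 := by simpa [hg, hγ] using hD
  have hcount := hgd.countable_zeros hD0o hD0c.isPreconnected h1 hg1
  have hC := hD0c.isPreconnected_diff_countable hD0o hcount
  have hmemC : ∀ {σ}, σ ∈ D0 \ {z ∈ D0 | g z = 0} ↔ σ ∈ D0 ∧ g σ ≠ 0 := fun {σ} => by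
    simp only [Set.mem_sdiff, Set.mem_ofPred_eq]; tauto
  obtain ⟨σ0, hσ0, hσ0A⟩ : ∃ σ ∈ D0 \ {z ∈ D0 | g z = 0}, γ σ ∈ A := by
    have hopen : IsOpen (γ ⁻¹' A ∩ D0) := (isOpen_interior.preimage hγc).inter hD0o
    obtain ⟨σ, hσ, hσ'⟩ := (hcount.dense_compl ℝ).inter_open_nonempty _ hopen
      ⟨0, by simpa [hγ] using hq1, h0⟩
    exact ⟨σ, ⟨hσ.2, hσ'⟩, hσ.1⟩
  have key := hC.induction₂ (fun σ τ => γ σ ∈ closure A ↔ γ τ ∈ closure A) (fun σ hσ => ?_)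
    (fun _ _ _ _ _ _ h1 h2 => h1.trans h2) (fun _ _ _ _ h => h.symm) hσ0
    (hmemC.2 ⟨h1, hg1⟩)
  · simpa [hγ] using key.1 (subset_closure hσ0A)
  · obtain ⟨N, hNo, hxN, hN⟩ := H.exists_nhds_subset_closure hQ hq (x := γ σ) hσ.1
      (hmemC.1 hσ).2
    have hev : ∀ᶠ τ in 𝓝 σ, γ τ ∈ N := hγc.continuousAt.eventually (hNo.mem_nhds hxN)
    filter_upwards [mem_nhdsWithin_of_mem_nhds hev] with τ hτ
    have aux : ∀ y ∈ N, y ∈ closure A → (N ∩ A).Nonempty := fun y hy hyA =>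
      mem_closure_iff.1 hyA N hNo hy
    exact ⟨fun h => hN (aux _ hxN h) hτ, fun h => hN (aux _ hτ h) hxN⟩

end ReflectionFamily

namespace ReflectionFamily

variable {R : (Xb × ℂ) × (Xb × ℂ) → ℂ} {Ω : Set (Xb × ℂ)} {b : Xb} {ω : ℂ} {η r : ℝ}
  {D : Xb × (Xb × ℂ) → ℂ} {Q : Xb × ℂ → ℝ} [CompleteSpace Xb]

set_option maxHeartbeats 1000000 in
theorem exists_base_point (H : ReflectionFamily R Ω b ω η r D)
    (hQ : AnalyticOnNhd ℝ Q Ω) (hT : ∃ᶠ q in 𝓝 (b, ω), IsLeviPoint R q ∧ Q q ≠ 0) :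
    ∃ q ∈ Metric.ball (b, ω) η, IsLeviPoint R q ∧ Q q ≠ 0 ∧
      ∃ x ∈ Metric.ball b η, star x = x ∧ D (x, star q) ≠ 0 := by
  obtain ⟨q0, ⟨⟨f, hf, hd, h0, h⟩, hQ0⟩, hq0⟩ :=
    (hT.and_eventually (Metric.isOpen_ball.mem_nhds (Metric.mem_ball_self H.pos))).exists
  have hev := (eventually_isLeviPoint hf hd h).and
    (((hQ q0 (H.ball_subset hq0)).continuousAt.eventually_ne hQ0).and
      (Metric.isOpen_ball.mem_nhds hq0))
  have hex : ∃ᶠ q in 𝓝 q0, (f q).im = 0 ∧ ∃ x ∈ Metric.ball b η, D (x, star q) ≠ 0 := by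
    by_contra hcon
    have hcon' : ∀ᶠ q in 𝓝 q0, (f q).im = 0 → ∀ x ∈ Metric.ball b η, D (x, star q) = 0 := by
      filter_upwards [Filter.not_frequently.1 hcon] with q hq him x hx
      by_contra hne
      exact hq ⟨him, x, hx, hne⟩
    obtain ⟨⟨x, w⟩, ⟨hx, hw⟩, hne⟩ := H.exists_ne_zero
    have hDx : DifferentiableOn ℂ (fun w => D (x, w)) (Metric.ball (b, ω) η) := by
      refine H.differentiableOn.comp (f := fun w => (x, w)) ?_ fun w hw => ⟨hx, hw⟩
      fun_prop
    have hst := H.star_mem_ball hq0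
    have hf' : AnalyticAt ℂ f (star (star q0)) := by rwa [star_star]
    have hzero := hf'.star_comp_star.eventually_eq_zero_of_im_eq_zero
      (hf'.fderiv_star_comp_star_ne_zero (by rwa [star_star])) (by simp [h0])
      (K := fun w => D (x, w))
      (by
        filter_upwards [Metric.isOpen_ball.mem_nhds hst] with z hz
        exact hDx.differentiableAt (Metric.isOpen_ball.mem_nhds hz))
      (by
        have hs : Tendsto (star : Xb × ℂ → Xb × ℂ) (𝓝 (star q0)) (𝓝 q0) := by
          simpa using continuous_star.tendsto (star q0)
        filter_upwards [hs.eventually hcon'] with z hz him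
        simpa using hz (by simpa using him) x hx)
    exact hne ((DifferentiableOn.eqOn_zero_of_eventually_eq_zero (convex_ball _ _)
      Metric.isOpen_ball hDx hst hzero) hw)
  obtain ⟨q, ⟨him, x, hx, hne⟩, hL, hQq, hq⟩ := (hex.and_eventually hev).exists
  refine ⟨q, hq, hL him, hQq, ?_⟩
  by_contra! hcon
  have hDq : DifferentiableOn ℂ (fun x => D (x, star q)) (Metric.ball b η) := by
    refine H.differentiableOn.comp (f := fun x => (x, star q)) ?_
      fun x hx => ⟨hx, H.star_mem_ball hq⟩
    fun_prop
  refine hne (DifferentiableOn.eqOn_zero_of_real (convex_ball _ _) Metric.isOpen_ball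
    (fun z hz => ?_) hDq (fun z hz hs => hcon z hz hs) hx)
  have : star z - b = star (z - b) := by rw [star_sub, H.star_fst]
  rw [mem_ball_iff_norm, this, norm_star, ← mem_ball_iff_norm]
  exact hz

theorem exists_common_branch (H : ReflectionFamily R Ω b ω η r D)
    (hQ : AnalyticOnNhd ℝ Q Ω) {q : Xb × ℂ} (hq : q ∈ Metric.ball (b, ω) η)
    (hL : IsLeviPoint R q) (hQq : Q q ≠ 0) {x : Xb} (hx : x ∈ Metric.ball b η)
    (hD : D (x, star q) ≠ 0) :
    ∃ (w0 : Xb × ℂ) (g : Xb × ℂ → ℂ) (N : Set Xb) (h : Xb × (Xb × ℂ) → ℂ),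
      AnalyticAt ℂ g w0 ∧ fderiv ℂ g w0 ≠ 0 ∧ (g w0).im = 0 ∧ IsOpen N ∧ IsPreconnected N ∧
      x ∈ N ∧ w0 ∈ Ω ∧ N ⊆ Metric.ball b η ∧
      ∀ᶠ w in 𝓝 w0, (∀ x' ∈ N, AnalyticAt ℂ h (x', w) ∧ h (x', w) ∈ Metric.ball ω r ∧
          R ((x', h (x', w)), w) = 0) ∧
        ((g w).im = 0 → (∀ x' ∈ N, R ((x', h (x', w)), star (x', h (x', w))) = 0) ∧
          ∃ x' ∈ N, Q (x', h (x', w)) ≠ 0) := by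
  obtain ⟨f, hf, hd, h0, hfR⟩ := hL
  obtain ⟨S, ψ, hψ, hbr⟩ := H.branches (x, star q) ⟨hx, H.star_mem_ball hq⟩ hD
  have hanS : ∀ᶠ y in 𝓝 (x, star q), ∀ a ∈ S, AnalyticAt ℂ (ψ a) y :=
    (Filter.eventually_all_finset S).2 fun a ha => (hψ a ha).eventually_analyticAt
  have hDev : ∀ᶠ y in 𝓝 (x, star q), D y ≠ 0 ∧ y ∈ Metric.ball b η ×ˢ Metric.ball (b, ω) η := by
    have hopen := Metric.isOpen_ball.prod (Metric.isOpen_ball (x := (b, ω)) (ε := η))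
      |>.mem_nhds (show (x, star q) ∈ Metric.ball b η ×ˢ Metric.ball (b, ω) η from
        ⟨hx, H.star_mem_ball hq⟩)
    exact ((H.differentiableOn.differentiableAt hopen).continuousAt.eventually_ne hD).and hopen
  have hall := (hanS.and hbr).and hDev
  obtain ⟨ε, hε, hb⟩ := Metric.eventually_nhds_iff_ball.1 hall
  set N := Metric.ball x ε with hN
  have hNp : IsPreconnected N := (convex_ball x ε).isPreconnected
  have hb' : ∀ x' ∈ N, ∀ w ∈ Metric.ball (star q) ε,
      ((∀ a ∈ S, AnalyticAt ℂ (ψ a) (x', w)) ∧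
        (∀ a ∈ S, ψ a (x', w) ∈ Metric.ball ω r ∧ R ((x', ψ a (x', w)), w) = 0) ∧
        ∀ z ∈ Metric.closedBall ω r, R ((x', z), w) = 0 → ∃ a ∈ S, z = ψ a (x', w)) ∧
      D (x', w) ≠ 0 ∧ (x', w) ∈ Metric.ball b η ×ˢ Metric.ball (b, ω) η := fun x' hx' w hw =>
    hb (x', w) (by rw [← ball_prod_same]; exact ⟨hx', hw⟩)
  have hxN : x ∈ N := Metric.mem_ball_self hε
  have hs : Tendsto (star : Xb × ℂ → Xb × ℂ) (𝓝 q) (𝓝 (star q)) := continuous_star.tendsto q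
  -- a neighbourhood of `q` on which all hypotheses hold
  have hqev := ((eventually_isLeviPoint hf hd hfR).and
    ((hQ q (H.ball_subset hq)).continuousAt.eventually_ne hQq)).and
    ((Filter.Eventually.and (Metric.isOpen_ball.mem_nhds hq)
      (hs.eventually (Metric.ball_mem_nhds _ hε))).and
    (hf.eventually_analyticAt.and (hf.eventually_fderiv_ne_zero hd)))
  obtain ⟨δ, hδ, hq'⟩ := Metric.eventually_nhds_iff_ball.1 hqev
  have hψΩ : ∀ w ∈ Metric.ball (star q) ε, ∀ a ∈ S, ∀ x' ∈ N, (x', ψ a (x', w)) ∈ Ω :=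
    fun w hw a ha x' hx' => H.mem _ (hb' x' hx' w hw).2.2.1 _
      (Metric.ball_subset_closedBall ((hb' x' hx' w hw).1.2.1 a ha).1)
  set Y := {z : Xb × ℂ // (f z).im = 0}
  let O : Set Y := {z | z.1 ∈ Metric.ball q δ}
  have hOo : IsOpen O := Metric.isOpen_ball.preimage continuous_subtype_val
  set ρ : ℂ → Xb → Xb × ℂ → ℂ := fun a x' z =>
    R ((x', ψ a (x', star z)), star (x', ψ a (x', star z))) with hρ
  have hψc : ∀ a ∈ S, ∀ x' ∈ N, ∀ z ∈ Metric.ball q δ,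
      ContinuousAt (fun z => (x', ψ a (x', star z))) z := fun a ha x' hx' z hz => by
    refine continuousAt_const.prodMk (ContinuousAt.comp' (g := ψ a) (f := fun z => (x', star z))
      ((hb' x' hx' (star z) (hq' z hz).2.1.2).1.1 a ha).continuousAt ?_)
    exact continuousAt_const.prodMk continuous_star.continuousAt
  have hρc : ∀ a ∈ S, ∀ x' ∈ N, ∀ z ∈ Metric.ball q δ, ContinuousAt (ρ a x') z :=
      fun a ha x' hx' z hz => by
    have hm := hψΩ (star z) (hq' z hz).2.1.2 a ha x' hx'
    exact ContinuousAt.comp' (g := fun u => R (u, star u)) (f := fun z => (x', ψ a (x', star z)))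
      (AnalyticAt.diag_star (H.analytic _ ⟨hm, H.star_mem _ hm⟩)).continuousAt
      (hψc a ha x' hx' z hz)
  have hQc : ∀ a ∈ S, ∀ x' ∈ N, ∀ z ∈ Metric.ball q δ,
      ContinuousAt (fun z => Q (x', ψ a (x', star z))) z := fun a ha x' hx' z hz => by
    exact ContinuousAt.comp' (g := Q) (f := fun z => (x', ψ a (x', star z)))
      (hQ _ (hψΩ (star z) (hq' z hz).2.1.2 a ha x' hx')).continuousAt (hψc a ha x' hx' z hz)
  obtain ⟨a, ha, M, hMO, hMo, ⟨⟨q2, hq2⟩, hq2M⟩, hM⟩ := exists_subset_of_subset_iUnion_inter S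
    (fun a => {z : Y | ∀ x' ∈ N, ρ a x' z.1 = 0})
    (fun a => {z : Y | ∃ x' ∈ N, Q (x', ψ a (x', star z.1)) ≠ 0}) hOo
    ⟨⟨q, h0⟩, Metric.mem_ball_self hδ⟩
    (fun a ha => by
      rw [isOpen_iff_mem_nhds]
      rintro z ⟨hz, hzC⟩
      obtain ⟨x', hx', hne⟩ : ∃ x' ∈ N, ρ a x' z.1 ≠ 0 := by
        by_contra! hcon
        exact hzC hcon
      filter_upwards [hOo.mem_nhds hz, (ContinuousAt.comp' (f := (Subtype.val : Y → Xb × ℂ))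
        (hρc a ha x' hx' z.1 hz) continuous_subtype_val.continuousAt).eventually_ne hne] with y h1 h2
      exact ⟨h1, fun h3 => h2 (h3 x' hx')⟩)
    (fun a ha => by
      rw [isOpen_iff_mem_nhds]
      rintro z ⟨hz, x', hx', hne⟩
      filter_upwards [hOo.mem_nhds hz, (ContinuousAt.comp' (f := (Subtype.val : Y → Xb × ℂ))
        (hQc a ha x' hx' z.1 hz) continuous_subtype_val.continuousAt).eventually_ne hne] with y h1 h2
      exact ⟨h1, x', hx', h2⟩)
    (fun z hz => by
      have hz' := hq' z.1 hz
      have hzb := hz'.2.1.1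
      have hsz := hz'.2.1.2
      have hcl := H.mem_closure_interior_reflSet hQ hzb (hz'.1.1 z.2) hz'.1.2 hx
        (hb' x hxN _ hsz).2.1
      obtain ⟨a, ha, h1, h2, -⟩ := exists_branch_of_reflSet H.analytic H.star_mem hQ
        Metric.isOpen_ball hNp S (fun a x' => ψ a (x', star z.1))
        (fun a ha x' hx' => AnalyticAt.fun_comp (g := ψ a) (f := fun x' => (x', star z.1))
          ((hb' x' hx' _ hsz).1.1 a ha) (analyticAt_id.prod analyticAt_const))
        (hψΩ _ hsz) (fun x' hx' z' hz' h0 => (hb' x' hx' _ hsz).1.2.2 z' hz' h0)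
        (mem_closure_iff.1 hcl N Metric.isOpen_ball hxN)
      exact ⟨a, ha, h1, h2⟩)
  have hq2O : q2 ∈ Metric.ball q δ := hMO hq2M
  have hq2' := hq' q2 hq2O
  obtain ⟨M', hM'o, hM'⟩ := isOpen_induced_iff.1 hMo
  have hq2M' : q2 ∈ M' := by
    have : (⟨q2, hq2⟩ : Y) ∈ Subtype.val ⁻¹' M' := hM' ▸ hq2M
    exact this
  have hf2 : AnalyticAt ℂ f (star (star q2)) := by rw [star_star]; exact hq2'.2.2.1
  refine ⟨star q2, fun w => star (f (star w)), N, ψ a, hf2.star_comp_star,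
    hf2.fderiv_star_comp_star_ne_zero (by rw [star_star]; exact hq2'.2.2.2), by simp [hq2],
    Metric.isOpen_ball, hNp, hxN, H.star_mem _ (H.ball_subset hq2'.2.1.1),
    fun x' hx' => (hb' x' hx' _ hq2'.2.1.2).2.2.1, ?_⟩
  have hs2 : Tendsto (star : Xb × ℂ → Xb × ℂ) (𝓝 (star q2)) (𝓝 q2) := by
    simpa using continuous_star.tendsto (star q2)
  filter_upwards [Metric.isOpen_ball.mem_nhds hq2'.2.1.2,
    hs2.eventually (hM'o.mem_nhds hq2M')] with w hw hwM
  refine ⟨fun x' hx' => ⟨(hb' x' hx' w hw).1.1 a ha, (hb' x' hx' w hw).1.2.1 a ha⟩, fun him => ?_⟩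
  have him' : (f (star w)).im = 0 := by simpa using him
  have hwM2 : (⟨star w, him'⟩ : Y) ∈ M := hM' ▸ hwM
  simpa [hρ] using hM hwM2

end ReflectionFamily

theorem ReflectionFamily.exists_levi_branch {R : (Xb × ℂ) × (Xb × ℂ) → ℂ} {Ω : Set (Xb × ℂ)}
    {b : Xb} {ω : ℂ} {η r : ℝ} {D : Xb × (Xb × ℂ) → ℂ} {Q : Xb × ℂ → ℝ} [CompleteSpace Xb]
    (H : ReflectionFamily R Ω b ω η r D) (hQ : AnalyticOnNhd ℝ Q Ω)
    (hT : ∃ᶠ q in 𝓝 (b, ω), IsLeviPoint R q ∧ Q q ≠ 0) :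
    ∃ (x : Xb) (h : Xb × ℂ → ℂ), star x = x ∧ AnalyticAt ℂ h (x, 0) ∧ (x, h (x, 0)) ∈ Ω ∧
      lastDeriv h (x, 0) ≠ 0 ∧
      (∀ᶠ q : Xb × ℂ in 𝓝 (x, 0), q.2.im = 0 → R ((q.1, h q), star (q.1, h q)) = 0) ∧
      ∃ᶠ x' in 𝓝 x, Q (x', h (x', 0)) ≠ 0 := by
  obtain ⟨q, hq, hL, hQq, x, hx, hxs, hD⟩ := H.exists_base_point hQ hT
  obtain ⟨w0, g, N, h, hg, hdg, hg0, hNo, hNp, hxN, hw0, hNb, hall⟩ :=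
    H.exists_common_branch hQ hq hL hQq hx hD
  have hsl : ∀ w, AnalyticAt ℂ h (x, w) → AnalyticAt ℂ (fun w => h (x, w)) w := fun w hw =>
    AnalyticAt.fun_comp (g := h) (f := fun w => (x, w)) hw (analyticAt_const.prod analyticAt_id)
  have hfreq : ∃ᶠ w in 𝓝 w0, (g w).im = 0 ∧ fderiv ℂ (fun w => h (x, w)) w ≠ 0 := by
    by_contra hcon
    have hz := hg.eventually_eq_zero_of_im_eq_zero hdg hg0
      (K := fun w => fderiv ℂ (fun w => h (x, w)) w)
      (by
        filter_upwards [hall] with w hw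
        exact (hsl w (hw.1 x hxN).1).fderiv.differentiableAt)
      (by
        filter_upwards [Filter.not_frequently.1 hcon] with w hw him
        by_contra hne
        exact hw ⟨him, hne⟩)
    obtain ⟨ε, hε, hb⟩ := Metric.eventually_nhds_iff_ball.1 (hz.and hall)
    have hconst : ∀ w ∈ Metric.ball w0 ε, h (x, w) = h (x, w0) := fun w hw =>
      Metric.isOpen_ball.is_const_of_fderiv_eq_zero (convex_ball w0 ε).isPreconnected
        (fun u hu => (hsl u ((hb u hu).2.1 x hxN).1).differentiableAt.differentiableWithinAt)
        (fun u hu => (hb u hu).1) hw (Metric.mem_ball_self hε)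
    have hc := ((hb w0 (Metric.mem_ball_self hε)).2.1 x hxN).2.1
    obtain ⟨w, hw, hne⟩ := H.nonconst x (hNb hxN) _ (Metric.ball_subset_closedBall hc)
    refine hne (DifferentiableOn.eqOn_zero_of_eventually_eq_zero
      (K := fun w => R ((x, h (x, w0)), w)) H.convex H.isOpen (fun u hu => ?_) hw0 ?_ hw)
    · refine (AnalyticAt.fun_comp (g := R) (f := fun w => ((x, h (x, w0)), w))
        (H.analytic _ ⟨H.mem x (hNb hxN) _ (Metric.ball_subset_closedBall hc), hu⟩)
        (analyticAt_const.prod analyticAt_id)).differentiableAt.differentiableWithinAt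
    · filter_upwards [Metric.ball_mem_nhds w0 hε] with u hu
      rw [← hconst u hu]
      exact ((hb u hu).2.1 x hxN).2.2
  obtain ⟨w, ⟨hgw, hne⟩, hall', hgan, hgd⟩ := (hfreq.and_eventually (hall.eventually_nhds.and
    (hg.eventually_analyticAt.and (hg.eventually_fderiv_ne_zero hdg)))).exists
  obtain ⟨Ψ, hΨ, hΨw, hΨd, hgΨ, hmap⟩ := hgan.exists_straightening hgd
  have hΨlim : Tendsto Ψ (𝓝 w) (𝓝 w) := hmap.le
  set l := fderiv ℂ g w
  set K := fderiv ℂ (fun w => h (x, w)) w with hK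
  obtain ⟨e, hle, hKe⟩ : ∃ e, (l e).im = 0 ∧ K e ≠ 0 := by
    obtain ⟨u, hu⟩ : ∃ u, K u ≠ 0 := by
      by_contra! hcon
      exact hne (ContinuousLinearMap.ext hcon)
    by_cases hlu : l u = 0
    · exact ⟨u, by simp [hlu], hu⟩
    · exact ⟨(l u)⁻¹ • u, by simp [hlu], by simp [hlu, hu]⟩
  have hallw := hall'.self_of_nhds
  have hhx := (hallw.1 x hxN).1
  set γ : ℂ → Xb × ℂ := fun s => Ψ (w + s • e) with hγ
  have hγ0 : γ 0 = w := by simp [hγ, hΨw]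
  have hγan : AnalyticAt ℂ γ 0 := by
    refine AnalyticAt.fun_comp (g := Ψ) (f := fun s : ℂ => w + s • e) (by simpa using hΨ) ?_
    exact analyticAt_const.add (analyticAt_id.smul analyticAt_const)
  have hγd : HasDerivAt γ e 0 := by
    have h1 : HasDerivAt (fun s : ℂ => w + s • e) e 0 := by
      simpa using ((hasDerivAt_id (0 : ℂ)).smul_const e).const_add w
    have h2 : HasFDerivAt Ψ (.id ℂ (Xb × ℂ)) (w + (0 : ℂ) • e) := by simpa using hΨd
    exact h2.comp_hasDerivAt 0 h1
  have hγlim : Tendsto (fun s : ℂ => w + s • e) (𝓝 0) (𝓝 w) := by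
    have : ContinuousAt (fun s : ℂ => w + s • e) 0 := by fun_prop
    simpa [ContinuousAt] using this
  have hhan : AnalyticAt ℂ (fun q : Xb × ℂ => h (q.1, γ q.2)) (x, 0) := by
    refine AnalyticAt.fun_comp (g := h) (f := fun q : Xb × ℂ => (q.1, γ q.2))
      (by simpa [hγ0] using hhx) ?_
    exact analyticAt_fst.prod (AnalyticAt.fun_comp (g := γ) (f := Prod.snd) hγan analyticAt_snd)
  refine ⟨x, fun q => h (q.1, γ q.2), hxs, hhan, ?_, ?_, ?_, ?_⟩
  · simp only [hγ0]
    exact H.mem x (hNb hxN) _ (Metric.ball_subset_closedBall (hallw.1 x hxN).2.1)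
  · have h1 := hasDerivAt_lastDeriv hhan
    have h2 : HasFDerivAt (fun w => h (x, w)) K (γ 0) := by
      rw [hγ0]; exact (hsl w hhx).differentiableAt.hasFDerivAt
    have h3 : HasDerivAt (fun t => h (x, γ t)) (K e) 0 := h2.comp_hasDerivAt 0 hγd
    rw [h1.unique h3]
    exact hKe
  · have h4 : ∀ᶠ q : Xb × ℂ in 𝓝 (x, 0), q.1 ∈ N :=
      continuous_fst.continuousAt.eventually (hNo.mem_nhds hxN)
    have h5 : Tendsto (fun q : Xb × ℂ => w + q.2 • e) (𝓝 (x, 0)) (𝓝 w) :=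
      hγlim.comp (continuous_snd.tendsto (x, (0 : ℂ)))
    filter_upwards [h4, h5.eventually (hΨlim.eventually hall'), h5.eventually hgΨ]
      with q h6 h7 h8 him
    refine (h7.2 ?_).1 q.1 h6
    rw [h8, add_sub_cancel_left, map_smul, smul_eq_mul, Complex.add_im, hgw]
    simp [Complex.mul_im, him, hle]
  · intro hcon
    obtain ⟨x', hx', hne'⟩ := (hallw.2 hgw).2
    refine hne' ?_
    have hQan : AnalyticOnNhd ℝ (fun x' => Q (x', h (x', w))) N := fun u hu => by
      have h9 := hallw.1 u hu
      refine AnalyticAt.fun_comp (g := Q) (f := fun x' => (x', h (x', w)))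
        (hQ _ (H.mem u (hNb hu) _ (Metric.ball_subset_closedBall h9.2.1))) ?_
      exact analyticAt_id.prod (AnalyticAt.fun_comp (g := h) (f := fun x' => (x', w))
        h9.1 (analyticAt_id.prod analyticAt_const)).restrictScalars
    refine hQan.eqOn_zero_of_preconnected_of_eventuallyEq_zero hNp hxN ?_ hx'
    filter_upwards [hcon] with u hu
    simpa [hγ0] using hu

theorem frequently_slice_ne_zero {K : ℂ → ℂ} {S : Set ℂ} (hS : Convex ℝ S) (hSo : IsOpen S)
    (hK : DifferentiableOn ℂ K S) {a c : ℂ} (ha : a ∈ S) (hc : c ∈ S) (hne : K c ≠ 0) :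
    ∃ᶠ z in 𝓝 a, K z ≠ 0 := fun hcon =>
  hne (hK.eqOn_zero_of_eventually_eq_zero hS hSo ha
    (by filter_upwards [hcon] with z hz using not_not.1 hz) hc)

theorem exists_reflectionFamily {R : (Xb × ℂ) × (Xb × ℂ) → ℂ} {Ω : Set (Xb × ℂ)}
    [CompleteSpace Xb] (hΩo : IsOpen Ω) (hΩc : Convex ℝ Ω) (hΩs : ∀ z ∈ Ω, star z ∈ Ω)
    (hR : AnalyticOnNhd ℂ R (Ω ×ˢ Ω)) {p : Xb × ℂ} (hp : p ∈ Ω) (hps : star p = p) {ζ1 : ℂ}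
    (hζ1 : (p.1, ζ1) ∈ Ω) (hne : R ((p.1, ζ1), (p.1, star ζ1)) ≠ 0) :
    ∃ ω η r D, (p.1, ω) ∈ Ω ∧ ReflectionFamily R Ω p.1 ω η r D := by
  obtain ⟨b, p2⟩ := p
  have hbs : star b = b := congrArg Prod.fst hps
  have hp2 : star p2 = p2 := congrArg Prod.snd hps
  simp only at *
  set S : Set ℂ := {ζ | (b, ζ) ∈ Ω} with hS
  have hSo : IsOpen S := hΩo.preimage (by fun_prop)
  have hSc : Convex ℝ S := by
    intro u hu v hv s t hs ht hst
    have := hΩc (x := (b, u)) hu (y := (b, v)) hv hs ht hst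
    have h2 : s • b + t • b = b := by rw [← add_smul, hst, one_smul]
    simpa [h2, hS] using this
  have hSs : star ζ1 ∈ S := by
    have := hΩs _ hζ1
    simpa [hS, Prod.star_def, hbs] using this
  have hd1 : ∀ w ∈ S, DifferentiableOn ℂ (fun ζ => R ((b, ζ), (b, w))) S := fun w hw ζ hζ =>
    (AnalyticAt.fun_comp (g := R) (f := fun ζ => ((b, ζ), (b, w))) (hR _ ⟨hζ, hw⟩)
      ((analyticAt_const.prod analyticAt_id).prod
        analyticAt_const)).differentiableAt.differentiableWithinAt
  have hd2 : DifferentiableOn ℂ (fun w => R ((b, ζ1), (b, w))) S := fun w hw =>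
    (AnalyticAt.fun_comp (g := R) (f := fun w => ((b, ζ1), (b, w))) (hR _ ⟨hζ1, hw⟩)
      (analyticAt_const.prod (analyticAt_const.prod
        analyticAt_id))).differentiableAt.differentiableWithinAt
  have hiso : ∀ K : ℂ → ℂ, DifferentiableOn ℂ K S → (∃ᶠ z in 𝓝 p2, K z ≠ 0) →
      ∀ᶠ z in 𝓝[≠] p2, K z ≠ 0 := by
    intro K hK h
    rcases ((hK.analyticOnNhd hSo) p2 hp).eventually_eq_zero_or_eventually_ne_zero with h1 | h1
    · exact absurd h (by simpa [Filter.not_frequently] using h1)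
    · exact h1
  have hev := ((hiso _ (hd1 _ hSs) (frequently_slice_ne_zero hSc hSo (hd1 _ hSs) hp hζ1 hne)).and
    (hiso _ hd2 (frequently_slice_ne_zero hSc hSo hd2 hp hSs hne))).and
    (mem_nhdsWithin_of_mem_nhds (hSo.mem_nhds hp))
  have hreal : Tendsto (fun t : ℝ => p2 + t) (𝓝[≠] 0) (𝓝[≠] p2) := by
    refine tendsto_nhdsWithin_iff.2 ⟨?_, ?_⟩
    · have : Continuous (fun t : ℝ => p2 + t) := by fun_prop
      simpa using (this.tendsto 0).mono_left (nhdsWithin_le_nhds (s := {0}ᶜ))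
    · filter_upwards [self_mem_nhdsWithin] with t ht
      simpa using ht
  obtain ⟨t, ⟨ht1, ht2⟩, ht3⟩ := (hreal.eventually hev).exists
  set ω : ℂ := p2 + t with hω
  have hωs : star ω = ω := by
    rw [hω, star_add, hp2]; simp
  replace ht3 : (b, ω) ∈ Ω := ht3
  have hF : AnalyticAt ℂ (fun q : (Xb × (Xb × ℂ)) × ℂ => R ((q.1.1, q.2), q.1.2))
      ((b, (b, ω)), ω) := by
    refine AnalyticAt.fun_comp (g := R)
      (f := fun q : (Xb × (Xb × ℂ)) × ℂ => ((q.1.1, q.2), q.1.2)) (hR _ ⟨ht3, ht3⟩) ?_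
    have h1 : AnalyticAt ℂ (fun q : (Xb × (Xb × ℂ)) × ℂ => q.1) ((b, (b, ω)), ω) :=
      analyticAt_fst
    exact ((analyticAt_fst.comp h1).prod analyticAt_snd).prod (analyticAt_snd.comp h1)
  have hG : ∀ᶠ q : Xb × ℂ in 𝓝 (b, ω), q ∈ Ω ∧ R (q, (b, star ζ1)) ≠ 0 := by
    have hc : ContinuousAt (fun q : Xb × ℂ => R (q, (b, star ζ1))) (b, ω) :=
      (AnalyticAt.fun_comp (g := R) (f := fun q : Xb × ℂ => (q, (b, star ζ1)))
        (hR _ ⟨ht3, hSs⟩) (analyticAt_id.prod analyticAt_const)).continuousAt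
    exact Filter.Eventually.and (hΩo.mem_nhds ht3) (hc.eventually_ne ht1)
  obtain ⟨δ, hδ, hball⟩ := Metric.eventually_nhds_iff_ball.1 hG
  rw [← ball_prod_same] at hball
  obtain ⟨P, r, hP, hfam, hrV, -⟩ := exists_isZeroFamily hF
    (frequently_slice_ne_zero hSc hSo (hd1 _ ht3) ht3 hζ1 ht2) (Metric.ball_mem_nhds ω hδ)
  obtain ⟨M, hM⟩ := hfam.exists_zeroCount_le hP
  obtain ⟨ε, hε, hε'⟩ := Metric.eventually_nhds_iff_ball.1
    (Filter.Eventually.and (hfam.isOpen.mem_nhds hP) hM)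
  rw [← ball_prod_same] at hε'
  set η := min (min ε δ) r with hη
  have hη0 : 0 < η := lt_min (lt_min hε hδ) hfam.pos
  have hηε : η ≤ ε := (min_le_left _ _).trans (min_le_left _ _)
  have hηδ : η ≤ δ := (min_le_left _ _).trans (min_le_right _ _)
  have hsub : ∀ y ∈ Metric.ball b η ×ˢ Metric.ball (b, ω) η,
      y ∈ Metric.ball b ε ×ˢ Metric.ball (b, ω) ε := fun y hy =>
    ⟨Metric.ball_subset_ball hηε hy.1, Metric.ball_subset_ball hηε hy.2⟩
  have hfam' : IsZeroFamily (fun q : (Xb × (Xb × ℂ)) × ℂ => R ((q.1.1, q.2), q.1.2))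
      (Metric.ball b η ×ˢ Metric.ball (b, ω) η) ω r :=
    ⟨Metric.isOpen_ball.prod Metric.isOpen_ball, hfam.pos,
      fun y hy => hfam.analyticAt y (hε' y (hsub y hy)).1,
      fun y hy => hfam.ne_zero y (hε' y (hsub y hy)).1⟩
  obtain ⟨D, hD1, hD2, hD3⟩ := hfam'.exists_discriminant
    ⟨(b, (b, ω)), Metric.mem_ball_self hη0, Metric.mem_ball_self hη0⟩
    (fun y hy => (hε' y (hsub y hy)).2)
  have hin : ∀ x ∈ Metric.ball b η, ∀ ζ ∈ Metric.closedBall ω r,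
      (x, ζ) ∈ Metric.ball b δ ×ˢ Metric.ball ω δ := fun x hx ζ hζ =>
    ⟨Metric.ball_subset_ball hηδ hx, hrV hζ⟩
  exact ⟨ω, η, r, D, ht3, hbs, hωs, hη0, min_le_right _ _, hΩo, hΩc, hR, hΩs,
    fun x hx ζ hζ => (hball _ (hin x hx ζ hζ)).1,
    fun x hx ζ hζ => ⟨(b, star ζ1), hSs, (hball _ (hin x hx ζ hζ)).2⟩, hfam', hD1, hD2, hD3⟩

/-- If Levi-flat hypersurface germs in `R (z, z̄) = 0` accumulate at all real points, then some
such hypersurface is a graph foliated by `s ↦ h (·, s)` over a real point. -/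
theorem exists_levi_branch {R : (Xb × ℂ) × (Xb × ℂ) → ℂ} {Ω : Set (Xb × ℂ)} {Q : Xb × ℂ → ℝ}
    [CompleteSpace Xb] (hΩo : IsOpen Ω) (hΩc : Convex ℝ Ω) (hΩs : ∀ z ∈ Ω, star z ∈ Ω)
    (hR : AnalyticOnNhd ℂ R (Ω ×ˢ Ω)) (hQ : AnalyticOnNhd ℝ Q Ω) {p : Xb × ℂ} (hp : p ∈ Ω)
    (hps : star p = p) {ζ1 : ℂ} (hζ1 : (p.1, ζ1) ∈ Ω)
    (hne : R ((p.1, ζ1), (p.1, star ζ1)) ≠ 0)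
    (hT : ∀ z ∈ Ω, star z = z → ∃ᶠ q in 𝓝 z, IsLeviPoint R q ∧ Q q ≠ 0) :
    ∃ (x : Xb) (h : Xb × ℂ → ℂ), star x = x ∧ AnalyticAt ℂ h (x, 0) ∧ (x, h (x, 0)) ∈ Ω ∧
      lastDeriv h (x, 0) ≠ 0 ∧
      (∀ᶠ q : Xb × ℂ in 𝓝 (x, 0), q.2.im = 0 → R ((q.1, h q), star (q.1, h q)) = 0) ∧
      ∃ᶠ x' in 𝓝 x, Q (x', h (x', 0)) ≠ 0 := by
  obtain ⟨ω, η, r, D, hω, H⟩ := exists_reflectionFamily hΩo hΩc hΩs hR hp hps hζ1 hne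
  exact H.exists_levi_branch hQ (hT _ hω (by rw [Prod.star_def, H.star_fst, H.star_snd]))

end Reflection

/-- Near a branch `h` over which `f` vanishes for real parameters, the zero set of `f` is locally
no bigger than the hypersurface at a dense set of points of the hypersurface. -/
theorem mem_closure_zero_subset {Xb : Type*} [NormedAddCommGroup Xb] [NormedSpace ℂ Xb] [CompleteSpace Xb]
    {Θ Ψ : Xb × ℂ → Xb × ℂ} {f : Xb × ℂ → ℝ} {q0 q : Xb × ℂ} (hΘ : AnalyticAt ℂ Θ q0)
    (hΨ : AnalyticAt ℂ Ψ q) (hΘq : Θ q0 = q) (hΨq : Ψ q = q0)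
    (hΘΨ : ∀ᶠ z in 𝓝 q, Θ (Ψ z) = z) (hΨΘ : ∀ᶠ y in 𝓝 q0, Ψ (Θ y) = y)
    (hf : AnalyticAt ℝ f q) (hne : ∀ᶠ z in 𝓝 q, ∃ᶠ z' in 𝓝 z, f z' ≠ 0) :
    ∀ᶠ z in 𝓝 q, (Ψ z).2.im = 0 →
      z ∈ closure {y | (Ψ y).2.im = 0 ∧ ∀ᶠ z' in 𝓝 y, f z' = 0 → (Ψ z').2.im = 0} := by
  have hΘt : Tendsto Θ (𝓝 q0) (𝓝 q) := hΘq ▸ hΘ.continuousAt.tendsto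
  have hΨt : Tendsto Ψ (𝓝 q) (𝓝 q0) := hΨq ▸ hΨ.continuousAt.tendsto
  have hgood : ∀ᶠ y in 𝓝 q0, AnalyticAt ℂ Θ y ∧ Ψ (Θ y) = y ∧ AnalyticAt ℝ f (Θ y) ∧
      AnalyticAt ℂ Ψ (Θ y) ∧ ∀ᶠ z in 𝓝 (Θ y), Θ (Ψ z) = z := by
    filter_upwards [hΘ.eventually_analyticAt, hΨΘ, hΘt.eventually hf.eventually_analyticAt,
      hΘt.eventually hΨ.eventually_analyticAt, hΘt.eventually hΘΨ.eventually_nhds]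
      with y h1 h2 h3 h4 h5 using ⟨h1, h2, h3, h4, h5⟩
  set β : (Xb × ℝ) × ℝ → Xb × ℂ := fun w => (w.1.1, (w.1.2 : ℂ) + (w.2 : ℂ) * I) with hβ
  set γ : Xb × ℂ → (Xb × ℝ) × ℝ := fun z => ((z.1, z.2.re), z.2.im) with hγ
  have hβγ : ∀ z, β (γ z) = z := fun z => Prod.ext rfl (Complex.re_add_im z.2)
  have hγβ : ∀ w, γ (β w) = w := fun w => by
    refine Prod.ext (Prod.ext rfl ?_) ?_ <;> simp [hβ, hγ]
  have hβc : Continuous β := by fun_prop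
  have hγc : Continuous γ := by fun_prop
  have hβa : ∀ w, AnalyticAt ℝ β w := fun w => by
    have h1 : AnalyticAt ℝ (fun w : (Xb × ℝ) × ℝ => w.1) w := analyticAt_fst
    refine (analyticAt_fst.comp h1).prod (AnalyticAt.add ?_ (AnalyticAt.mul ?_ analyticAt_const))
    · exact (Complex.ofRealCLM.analyticAt _).comp (analyticAt_snd.comp h1)
    · exact (Complex.ofRealCLM.analyticAt _).comp analyticAt_snd
  filter_upwards [hΨt.eventually hgood.eventually_nhds, hΘΨ, hne] with z hz hΘz hnez him
  rw [mem_closure_iff_nhds]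
  intro O hO
  set w0 := γ (Ψ z) with hw0
  have hw02 : w0 = ((w0.1, (0 : ℝ)) : (Xb × ℝ) × ℝ) := Prod.ext rfl him
  have hβw0 : β w0 = Ψ z := hβγ _
  have hcz : ContinuousAt Θ (Ψ z) := hz.self_of_nhds.1.continuousAt
  have hO' : ∀ᶠ w in 𝓝 w0, Θ (β w) ∈ O := by
    have h1 : ContinuousAt (fun w => Θ (β w)) w0 :=
      ContinuousAt.comp (g := Θ) (by rw [hβw0]; exact hcz) hβc.continuousAt
    exact h1.eventually (by simpa [hβw0, hΘz] using hO)
  have hgoodw : ∀ᶠ w in 𝓝 w0, AnalyticAt ℂ Θ (β w) ∧ Ψ (Θ (β w)) = β w ∧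
      AnalyticAt ℝ f (Θ (β w)) ∧ AnalyticAt ℂ Ψ (Θ (β w)) ∧
      ∀ᶠ z in 𝓝 (Θ (β w)), Θ (Ψ z) = z := by
    have h1 : Tendsto β (𝓝 w0) (𝓝 (Ψ z)) := hβw0 ▸ hβc.tendsto w0
    exact h1.eventually hz
  obtain ⟨δ, hδ, hball⟩ := Metric.eventually_nhds_iff_ball.1 (hO'.and hgoodw)
  have hF : AnalyticOnNhd ℝ (fun w => f (Θ (β w))) (Metric.ball w0 δ) := fun w hw => by
    have h2 := (hball w hw).2
    exact AnalyticAt.fun_comp (g := f) (f := fun w => Θ (β w)) h2.2.2.1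
      (AnalyticAt.fun_comp (g := Θ) (f := β) h2.1.restrictScalars (hβa w))
  obtain ⟨y0, hy0, hy0'⟩ := exists_zero_subset_hyperplane Metric.isOpen_ball
    (convex_ball w0 δ).isPreconnected hF (y1 := w0.1)
    (by rw [← hw02]; exact Metric.mem_ball_self hδ) (by
      have hzΘ : Θ (Ψ z) = z := hΘz
      have hΨz : AnalyticAt ℂ Ψ z := by
        have := hz.self_of_nhds.2.2.2.1
        rwa [hzΘ] at this
      have h3 : ∀ᶠ z' in 𝓝 z, Θ (Ψ z') = z' := by
        have := hz.self_of_nhds.2.2.2.2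
        rwa [hzΘ] at this
      have h4 : ∀ᶠ z' in 𝓝 z, γ (Ψ z') ∈ Metric.ball w0 δ :=
        (hγc.continuousAt.comp hΨz.continuousAt).eventually (Metric.ball_mem_nhds _ hδ)
      obtain ⟨z', hz', h5, h6⟩ := (hnez.and_eventually (h3.and h4)).exists
      exact ⟨γ (Ψ z'), h6, by rwa [hβγ, h5]⟩)
  obtain ⟨h1, h2, h3, h4, h5, h6⟩ := hball _ hy0
  have him0 : (Ψ (Θ (β (y0, 0)))).2.im = 0 := by rw [h3]; simp [hβ]
  refine ⟨Θ (β (y0, 0)), h1, him0, ?_⟩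
  have h7 : Tendsto (fun z' => γ (Ψ z')) (𝓝 (Θ (β (y0, 0)))) (𝓝 (y0, 0)) := by
    have := (hγc.continuousAt.comp h5.continuousAt).tendsto
    simpa [h3, hγβ, Function.comp_def] using this
  filter_upwards [h7.eventually hy0', h6] with z' h8 h9 h10
  refine h8 ?_
  rw [hβγ, h9, h10]

theorem exists_graph_inverse {Xb : Type*} [NormedAddCommGroup Xb] [NormedSpace ℂ Xb]
    [CompleteSpace Xb] {h : Xb × ℂ → ℂ} {x : Xb} (hh : AnalyticAt ℂ h (x, 0))
    (hd : lastDeriv h (x, 0) ≠ 0) :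
    ∃ Ψ : Xb × ℂ → Xb × ℂ, AnalyticAt ℂ Ψ (x, h (x, 0)) ∧ Ψ (x, h (x, 0)) = (x, 0) ∧
      fderiv ℂ (fun z => (Ψ z).2) (x, h (x, 0)) ≠ 0 ∧
      (∀ᶠ z in 𝓝 (x, h (x, 0)), ((Ψ z).1, h (Ψ z)) = z) ∧
      ∀ᶠ y in 𝓝 (x, 0), Ψ (y.1, h y) = y := by
  set Θ : Xb × ℂ → Xb × ℂ := fun y => (y.1, h y) with hΘ
  have hΘa : AnalyticAt ℂ Θ (x, 0) := analyticAt_fst.prod hh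
  set d := fderiv ℂ h (x, 0) with hdd
  set l : Xb →L[ℂ] ℂ := d.comp (.inl ℂ Xb ℂ) with hl
  set L : (Xb × ℂ) ≃L[ℂ] Xb × ℂ := (ContinuousLinearEquiv.refl ℂ Xb).skewProd
    (ContinuousLinearEquiv.unitsEquivAut ℂ (Units.mk0 _ hd)) l with hL
  have hLd : HasFDerivAt Θ (L : Xb × ℂ →L[ℂ] Xb × ℂ) (x, 0) := by
    refine (hasFDerivAt_fst.prodMk hh.differentiableAt.hasFDerivAt).congr_fderiv ?_
    refine ContinuousLinearMap.ext fun u => Prod.ext rfl ?_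
    have : u = (u.1, 0) + u.2 • ((0 : Xb), (1 : ℂ)) := by simp
    have h2 : d u = d (u.1, 0) + u.2 * d (0, 1) := by
      conv_lhs => rw [this]
      rw [map_add, map_smul, smul_eq_mul]
    simp [hL, hl, lastDeriv, ← hdd, h2, add_comm]
  obtain ⟨Ψ, h1, h2, h3, h4, h5⟩ := hΘa.exists_local_inverse hLd
  refine ⟨Ψ, h1, h2, ?_, h4, h5⟩
  have h6 : HasFDerivAt (fun z => (Ψ z).2)
      ((ContinuousLinearMap.snd ℂ Xb ℂ).comp (L.symm : Xb × ℂ →L[ℂ] Xb × ℂ)) (Θ (x, 0)) :=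
    (ContinuousLinearMap.snd ℂ Xb ℂ).hasFDerivAt.comp _ h3
  intro hcon
  have h7 := h6.fderiv.symm.trans hcon
  have h8 := congrArg (fun T : Xb × ℂ →L[ℂ] ℂ => T (L (0, 1))) h7
  simp at h8

section LeviFunction

variable {Xb : Type*} [NormedAddCommGroup Xb] [NormedSpace ℂ Xb] [StarAddMonoid Xb]
  [NormedStarGroup Xb] [StarModule ℂ Xb] [CompleteSpace Xb]

/-- A holomorphic function taking real values at real points commutes with conjugation. -/
theorem AnalyticAt.eventually_star_apply {E : Type*} [NormedAddCommGroup E] [NormedSpace ℂ E]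
    [StarAddMonoid E] [NormedStarGroup E] [StarModule ℂ E] [CompleteSpace E] {f : E → ℂ} {q : E}
    (hf : AnalyticAt ℂ f q) (hq : star q = q)
    (h : ∀ᶠ z in 𝓝 q, star z = z → star (f z) = f z) : ∀ᶠ z in 𝓝 q, f (star z) = star (f z) := by
  have hf' : AnalyticAt ℂ (fun z => star (f (star z))) q :=
    AnalyticAt.star_comp_star (by rwa [hq])
  obtain ⟨ε, hε, hb⟩ := Metric.eventually_nhds_iff_ball.1
    ((hf.eventually_analyticAt.and hf'.eventually_analyticAt).and h)
  have hst : ∀ z ∈ Metric.ball q ε, star z ∈ Metric.ball q ε := fun z hz => by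
    rw [mem_ball_iff_norm] at hz ⊢
    rwa [← hq, ← star_sub, norm_star]
  have h0 := DifferentiableOn.eqOn_zero_of_real (K := fun z => f z - star (f (star z)))
    (convex_ball q ε) Metric.isOpen_ball hst
    (fun z hz => ((hb z hz).1.1.sub (hb z hz).1.2).differentiableAt.differentiableWithinAt)
    (fun z hz hzs => by simp only [hzs, (hb z hz).2 hzs, sub_self])
  filter_upwards [Metric.ball_mem_nhds q hε] with z hz
  have := sub_eq_zero.1 (h0 hz)
  rw [this, star_star]

/-- The output of the accumulation argument, phrased through a holomorphic function `g` which is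
real at real points and whose real level set lies in `R (z, z̄) = 0`. -/
theorem exists_levi_function {R : (Xb × ℂ) × (Xb × ℂ) → ℂ} {Ω : Set (Xb × ℂ)} {Q : Xb × ℂ → ℝ}
    (hΩo : IsOpen Ω) (hΩc : Convex ℝ Ω) (hΩs : ∀ z ∈ Ω, star z ∈ Ω)
    (hR : AnalyticOnNhd ℂ R (Ω ×ˢ Ω)) (hQ : AnalyticOnNhd ℝ Q Ω)
    (hRre : ∀ z ∈ Ω, (R (z, star z)).im = 0)
    (hyp : ∀ z ∈ Ω, star z.1 = z.1 → R (z, star z) = 0 → star z = z)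
    (hne : ∀ z ∈ Ω, ∃ᶠ z' in 𝓝 z, R (z', star z') ≠ 0)
    {p : Xb × ℂ} (hp : p ∈ Ω) (hps : star p = p)
    (hT : ∀ z ∈ Ω, star z = z → ∃ᶠ q in 𝓝 z, IsLeviPoint R q ∧ Q q ≠ 0) :
    ∃ (x : Xb) (h g : Xb × ℂ → ℂ), AnalyticAt ℂ h (x, 0) ∧ (x, h (x, 0)) ∈ Ω ∧
      star (x, h (x, 0)) = (x, h (x, 0)) ∧ AnalyticAt ℂ g (x, h (x, 0)) ∧ g (x, h (x, 0)) = 0 ∧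
      fderiv ℂ g (x, h (x, 0)) ≠ 0 ∧
      (∀ᶠ z in 𝓝 (x, h (x, 0)), (g z).im = 0 → R (z, star z) = 0) ∧
      (∀ᶠ z in 𝓝 (x, h (x, 0)), g (star z) = star (g z)) ∧
      (∀ᶠ x' in 𝓝 x, g (x', h (x', 0)) = 0) ∧
      (∀ᶠ x' in 𝓝 x, star x' = x' → star (h (x', 0)) = h (x', 0)) ∧
      (∃ᶠ x' in 𝓝 x, Q (x', h (x', 0)) ≠ 0) ∧
      ∀ᶠ z in 𝓝 (x, h (x, 0)), (g z).im = 0 →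
        z ∈ closure {y | (g y).im = 0 ∧ ∀ᶠ z' in 𝓝 y, R (z', star z') = 0 → (g z').im = 0} := by
  obtain ⟨ζ1, hζ1, hζne⟩ : ∃ ζ1, (p.1, ζ1) ∈ Ω ∧ R ((p.1, ζ1), (p.1, star ζ1)) ≠ 0 := by
    have hp1 : star p.1 = p.1 := congrArg Prod.fst hps
    have hp2 : star p.2 = p.2 := congrArg Prod.snd hps
    have hc : Continuous fun t : ℝ => (p.1, p.2 + t * I) := by fun_prop
    have h1 : ∀ᶠ t : ℝ in 𝓝[≠] 0, (p.1, p.2 + t * I) ∈ Ω :=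
      (hc.continuousAt.eventually (hΩo.mem_nhds (by simpa using hp))).filter_mono
        nhdsWithin_le_nhds
    obtain ⟨t, ht, ht0⟩ := (h1.and self_mem_nhdsWithin).exists
    refine ⟨_, ht, fun h0 => ht0 ?_⟩
    have h2 := hyp _ ht hp1 (by rw [Prod.star_def]; simpa only [hp1] using h0)
    have h3 : star (p.2 + t * I) = p.2 + t * I := congrArg Prod.snd h2
    rw [star_add, hp2] at h3
    have h4 := congrArg Complex.im h3
    simp only [add_im, star_def, conj_im, mul_im, ofReal_re, I_im, ofReal_im, I_re] at h4
    simp only [Set.mem_singleton_iff]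
    linarith
  obtain ⟨x, h, hxs, hh, hmem, hd, hRz, hQne⟩ :=
    exists_levi_branch hΩo hΩc hΩs hR hQ hp hps hζ1 hζne hT
  obtain ⟨Ψ, hΨ, hΨ0, hΨd, hΘΨ, hΨΘ⟩ := exists_graph_inverse hh hd
  have hΘa : AnalyticAt ℂ (fun y : Xb × ℂ => (y.1, h y)) (x, 0) := analyticAt_fst.prod hh
  have hΘt : Tendsto (fun y : Xb × ℂ => (y.1, h y)) (𝓝 (x, 0)) (𝓝 (x, h (x, 0))) :=
    hΘa.continuousAt.tendsto
  have hΨt : Tendsto Ψ (𝓝 (x, h (x, 0))) (𝓝 (x, 0)) := by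
    have := hΨ.continuousAt.tendsto; rwa [hΨ0] at this
  have hx0 : star ((x, 0) : Xb × ℂ) = (x, 0) := by rw [Prod.star_def]; simp [hxs]
  have hreal : ∀ᶠ y : Xb × ℂ in 𝓝 (x, 0), star y = y → star (h y) = h y := by
    filter_upwards [hRz, hΘt.eventually (hΩo.mem_nhds hmem)] with y h1 h2 hy
    have hy1 : star y.1 = y.1 := congrArg Prod.fst hy
    have hy2 : star y.2 = y.2 := congrArg Prod.snd hy
    exact congrArg Prod.snd (hyp _ h2 hy1 (h1 (Complex.conj_eq_iff_im.1 hy2)))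
  have hhs := hh.eventually_star_apply hx0 hreal
  have hslice : Tendsto (fun x' : Xb => (x', (0 : ℂ))) (𝓝 x) (𝓝 (x, 0)) := by
    have : Continuous (fun x' : Xb => (x', (0 : ℂ))) := by fun_prop
    exact this.tendsto x
  have hstarc : Tendsto (star : Xb × ℂ → Xb × ℂ) (𝓝 (x, 0)) (𝓝 (x, 0)) := by
    have := (continuous_star (R := Xb × ℂ)).tendsto (x, 0)
    rwa [hx0] at this
  have hga : AnalyticAt ℂ (fun z => (Ψ z).2) (x, h (x, 0)) := analyticAt_snd.comp hΨ
  refine ⟨x, h, fun z => (Ψ z).2, hh, hmem, ?_, hga, by simp only [hΨ0], hΨd, ?_, ?_, ?_, ?_, hQne, ?_⟩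
  · have := hreal.self_of_nhds hx0
    rw [Prod.star_def]; simp only [hxs, this]
  · filter_upwards [hΨt.eventually hRz, hΘΨ] with z h1 h2 h3
    have := h1 h3
    rwa [h2] at this
  · filter_upwards [hΘΨ, hΨt.eventually hhs, hΨt.eventually (hstarc.eventually hΨΘ)]
      with z h1 h2 h3
    have h4 : ((star (Ψ z)).1, h (star (Ψ z))) = star z := by
      rw [h2]
      conv_rhs => rw [← h1]
      rfl
    rw [h4] at h3
    rw [h3]; rfl
  · filter_upwards [hslice.eventually hΨΘ] with x' h1
    rw [h1]
  · filter_upwards [hslice.eventually hreal] with x' h1 h2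
    exact h1 (by rw [Prod.star_def]; simp [h2])
  · have hf : AnalyticAt ℝ (fun z => (R (z, star z)).re) (x, h (x, 0)) :=
      (Complex.reCLM.analyticAt _).comp (AnalyticAt.diag_star (hR _ ⟨hmem, hΩs _ hmem⟩))
    have hiff : ∀ z ∈ Ω, (R (z, star z)).re = 0 ↔ R (z, star z) = 0 := fun z hz =>
      ⟨fun h0 => Complex.ext h0 (hRre z hz), fun h0 => by rw [h0]; rfl⟩
    have h1 := mem_closure_zero_subset hΘa hΨ rfl hΨ0 hΘΨ hΨΘ hf (by
      filter_upwards [hΩo.mem_nhds hmem] with z hz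
      refine ((hne z hz).and_eventually (hΩo.mem_nhds hz)).mono fun z' h2 => ?_
      exact fun h3 => h2.1 ((hiff _ h2.2).1 h3))
    filter_upwards [h1, hΩo.mem_nhds hmem] with z h2 hzΩ h3
    refine closure_mono ?_ ((hΩo.closure_inter (s := _)) ⟨h2 h3, hzΩ⟩)
    rintro y ⟨⟨h4, h5⟩, hyΩ⟩
    refine ⟨h4, ?_⟩
    filter_upwards [h5, hΩo.mem_nhds hyΩ] with z' h6 h7 h8
    exact h6 ((hiff _ h7).2 h8)

end LeviFunction

section Descent

variable {E F : Type*} [NormedAddCommGroup E] [NormedSpace ℂ E] [CompleteSpace E]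
  [NormedAddCommGroup F] [NormedSpace ℂ F] [CompleteSpace F]

theorem AnalyticAt.eventually_surjective_fderiv {φ : E → F} {q : E} (hφ : AnalyticAt ℂ φ q)
    {S : F →L[ℂ] E} (hS : ∀ w, fderiv ℂ φ q (S w) = w) :
    ∀ᶠ z in 𝓝 q, Function.Surjective (fderiv ℂ φ z) := by
  have hc : ContinuousAt (fun z => (fderiv ℂ φ z).comp S) q :=
    hφ.fderiv.continuousAt.clm_comp continuousAt_const
  have h1 : (fderiv ℂ φ q).comp S = 1 := ContinuousLinearMap.ext hS
  have h2 : ∀ᶠ z in 𝓝 q, IsUnit ((fderiv ℂ φ z).comp S) :=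
    hc.eventually (by simp only [h1]; exact Units.isOpen.mem_nhds isUnit_one)
  filter_upwards [h2] with z hz w
  obtain ⟨u, hu⟩ := hz
  refine ⟨S (((u⁻¹ : (F →L[ℂ] F)ˣ) : F →L[ℂ] F) w), ?_⟩
  have h3 : (u : F →L[ℂ] F) * ((u⁻¹ : (F →L[ℂ] F)ˣ) : F →L[ℂ] F) = 1 := u.mul_inv
  rw [hu] at h3
  exact congrArg (fun T : F →L[ℂ] F => T w) h3

theorem AnalyticAt.map_nhds_eq_of_surjective {φ : E → F} {q : E} (hφ : AnalyticAt ℂ φ q)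
    (hs : Function.Surjective (fderiv ℂ φ q)) : map φ (𝓝 q) = 𝓝 (φ q) :=
  HasStrictFDerivAt.map_nhds_eq_of_surj
    ((hφ.contDiffAt (n := ⊤)).hasStrictFDerivAt (by simp)) (LinearMap.range_eq_top.2 hs)

theorem HasDerivAt.eq_zero_of_im_eq_zero {u : ℂ → ℂ} {c t : ℂ} (hu : HasDerivAt u c t)
    (h : ∀ᶠ s in 𝓝 t, (u s).im = 0) : c = 0 := by
  have h1 : HasFDerivAt (fun s => (u s).im)
      (Complex.imCLM.comp ((ContinuousLinearMap.toSpanSingleton ℂ c).restrictScalars ℝ)) t :=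
    Complex.imCLM.hasFDerivAt.comp t (hu.hasFDerivAt.restrictScalars ℝ)
  have h2 : HasFDerivAt (fun s => (u s).im) (0 : ℂ →L[ℝ] ℝ) t :=
    (hasFDerivAt_const (0 : ℝ) t).congr_of_eventuallyEq h
  have h3 := h1.unique h2
  have h4 := congrArg (fun T : ℂ →L[ℝ] ℝ => T 1) h3
  have h5 := congrArg (fun T : ℂ →L[ℝ] ℝ => T I) h3
  simp at h4 h5
  exact Complex.ext h5 h4

theorem AnalyticAt.exists_factor {φ : E → F} {q : E} (hφ : AnalyticAt ℂ φ q) {S : F →L[ℂ] E}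
    (hS : ∀ w, fderiv ℂ φ q (S w) = w) {g : E → ℂ} (hg : AnalyticAt ℂ g q)
    (hd : fderiv ℂ g q ≠ 0) (h0 : (g q).im = 0) {H : Set F}
    (hY : ∀ᶠ z in 𝓝 q, (g z).im = 0 → φ z ∈ H)
    (hdense : ∀ᶠ z in 𝓝 q, (g z).im = 0 →
      z ∈ closure {y | (g y).im = 0 ∧ ∀ᶠ z' in 𝓝 y, φ z' ∈ H → (g z').im = 0}) :
    ∃ G : F → ℂ, AnalyticAt ℂ G (φ q) ∧ ∀ᶠ z in 𝓝 q, G (φ z) = g z := by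
  obtain ⟨Ψ, Χ, hΨ, hΧ, hΨ0, hΧ0, hΨd, -, hΧΨ, hΨΧ, hφΨ, hlΧ⟩ := hφ.exists_linear_straightening hS
  set l := fderiv ℂ φ q with hl
  set ι : l.ker →L[ℂ] E := l.ker.subtypeL with hι
  set P : E →L[ℂ] E := .id ℂ E - S.comp l with hP
  have hlP : ∀ v, l (P v) = 0 := fun v => by simp [hP, hS]
  have hΨt : Tendsto Ψ (𝓝 q) (𝓝 q) := by
    have := hΨ.continuousAt.tendsto; rwa [hΨ0] at this
  have hΧt : Tendsto Χ (𝓝 q) (𝓝 q) := by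
    have := hΧ.continuousAt.tendsto; rwa [hΧ0] at this
  have hgΨ : AnalyticAt ℂ (fun y => g (Ψ y)) q :=
    AnalyticAt.fun_comp (g := g) (by rwa [hΨ0]) hΨ
  have hgΨd : fderiv ℂ (fun y => g (Ψ y)) q = fderiv ℂ g q := by
    have h1 : HasFDerivAt g (fderiv ℂ g q) (Ψ q) := by
      rw [hΨ0]; exact hg.differentiableAt.hasFDerivAt
    have h2 : HasFDerivAt (fun y => g (Ψ y)) ((fderiv ℂ g q).comp (.id ℂ E)) q := h1.comp q hΨd
    rw [h2.fderiv, ContinuousLinearMap.comp_id]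
  set K : E → (E →L[ℂ] ℂ) := fun y => (fderiv ℂ (fun y => g (Ψ y)) y).comp P with hK
  have hKan : ∀ᶠ y in 𝓝 q, DifferentiableAt ℂ K y := by
    filter_upwards [hgΨ.eventually_analyticAt] with y hy
    exact hy.fderiv.differentiableAt.clm_comp (differentiableAt_const _)
  have hKA : ∀ᶠ y in 𝓝 q, (g (Ψ y)).im = 0 →
      (∀ᶠ z' in 𝓝 (Ψ y), φ z' ∈ H → (g z').im = 0) → K y = 0 := by
    filter_upwards [hφΨ.eventually_nhds, hgΨ.eventually_analyticAt, hΨt.eventually hY,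
      hΨ.eventually_analyticAt] with y h1 h2 h3 h4 h5 h6
    refine ContinuousLinearMap.ext fun v => ?_
    set κ := P v
    have hcont : Continuous fun t : ℂ => y + t • κ := by fun_prop
    have hct : Tendsto (fun t : ℂ => y + t • κ) (𝓝 0) (𝓝 y) := by
      simpa using hcont.tendsto 0
    have hγ : HasDerivAt (fun t : ℂ => y + t • κ) κ 0 := by
      simpa using ((hasDerivAt_id (0 : ℂ)).smul_const κ).const_add y
    have h7 : HasDerivAt (fun t : ℂ => g (Ψ (y + t • κ))) (K y v) 0 := by
      have h8 : HasFDerivAt (fun y => g (Ψ y)) (fderiv ℂ (fun y => g (Ψ y)) y)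
          (y + (0 : ℂ) • κ) := by simpa using h2.differentiableAt.hasFDerivAt
      have h9 := HasFDerivAt.comp_hasDerivAt (f := fun t : ℂ => y + t • κ)
        (l := fun y => g (Ψ y)) 0 h8 hγ
      exact h9
    refine h7.eq_zero_of_im_eq_zero ?_
    filter_upwards [hct.eventually h1, (h4.continuousAt.tendsto.comp hct).eventually h6]
      with t h8 h9
    refine h9 ?_
    have hκ : l κ = 0 := hlP v
    have h10 := h1.self_of_nhds
    have h11 : l (y + t • κ - q) = l (y - q) := by
      rw [add_sub_right_comm, map_add, map_smul, hκ, smul_zero, add_zero]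
    simp only [Function.comp_apply]
    rw [h8, h11, ← h10]
    exact h3 h5
  have hK0 : ∀ᶠ y in 𝓝 q, K y = 0 := by
    refine hgΨ.eventually_eq_zero_of_im_eq_zero (by rwa [hgΨd]) (by rwa [hΨ0]) hKan ?_
    filter_upwards [hΨt.eventually hdense, hΧΨ, hKan, hKA.eventually_nhds,
      hΨt.eventually hΧ.eventually_analyticAt, hΨt.eventually hΨΧ.eventually_nhds]
      with y h1 h2 h3 h4 h5 h6 h7
    have hc : ContinuousAt (fun z => K (Χ z)) (Ψ y) :=
      ContinuousAt.comp (g := K) (by rw [h2]; exact h3.continuousAt) h5.continuousAt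
    have hA : ∃ᶠ z in 𝓝 (Ψ y), K (Χ z) = 0 := by
      have h8 : ∀ᶠ z in 𝓝 (Ψ y), (g (Ψ (Χ z))).im = 0 →
          (∀ᶠ z' in 𝓝 (Ψ (Χ z)), φ z' ∈ H → (g z').im = 0) → K (Χ z) = 0 := by
        have : Tendsto Χ (𝓝 (Ψ y)) (𝓝 y) := by
          have := h5.continuousAt.tendsto; rwa [h2] at this
        exact this.eventually h4
      refine ((mem_closure_iff_frequently.1 (h1 h7)).and_eventually (h8.and h6)).mono ?_
      rintro z ⟨⟨ha, hb⟩, hc, hd⟩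
      rw [hd] at hc
      exact hc ha hb
    have := (isClosed_singleton (x := (0 : E →L[ℂ] ℂ))).mem_of_frequently_of_tendsto
      hA hc.tendsto
    rw [h2] at this
    exact this
  obtain ⟨ε, hε, hb⟩ := Metric.eventually_nhds_iff_ball.1 (hK0.and hgΨ.eventually_analyticAt)
  have hconst : ∀ y ∈ Metric.ball q ε, ∀ y' ∈ Metric.ball q ε, l (y' - y) = 0 →
      g (Ψ y') = g (Ψ y) := by
    intro y hy y' hy' hl0
    have hso : IsOpen ((fun κ : l.ker => y + (κ : E)) ⁻¹' Metric.ball q ε) :=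
      Metric.isOpen_ball.preimage (by fun_prop)
    have hsc : Convex ℝ ((fun κ : l.ker => y + (κ : E)) ⁻¹' Metric.ball q ε) := by
      intro u hu v hv a b ha hb hab
      have := convex_ball q ε hu hv ha hb hab
      have h2 : a • (y + (u : E)) + b • (y + (v : E)) = y + (a • (u : E) + b • (v : E)) := by
        rw [smul_add, smul_add, add_add_add_comm, ← add_smul, hab, one_smul]
      rw [h2] at this
      exact this
    have hder : ∀ κ ∈ ((fun κ : l.ker => y + (κ : E)) ⁻¹' Metric.ball q ε),
        HasFDerivAt (fun κ : l.ker => g (Ψ (y + (κ : E)))) (0 : l.ker →L[ℂ] ℂ) κ := by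
      intro κ hκ
      have h1 : HasFDerivAt (fun κ : l.ker => y + (κ : E)) ι κ :=
        (ι.hasFDerivAt (x := κ)).const_add y
      have h2 := (hb _ hκ).2.differentiableAt.hasFDerivAt.comp κ h1
      refine h2.congr_fderiv (ContinuousLinearMap.ext fun κ' => ?_)
      have h3 := congrArg (fun T : E →L[ℂ] ℂ => T (κ' : E)) (hb _ hκ).1
      have h4 : l (κ' : E) = 0 := κ'.2
      simpa [hK, hP, h4, hι] using h3
    have := hso.is_const_of_fderiv_eq_zero (𝕜 := ℂ) hsc.isPreconnected
      (fun κ hκ => (hder κ hκ).differentiableAt.differentiableWithinAt)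
      (fun κ hκ => (hder κ hκ).fderiv) (x := ⟨y' - y, hl0⟩) (y := 0) (by simpa using hy')
      (by simpa using hy)
    simpa using this
  have hσ : ∀ w, AnalyticAt ℂ (fun w => q + S (w - φ q)) w := fun w =>
    analyticAt_const.add ((S.analyticAt _).comp (analyticAt_id.sub analyticAt_const))
  refine ⟨fun w => g (Ψ (q + S (w - φ q))), ?_, ?_⟩
  · exact AnalyticAt.fun_comp (g := fun y => g (Ψ y)) (by simpa using hgΨ) (hσ _)
  · have h1 : Tendsto (fun z => q + S (φ z - φ q)) (𝓝 q) (𝓝 q) := by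
      have : ContinuousAt (fun z => q + S (φ z - φ q)) q :=
        ContinuousAt.comp (g := fun w => q + S (w - φ q)) (hσ _).continuousAt hφ.continuousAt
      simpa [ContinuousAt] using this
    filter_upwards [h1.eventually (Metric.ball_mem_nhds q hε),
      hΧt.eventually (Metric.ball_mem_nhds q hε), hΨΧ] with z h2 h3 h4
    rw [hconst _ h3 _ h2, h4]
    rw [add_sub_right_comm, ← neg_sub (Χ z) q, map_add, map_neg, hlΧ, hS]
    abel

theorem AnalyticAt.eventually_mem_closure_of_factor {φ : E → F} {q : E} (hφ : AnalyticAt ℂ φ q)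
    {S : F →L[ℂ] E} (hS : ∀ w, fderiv ℂ φ q (S w) = w) {g : E → ℂ} {H : Set F} {G : F → ℂ}
    (hG : ∀ᶠ z in 𝓝 q, G (φ z) = g z)
    (hY : ∀ᶠ z in 𝓝 q, (g z).im = 0 → φ z ∈ H)
    (hdense : ∀ᶠ z in 𝓝 q, (g z).im = 0 →
      z ∈ closure {y | (g y).im = 0 ∧ ∀ᶠ z' in 𝓝 y, φ z' ∈ H → (g z').im = 0}) :
    ∀ᶠ w in 𝓝 (φ q), (G w).im = 0 →
      w ∈ closure {w | (G w).im = 0 ∧ ∀ᶠ w' in 𝓝 w, w' ∈ H ↔ (G w').im = 0} := by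
  have hsurj := hφ.eventually_surjective_fderiv hS
  rw [← hφ.map_nhds_eq_of_surjective hsurj.self_of_nhds, eventually_map]
  filter_upwards [hdense, hG.eventually_nhds, hY.eventually_nhds, hφ.eventually_analyticAt,
    hφ.eventually_analyticAt.eventually_nhds, hsurj.eventually_nhds] with z h1 h2 h3 h4 h5 h6 him
  rw [h2.self_of_nhds] at him
  rw [mem_closure_iff_frequently]
  refine h4.continuousAt.tendsto.frequently ?_
  refine ((mem_closure_iff_frequently.1 (h1 him)).and_eventually
    (h2.eventually_nhds.and (h3.eventually_nhds.and (h5.and h6)))).mono ?_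
  rintro y ⟨⟨ha, hb⟩, hc, hd, he, hf⟩
  refine ⟨by rwa [hc.self_of_nhds], ?_⟩
  rw [← he.map_nhds_eq_of_surjective hf, eventually_map]
  filter_upwards [hb, hc, hd] with z' h7 h8 h9
  rw [h8]
  exact ⟨h7, h9⟩

end Descent

section GenericParam

theorem exists_continuousLinearEquiv_prod {V W : Type*} [NormedAddCommGroup V] [NormedSpace ℝ V]
    [FiniteDimensional ℝ V] [NormedAddCommGroup W] [NormedSpace ℝ W] [FiniteDimensional ℝ W]
    (l : V →L[ℝ] W) (hl : Function.Surjective l) {m : ℕ}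
    (hm : m + Module.finrank ℝ W = Module.finrank ℝ V) :
    ∃ (L : V →L[ℝ] (Fin m → ℝ)) (e : V ≃L[ℝ] W × (Fin m → ℝ)), ∀ v, e v = (l v, L v) := by
  have h1 : Module.finrank ℝ (l : V →ₗ[ℝ] W).ker = m := by
    have h2 := LinearMap.finrank_range_add_finrank_ker (l : V →ₗ[ℝ] W)
    rw [LinearMap.range_eq_top.2 hl, finrank_top] at h2
    omega
  obtain ⟨P, hP⟩ := (l : V →ₗ[ℝ] W).ker.exists_isCompl
  obtain ⟨π, hπ⟩ := LinearMap.exists_leftInverse_of_injective (l : V →ₗ[ℝ] W).ker.subtype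
    (Submodule.ker_subtype _)
  let c : (l : V →ₗ[ℝ] W).ker ≃ₗ[ℝ] (Fin m → ℝ) := LinearEquiv.ofFinrankEq _ _ (by simp [h1])
  let L : V →ₗ[ℝ] (Fin m → ℝ) := c.toLinearMap ∘ₗ π
  let e : V →ₗ[ℝ] W × (Fin m → ℝ) := (l : V →ₗ[ℝ] W).prod L
  have he : Function.Injective e := by
    rw [← LinearMap.ker_eq_bot, LinearMap.ker_eq_bot']
    intro v hv
    have hv1 : l v = 0 := congrArg Prod.fst hv
    have hv2 : c (π v) = 0 := congrArg Prod.snd hv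
    have hv3 : π v = 0 := by simpa using hv2
    have hv4 := congrArg (fun f => f ⟨v, hv1⟩) hπ
    simpa [hv3, Subtype.ext_iff, eq_comm] using hv4
  refine ⟨L.toContinuousLinearMap, (LinearEquiv.ofInjectiveOfFinrankEq e he
    (by simp; omega)).toContinuousLinearEquiv, fun v => rfl⟩

theorem eq_zero_of_delForm {N k : ℕ} {r : Fin k → CN N → ℝ} {p : CN N}
    (hlin : LinearIndependent ℂ fun i => delForm N (r i) p) {l : CN N →ₗ[ℂ] ℂ}
    (hl : ∀ v, (∀ i, fderiv ℝ (r i) p v = 0) → l v = 0) : l = 0 := by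
  have key : ∀ l : CN N →ₗ[ℂ] ℂ, (∀ v, (∀ i, fderiv ℝ (r i) p v = 0) → l v = 0) →
      ∃ c : Fin k → ℝ, ∀ v, l v = ∑ i, (c i : ℂ) * delForm N (r i) p v := by
    intro l hl
    have h1 : Complex.reLm ∘ₗ (l.restrictScalars ℝ) ∈
        Submodule.span ℝ (Set.range fun i => (fderiv ℝ (r i) p : CN N →ₗ[ℝ] ℝ)) := by
      refine mem_span_of_iInf_ker_le_ker fun v hv => ?_
      simp only [Submodule.mem_iInf, LinearMap.mem_ker, ContinuousLinearMap.coe_coe] at hv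
      simp [hl v hv]
    obtain ⟨c, hc⟩ := (Submodule.mem_span_range_iff_exists_fun ℝ).1 h1
    have hre : ∀ v, (l v).re = ∑ i, c i * fderiv ℝ (r i) p v := by
      intro v
      have := congrArg (fun f : CN N →ₗ[ℝ] ℝ => f v) hc
      simpa using this.symm
    refine ⟨c, fun v => ?_⟩
    have h2 : (l v).im = - (l (I • v)).re := by simp
    refine Complex.ext ?_ ?_
    · rw [hre]
      simp [delForm]
    · rw [h2, hre]
      simp [delForm]
  obtain ⟨c, hc⟩ := key l hl
  obtain ⟨d, hd⟩ := key (I • l) fun v hv => by simp [hl v hv]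
  have h1 : ∑ i, (I * c i - d i) • delForm N (r i) p = 0 := by
    funext v
    have h2 := hd v
    rw [LinearMap.smul_apply, hc v, smul_eq_mul, Finset.mul_sum] at h2
    simp only [Finset.sum_apply, Pi.smul_apply, smul_eq_mul, Pi.zero_apply, sub_mul,
      Finset.sum_sub_distrib, mul_assoc]
    rw [h2, sub_self]
  have h3 := Fintype.linearIndependent_iff.1 hlin _ h1
  refine LinearMap.ext fun v => ?_
  rw [hc]
  have h4 : ∀ i, c i = 0 := fun i => by simpa using congrArg Complex.im (h3 i)
  simp [h4]

theorem surjective_of_linearIndependent {N k : ℕ} {f : Fin k → (CN N →L[ℝ] ℝ)}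
    (hf : LinearIndependent ℝ f) : Function.Surjective (ContinuousLinearMap.pi f) := by
  by_contra hs
  obtain ⟨l, hl0, hl⟩ := Submodule.exists_le_ker_of_lt_top
    (LinearMap.range (ContinuousLinearMap.pi f : CN N →ₗ[ℝ] (Fin k → ℝ)))
    (lt_top_iff_ne_top.2 fun h => hs (LinearMap.range_eq_top.1 h))
  refine hl0 (LinearMap.pi_ext' fun i => LinearMap.ext_ring ?_)
  refine Fintype.linearIndependent_iff.1 hf (fun i => l (Pi.single i 1)) ?_ i
  ext v
  have h1 : l (fun i => f i v) = 0 := hl ⟨v, rfl⟩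
  rw [LinearMap.pi_apply_eq_sum_univ] at h1
  simp only [smul_eq_mul] at h1
  simp only [sum_apply, smul_apply, smul_eq_mul,
    _root_.zero_apply]
  rw [← h1]
  refine Finset.sum_congr rfl fun i _ => ?_
  rw [mul_comm]
  congr 2
  ext j
  simp [Pi.single_apply, eq_comm]

theorem exists_generic_param {N k : ℕ} {r : Fin k → CN N → ℝ} {p : CN N}
    (hr : ∀ i, AnalyticAt ℝ (r i) p) (hp : ∀ i, r i p = 0)
    (hreal : LinearIndependent ℝ fun i => fderiv ℝ (r i) p)
    (hcx : LinearIndependent ℂ fun i => delForm N (r i) p) :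
    ∃ (m : ℕ) (φ : (Fin m → ℂ) → CN N) (T : CN N →L[ℝ] (Fin m → ℂ)) (S : CN N →L[ℂ] (Fin m → ℂ)),
      m + k = 2 * N ∧ AnalyticAt ℂ φ 0 ∧ φ 0 = p ∧ (∀ w, fderiv ℂ φ 0 (S w) = w) ∧
      (∀ v, star (T v) = T v) ∧
      (∀ᶠ w in 𝓝 p, (∀ i, r i w = 0) → φ (T (w - p)) = w) ∧
      ∀ᶠ x in 𝓝 0, star x = x → (∀ i, r i (φ x) = 0) ∧ T (φ x - p) = x := by
  have hfr : Module.finrank ℝ (CN N) = 2 * N := by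
    simp [Module.finrank_pi_fintype, mul_comm]
  set l : CN N →L[ℝ] (Fin k → ℝ) := ContinuousLinearMap.pi fun i => fderiv ℝ (r i) p with hl
  have hls : Function.Surjective l := surjective_of_linearIndependent hreal
  have hk : k ≤ 2 * N := by
    have := LinearMap.finrank_le_finrank_of_surjective (f := (l : CN N →ₗ[ℝ] (Fin k → ℝ))) hls
    simpa [hfr] using this
  obtain ⟨m, hm⟩ : ∃ m, m + k = 2 * N := ⟨2 * N - k, by omega⟩
  obtain ⟨L, e, he⟩ := exists_continuousLinearEquiv_prod l hls (m := m) (by simpa [hfr] using hm)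
  set Ξ : CN N → (Fin k → ℝ) × (Fin m → ℝ) := fun z => (fun i => r i z, L (z - p)) with hΞ
  have hrpi : AnalyticAt ℝ (fun z i => r i z) p := analyticAt_pi_iff.2 hr
  have hΞa : AnalyticAt ℝ Ξ p :=
    hrpi.prod ((L.analyticAt _).comp (analyticAt_id.sub analyticAt_const))
  have hΞd : HasFDerivAt Ξ (e : CN N →L[ℝ] (Fin k → ℝ) × (Fin m → ℝ)) p := by
    have h1 : HasFDerivAt (fun z i => r i z) l p :=
      hasFDerivAt_pi.2 fun i => (hr i).differentiableAt.hasFDerivAt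
    have h2 : HasFDerivAt (fun z => L (z - p)) L p :=
      L.hasFDerivAt.comp p (hasFDerivAt_sub_const p)
    exact (h1.prodMk h2).congr_fderiv (ContinuousLinearMap.ext fun v => (he v).symm)
  have hΞ0 : Ξ p = (0, 0) := by simp [hΞ, hp]; rfl
  obtain ⟨Ψ, hΨ, hΨ0, hΨd, h1, h2⟩ := hΞa.exists_local_inverse hΞd
  rw [hΞ0] at hΨ hΨ0 hΨd h1
  have hin : AnalyticAt ℝ (fun t : Fin m → ℝ => ((0 : Fin k → ℝ), t)) 0 :=
    analyticAt_const.prod analyticAt_id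
  have hφ' : AnalyticAt ℝ (fun t : Fin m → ℝ => Ψ (0, t)) 0 :=
    AnalyticAt.fun_comp (g := Ψ) hΨ hin
  obtain ⟨φ, hφ, hφe⟩ := hφ'.exists_complexification
  have hz : (fun i : Fin m => (((0 : Fin m → ℝ) i : ℝ) : ℂ)) = 0 := by ext; simp
  rw [hz] at hφ
  have hφ0 : φ 0 = p := by
    have := hφe.self_of_nhds
    rwa [hz, hΨ0] at this
  set ι : (Fin m → ℝ) →L[ℝ] (Fin m → ℂ) :=
    ContinuousLinearMap.pi fun i => Complex.ofRealCLM.comp (ContinuousLinearMap.proj i) with hι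
  have hι' : ∀ t, ι t = fun i => (t i : ℂ) := fun t => rfl
  have hker : ∀ v, l v = 0 → fderiv ℂ φ 0 (ι (L v)) = v := by
    intro v hv
    have h3 : HasFDerivAt (fun t => φ (ι t)) (((fderiv ℂ φ 0).restrictScalars ℝ).comp ι) 0 := by
      have h4 : HasFDerivAt φ ((fderiv ℂ φ 0).restrictScalars ℝ) (ι 0) := by
        rw [map_zero]; exact hφ.differentiableAt.hasFDerivAt.restrictScalars ℝ
      exact h4.comp 0 ι.hasFDerivAt
    have h5 : HasFDerivAt (fun t : Fin m → ℝ => Ψ (0, t))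
        ((e.symm : (Fin k → ℝ) × (Fin m → ℝ) →L[ℝ] CN N).comp (.inr ℝ _ _)) 0 :=
      HasFDerivAt.comp (g := Ψ) 0 hΨd (hasFDerivAt_prodMk_right 0 0)
    have h6 := (h3.congr_of_eventuallyEq (hφe.mono fun t h => h.symm)).unique h5
    have h7 := congrArg (fun A : (Fin m → ℝ) →L[ℝ] CN N => A (L v)) h6
    simp only [ContinuousLinearMap.comp_apply, ContinuousLinearMap.coe_restrictScalars',
      ContinuousLinearMap.inr_apply, ContinuousLinearEquiv.coe_coe] at h7
    rw [h7, ← hv, ← he, ContinuousLinearEquiv.symm_apply_apply]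
  have hsurj : Function.Surjective (fderiv ℂ φ 0) := by
    by_contra hs
    obtain ⟨l', hl0, hl'⟩ := Submodule.exists_le_ker_of_lt_top
      (LinearMap.range (fderiv ℂ φ 0 : (Fin m → ℂ) →ₗ[ℂ] CN N))
      (lt_top_iff_ne_top.2 fun h => hs (LinearMap.range_eq_top.1 h))
    refine hl0 (eq_zero_of_delForm hcx fun v hv => hl' ⟨ι (L v), hker v (funext hv)⟩)
  obtain ⟨S, hS⟩ := ((fderiv ℂ φ 0 : (Fin m → ℂ) →ₗ[ℂ] CN N)).exists_rightInverse_of_surjective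
    (LinearMap.range_eq_top.2 hsurj)
  refine ⟨m, φ, ι.comp L, S.toContinuousLinearMap, hm, hφ, hφ0,
    fun w => congrArg (fun f => f w) hS, fun v => ?_, ?_, ?_⟩
  · ext i
    simp [hι']
  · have ht : Tendsto (fun w => L (w - p)) (𝓝 p) (𝓝 0) := by
      have : Continuous fun w => L (w - p) := by fun_prop
      simpa using this.tendsto p
    filter_upwards [h2, ht.eventually hφe] with w h3 h4 h5
    rw [ContinuousLinearMap.comp_apply, hι', h4]
    have h6 : Ξ w = (0, L (w - p)) := Prod.ext (funext h5) rfl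
    rwa [h6] at h3
  · have hre : Continuous fun x : Fin m → ℂ => fun i => (x i).re := by fun_prop
    have ht : Tendsto (fun x : Fin m → ℂ => fun i => (x i).re) (𝓝 0) (𝓝 0) :=
      hre.tendsto' 0 0 (by ext; simp)
    have ht2 : Tendsto (fun t : Fin m → ℝ => ((0 : Fin k → ℝ), t)) (𝓝 0) (𝓝 (0, 0)) :=
      hin.continuousAt.tendsto
    filter_upwards [ht.eventually hφe, (ht2.comp ht).eventually h1] with x h3 h4 hx
    have h5 : (fun i => ((x i).re : ℂ)) = x :=
      funext fun i => Complex.conj_eq_iff_re.1 (congrFun hx i)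
    rw [h5] at h3
    simp only [Function.comp_apply] at h4
    rw [← h3] at h4
    refine ⟨fun i => congrFun (congrArg Prod.fst h4) i, ?_⟩
    have h6 : L (φ x - p) = fun i => (x i).re := congrArg Prod.snd h4
    rw [ContinuousLinearMap.comp_apply, h6, hι']
    exact h5

end GenericParam

theorem AnalyticAt.exists_polarization {m : ℕ} {f : (Fin m → ℂ) → ℂ} (hf : AnalyticAt ℝ f 0) :
    ∃ R : (Fin m → ℂ) × (Fin m → ℂ) → ℂ, AnalyticAt ℂ R (0, 0) ∧
      ∀ᶠ z in 𝓝 0, R (z, star z) = f z := by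
  set u : (Fin (m + m) → ℝ) →L[ℝ] (Fin m → ℂ) := ContinuousLinearMap.pi fun i =>
    Complex.ofRealCLM.comp (ContinuousLinearMap.proj (Fin.castAdd m i)) +
      I • Complex.ofRealCLM.comp (ContinuousLinearMap.proj (Fin.natAdd m i)) with hu
  have hfu : AnalyticAt ℝ (fun t => f (u t)) 0 :=
    AnalyticAt.fun_comp (g := f) (by rwa [map_zero]) (u.analyticAt 0)
  obtain ⟨F, hF, hFe⟩ := hfu.exists_complexification
  set L : (Fin m → ℂ) × (Fin m → ℂ) →ₗ[ℂ] (Fin (m + m) → ℂ) :=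
    { toFun := fun q => Fin.append (fun i => (q.1 i + q.2 i) / 2) fun i => (q.1 i - q.2 i) / (2 * I)
      map_add' := fun q q' => by
        ext j
        refine Fin.addCases (fun i => ?_) (fun i => ?_) j <;>
          simp [-Fin.natAdd_eq_addNat] <;> ring
      map_smul' := fun c q => by
        ext j
        refine Fin.addCases (fun i => ?_) (fun i => ?_) j <;>
          simp [-Fin.natAdd_eq_addNat] <;> ring } with hL
  refine ⟨fun q => F (L q), AnalyticAt.fun_comp (g := F) ?_
    (L.toContinuousLinearMap.analyticAt (0, 0)), ?_⟩
  · have h1 : L.toContinuousLinearMap (0, 0) = fun i => (((0 : Fin (m + m) → ℝ) i : ℝ) : ℂ) := by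
      have : L.toContinuousLinearMap (0, 0) = 0 := map_zero _
      rw [this]
      ext; simp
    exact h1 ▸ hF
  · set t : (Fin m → ℂ) → (Fin (m + m) → ℝ) := fun z =>
      Fin.append (fun i => (z i).re) fun i => (z i).im with ht
    have htc : Continuous t := by
      refine continuous_pi fun j => ?_
      refine Fin.addCases (fun i => ?_) (fun i => ?_) j <;> simp [ht, -Fin.natAdd_eq_addNat] <;> fun_prop
    have ht0 : t 0 = 0 := by
      ext j
      refine Fin.addCases (fun i => ?_) (fun i => ?_) j <;> simp [ht, -Fin.natAdd_eq_addNat]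
    filter_upwards [(htc.tendsto' 0 0 ht0).eventually hFe] with z hz
    have h1 : u (t z) = z := by
      ext i
      simp [hu, ht, mul_comm I, -Fin.natAdd_eq_addNat]
    have h2 : L (z, star z) = fun i => (t z i : ℂ) := by
      ext j
      refine Fin.addCases (fun i => ?_) (fun i => ?_) j
      · apply Complex.ext <;> simp [hL, ht]
      · have h3 : z i - star (z i) = 2 * I * ((z i).im : ℂ) := by
          apply Complex.ext <;> simp
          ring
        have h4 : L (z, star z) (Fin.natAdd m i) = (z i - star (z i)) / (2 * I) := by simp [hL, -Fin.natAdd_eq_addNat]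
        rw [h4, h3, mul_div_cancel_left₀ _ (by simp)]
        simp [ht, -Fin.natAdd_eq_addNat]
    rw [h2, hz, h1]

theorem exists_equiv_prod_of_star_eq {m : ℕ} {v : Fin m → ℂ} (hv : star v = v) (hv0 : v ≠ 0) :
    ∃ (n : ℕ) (A : ((Fin n → ℂ) × ℂ) ≃L[ℂ] (Fin m → ℂ)),
      (∀ z, A (star z) = star (A z)) ∧ A (0, 1) = v := by
  obtain ⟨i₀, hi₀⟩ := Function.ne_iff.1 hv0
  obtain _ | n := m
  · exact i₀.elim0
  have hvi : ∀ i, (starRingEnd ℂ) (v i) = v i := fun i => congrFun hv i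
  rw [Pi.zero_apply] at hi₀
  set A : ((Fin n → ℂ) × ℂ) ≃ₗ[ℂ] (Fin (n + 1) → ℂ) :=
    { toFun := fun z => i₀.insertNth 0 z.1 + z.2 • v
      invFun := fun w => (fun j => w (i₀.succAbove j) - w i₀ / v i₀ * v (i₀.succAbove j),
        w i₀ / v i₀)
      map_add' := fun z z' => by
        ext j
        refine Fin.succAboveCases i₀ ?_ (fun i => ?_) j <;> simp <;> ring
      map_smul' := fun c z => by
        ext j
        refine Fin.succAboveCases i₀ ?_ (fun i => ?_) j <;> simp <;> ring
      left_inv := fun z => by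
        refine Prod.ext ?_ ?_
        · ext j
          simp [hi₀]
        · simp [hi₀]
      right_inv := fun w => by
        ext j
        refine Fin.succAboveCases i₀ ?_ (fun i => ?_) j <;> simp [hi₀] } with hA
  refine ⟨n, A.toContinuousLinearEquiv, fun z => ?_, ?_⟩
  · ext j
    refine Fin.succAboveCases i₀ ?_ (fun i => ?_) j <;> simp [hA, hvi]
  · ext j
    refine Fin.succAboveCases i₀ ?_ (fun i => ?_) j <;> simp [hA]

theorem exists_isSubmanifold_of_im {N : ℕ} {X : Set (CN N)} {G : CN N → ℂ} {w : CN N}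
    (hG : AnalyticAt ℂ G w) (hd : fderiv ℂ G w ≠ 0)
    (h : ∀ᶠ w' in 𝓝 w, w' ∈ X ↔ (G w').im = 0) : IsSubmanifoldAtDim N (2 * N - 1) X w := by
  obtain _ | N := N
  · exact absurd (Subsingleton.elim _ _) hd
  obtain ⟨V, hV, hVo, hwV⟩ := eventually_nhds_iff.1
    (h.and (hG.eventually_analyticAt.and (hG.eventually_fderiv_ne_zero hd)))
  have h1 : ∀ z ∈ V, HasFDerivAt (fun z => (G z).im)
      (Complex.imCLM.comp ((fderiv ℂ G z).restrictScalars ℝ)) z := fun z hz =>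
    Complex.imCLM.hasFDerivAt.comp z
      ((hV z hz).2.1.differentiableAt.hasFDerivAt.restrictScalars ℝ)
  have hsub : Subsingleton (Fin (2 * (N + 1) - (2 * (N + 1) - 1))) := by
    have : 2 * (N + 1) - (2 * (N + 1) - 1) = 1 := by omega
    rw [this]; infer_instance
  have i₀ : Fin (2 * (N + 1) - (2 * (N + 1) - 1)) := ⟨0, by omega⟩
  have : Unique (Fin (2 * (N + 1) - (2 * (N + 1) - 1))) := uniqueOfSubsingleton i₀
  refine ⟨V, fun _ z => (G z).im, hVo, hwV, fun _ z hz => ?_, fun z hz => ?_, ?_⟩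
  · exact ((Complex.imCLM.analyticAt _).comp
      ((hV z hz).2.1.restrictScalars (𝕜 := ℝ))).analyticWithinAt
  · refine linearIndependent_unique_iff.2 ?_
    simp only [(h1 z hz).fderiv]
    intro h0
    refine (hV z hz).2.2 (ContinuousLinearMap.ext fun v => ?_)
    have h2 := fun v => congrArg (fun T : CN (N + 1) →L[ℝ] ℝ => T v) h0
    have h3 := h2 v
    have h4 := h2 (I • v)
    simp at h3 h4
    exact Complex.ext h4 h3
  · ext z
    refine ⟨fun hz => ⟨hz.2, fun _ => (hV z hz.2).1.1 hz.1⟩, fun hz => ⟨?_, hz.1⟩⟩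
    exact (hV z hz.1).1.2 (hz.2 i₀)

theorem mem_hypStar_of_im {N : ℕ} {X : Set (CN N)} {G : CN N → ℂ} {w : CN N}
    (hG : AnalyticAt ℂ G w) (hd : fderiv ℂ G w ≠ 0) (h0 : (G w).im = 0)
    (h : ∀ᶠ w' in 𝓝 w, w' ∈ X ↔ (G w').im = 0) : w ∈ hypStar N X :=
  ⟨h.self_of_nhds.2 h0, exists_isSubmanifold_of_im hG hd h⟩

theorem frequently_notMem_of_dimH {N : ℕ} (hN : 1 ≤ N) {H : Set (CN N)}
    (hH : dimH H = ((2 * N - 1 : ℕ) : ℝ≥0∞)) (w : CN N) : ∃ᶠ w' in 𝓝 w, w' ∉ H := by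
  intro h
  have h1 : H ∈ 𝓝 w := by
    filter_upwards [h] with w' hw'
    exact not_not.1 hw'
  have h2 := Real.dimH_of_mem_nhds h1
  rw [hH] at h2
  have h3 : Module.finrank ℝ (CN N) = 2 * N := by
    simp [Module.finrank_pi_fintype, mul_comm]
  rw [h3] at h2
  have h4 : 2 * N - 1 = 2 * N := by exact_mod_cast h2
  omega

theorem hypStar_subset {N : ℕ} {H : Set (CN N)} : hypStar N H ⊆ H := fun _ h => h.1

theorem IsRealSubvariety.closure_hypStar_subset {N : ℕ} {U H : Set (CN N)}
    (h : IsRealSubvariety N U H) : closure (hypStar N H) ∩ U ⊆ H := fun _ hz =>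
  h.2.1 ⟨closure_mono hypStar_subset hz.1, hz.2⟩

theorem exists_levi_step {N n : ℕ} {U H : Set (CN N)} (hH : IsLeviFlatHypervariety N U H)
    (hN : 1 ≤ N) {φ : (Fin n → ℂ) × ℂ → CN N} {R : ((Fin n → ℂ) × ℂ) × ((Fin n → ℂ) × ℂ) → ℂ}
    {Ω : Set ((Fin n → ℂ) × ℂ)} {Q : CN N → ℝ} {p : (Fin n → ℂ) × ℂ} (hΩo : IsOpen Ω)
    (hΩc : Convex ℝ Ω) (hΩs : ∀ z ∈ Ω, star z ∈ Ω)
    (hφ : ∀ z ∈ Ω, AnalyticAt ℂ φ z ∧ Function.Surjective (fderiv ℂ φ z))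
    (hφU : ∀ z ∈ Ω, φ z ∈ U)
    (hR : AnalyticOnNhd ℂ R (Ω ×ˢ Ω)) (hRre : ∀ z ∈ Ω, (R (z, star z)).im = 0)
    (hRH : ∀ z ∈ Ω, R (z, star z) = 0 ↔ φ z ∈ H)
    (hyp : ∀ z ∈ Ω, star z.1 = z.1 → φ z ∈ H → star z = z)
    (hQ : ∀ z ∈ Ω, AnalyticAt ℝ Q (φ z)) (hp : p ∈ Ω) (hps : star p = p)
    (hT : ∀ z ∈ Ω, star z = z → ∃ᶠ w in 𝓝 (φ z), w ∈ hypStar N H ∧ Q w ≠ 0) :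
    ∃ (x : Fin n → ℂ) (η : (Fin n → ℂ) → ℂ) (G : CN N → ℂ),
      AnalyticAt ℂ η x ∧ (x, η x) ∈ Ω ∧ star (x, η x) = (x, η x) ∧
      AnalyticAt ℂ G (φ (x, η x)) ∧ fderiv ℂ G (φ (x, η x)) ≠ 0 ∧
      (∀ᶠ w in 𝓝 (φ (x, η x)), (G w).im = 0 → w ∈ closure (hypStar N H) ∩ U) ∧
      (∀ᶠ z in 𝓝 (x, η x), G (φ (star z)) = star (G (φ z))) ∧
      (∀ᶠ x' in 𝓝 x, G (φ (x', η x')) = 0) ∧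
      (∀ᶠ x' in 𝓝 x, star x' = x' → star (η x') = η x') ∧
      ∃ᶠ x' in 𝓝 x, Q (φ (x', η x')) ≠ 0 := by
  have hmap : ∀ z ∈ Ω, map φ (𝓝 z) = 𝓝 (φ z) := fun z hz =>
    (hφ z hz).1.map_nhds_eq_of_surjective (hφ z hz).2
  obtain ⟨x, h, g, hh, hxΩ, hxs, hg, hg0, hgd, hgR, hgs, hgh, hhs, hQh, hcl⟩ :=
    exists_levi_function hΩo hΩc hΩs hR (Q := fun z => Q (φ z))
      (fun z hz => AnalyticAt.fun_comp (g := Q) (hQ z hz) ((hφ z hz).1.restrictScalars (𝕜 := ℝ)))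
      hRre (fun z hz h1 h2 => hyp z hz h1 ((hRH z hz).1 h2))
      (fun z hz => by
        have h1 := frequently_notMem_of_dimH hN hH.2.2.1 (φ z)
        rw [← hmap z hz, frequently_map] at h1
        refine (h1.and_eventually (hΩo.mem_nhds hz)).mono ?_
        rintro z' ⟨h2, h3⟩ h4
        exact h2 ((hRH z' h3).1 h4)) hp hps
      (fun z hz hzs => by
        have h1 := hT z hz hzs
        rw [← hmap z hz, frequently_map] at h1
        refine (h1.and_eventually (hΩo.mem_nhds hz)).mono ?_
        rintro q ⟨⟨h2, h3⟩, hq⟩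
        refine ⟨?_, h3⟩
        obtain ⟨V, f, hVo, hqV, hf, hfd, hHV⟩ := hH.2.2.2 _ h2
        have hfa : AnalyticAt ℂ f (φ q) := (hVo.analyticOn_iff_analyticOnNhd.1 hf) _ hqV
        refine ⟨fun z => f (φ z), AnalyticAt.fun_comp (g := f) hfa (hφ q hq).1, ?_, ?_, ?_⟩
        · intro h0
          refine hfd _ hqV (ContinuousLinearMap.ext fun w => ?_)
          obtain ⟨v, rfl⟩ := (hφ q hq).2 w
          have h5 : HasFDerivAt (fun z => f (φ z))
              ((fderiv ℂ f (φ q)).comp (fderiv ℂ φ q)) q :=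
            hfa.differentiableAt.hasFDerivAt.comp q (hφ q hq).1.differentiableAt.hasFDerivAt
          rw [h5.fderiv] at h0
          exact congrArg (fun T : (Fin n → ℂ) × ℂ →L[ℂ] ℂ => T v) h0
        · have : φ q ∈ H ∩ V := ⟨h2.1, hqV⟩
          rw [hHV] at this
          exact this.2
        · filter_upwards [hΩo.mem_nhds hq,
            (hφ q hq).1.continuousAt.eventually (hVo.mem_nhds hqV)] with z hz hzV h6
          have : φ z ∈ {z ∈ V | (f z).im = 0} := ⟨hzV, h6⟩
          rw [← hHV] at this
          exact (hRH z hz).2 this.1)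
  set q : (Fin n → ℂ) × ℂ := (x, h (x, 0)) with hq
  have hφq := (hφ q hxΩ).1
  obtain ⟨S, hS⟩ := ((fderiv ℂ φ q : (Fin n → ℂ) × ℂ →ₗ[ℂ] CN N)).exists_rightInverse_of_surjective
    (LinearMap.range_eq_top.2 (hφ q hxΩ).2)
  have hS' : ∀ w, fderiv ℂ φ q (S.toContinuousLinearMap w) = w :=
    fun w => congrArg (fun f => f w) hS
  have hY : ∀ᶠ z in 𝓝 q, (g z).im = 0 → φ z ∈ H := by
    filter_upwards [hgR, hΩo.mem_nhds hxΩ] with z h1 h2 h3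
    exact (hRH z h2).1 (h1 h3)
  have hdense : ∀ᶠ z in 𝓝 q, (g z).im = 0 →
      z ∈ closure {y | (g y).im = 0 ∧ ∀ᶠ z' in 𝓝 y, φ z' ∈ H → (g z').im = 0} := by
    filter_upwards [hcl, hΩo.mem_nhds hxΩ] with z h1 h2 h3
    rw [mem_closure_iff_frequently]
    refine ((mem_closure_iff_frequently.1 (h1 h3)).and_eventually (hΩo.mem_nhds h2)).mono ?_
    rintro y ⟨⟨h4, h5⟩, h6⟩
    refine ⟨h4, ?_⟩
    filter_upwards [h5, hΩo.mem_nhds h6] with z' h7 h8 h9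
    exact h7 ((hRH z' h8).2 h9)
  obtain ⟨G, hG, hGg⟩ := hφq.exists_factor hS' hg hgd (by rw [hg0]; rfl) hY hdense
  have hGd : fderiv ℂ G (φ q) ≠ 0 := by
    intro h0
    have h1 : HasFDerivAt (fun z => G (φ z)) ((fderiv ℂ G (φ q)).comp (fderiv ℂ φ q)) q :=
      hG.differentiableAt.hasFDerivAt.comp q hφq.differentiableAt.hasFDerivAt
    rw [h0, ContinuousLinearMap.zero_comp] at h1
    exact hgd ((h1.congr_of_eventuallyEq (hGg.mono fun z h => h.symm)).fderiv)
  have hηa : AnalyticAt ℂ (fun x' => h (x', 0)) x :=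
    AnalyticAt.fun_comp (g := h) hh (analyticAt_id.prod analyticAt_const)
  have hηc : Tendsto (fun x' => (x', h (x', (0 : ℂ)))) (𝓝 x) (𝓝 q) :=
    (analyticAt_id.prod hηa).continuousAt.tendsto
  refine ⟨x, fun x' => h (x', 0), G, hηa, hxΩ, hxs, hG, hGd, ?_, ?_, ?_, hhs, hQh⟩
  · filter_upwards [hφq.eventually_mem_closure_of_factor hS' hGg hY hdense,
      hG.eventually_analyticAt.eventually_nhds, (hG.eventually_fderiv_ne_zero hGd).eventually_nhds,
      hH.1.mem_nhds (hφU q hxΩ)] with w h1 h2 h3 h4 h5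
    refine ⟨?_, h4⟩
    rw [mem_closure_iff_frequently]
    refine ((mem_closure_iff_frequently.1 (h1 h5)).and_eventually (h2.and h3)).mono ?_
    rintro w' ⟨⟨h6, h7⟩, h8, h9⟩
    exact mem_hypStar_of_im h8 h9 h6 h7
  · have hst : Tendsto (star : (Fin n → ℂ) × ℂ → _) (𝓝 q) (𝓝 q) := by
      have := (continuous_star (R := (Fin n → ℂ) × ℂ)).tendsto q
      rwa [hxs] at this
    filter_upwards [hgs, hGg, hst.eventually hGg] with z h1 h2 h3
    rw [h3, h1, h2]
  · filter_upwards [hgh, hηc.eventually hGg] with x' h1 h2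
    rw [h2, h1]

theorem star_mem_ball_of_star_eq {E : Type*} [NormedAddCommGroup E] [StarAddMonoid E]
    [NormedStarGroup E] {p z : E} (hp : star p = p) {ε : ℝ} (hz : z ∈ Metric.ball p ε) :
    star z ∈ Metric.ball p ε := by
  rw [Metric.mem_ball, dist_eq_norm] at hz ⊢
  rwa [← hp, ← star_sub, norm_star]

def realSlice (n : ℕ) : ((Fin n → ℝ) × ℝ) × ℝ →L[ℝ] (Fin n → ℂ) × ℂ :=
  ContinuousLinearMap.prod
    (ContinuousLinearMap.pi fun i => Complex.ofRealCLM.comp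
      ((ContinuousLinearMap.proj i).comp ((ContinuousLinearMap.fst ℝ _ _).comp
        (ContinuousLinearMap.fst ℝ _ _))))
    (Complex.ofRealCLM.comp ((ContinuousLinearMap.snd ℝ _ _).comp (ContinuousLinearMap.fst ℝ _ _))
      + I • Complex.ofRealCLM.comp (ContinuousLinearMap.snd ℝ _ _))

theorem realSlice_apply {n : ℕ} (q : ((Fin n → ℝ) × ℝ) × ℝ) :
    realSlice n q = (fun i => (q.1.1 i : ℂ), (q.1.2 : ℂ) + I * q.2) := rfl

theorem exists_normal_hyperplane {m : ℕ} {u : (Fin m → ℂ) → ℝ} {δ : ℝ} (hδ0 : 0 < δ)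
    (hu : AnalyticOnNhd ℝ u (Metric.ball 0 δ))
    (h0 : ∀ x ∈ Metric.ball (0 : Fin m → ℂ) δ, star x = x → u x = 0)
    (hne : ∃ q ∈ Metric.ball (0 : Fin m → ℂ) δ, u q ≠ 0) :
    ∃ (n : ℕ) (A : ((Fin n → ℂ) × ℂ) ≃L[ℂ] (Fin m → ℂ)) (p : (Fin n → ℂ) × ℂ),
      (∀ z, A (star z) = star (A z)) ∧ star p = p ∧ A p ∈ Metric.ball 0 δ ∧
      ∀ᶠ z in 𝓝 p, star z.1 = z.1 → u (A z) = 0 → star z = z := by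
  obtain ⟨q, hq, hqu⟩ := hne
  set v : Fin m → ℂ := fun i => ((q i).im : ℂ) with hv
  have hvs : star v = v := funext fun i => Complex.conj_ofReal _
  have hv0 : v ≠ 0 := by
    intro h1
    refine hqu (h0 q hq (funext fun i => ?_))
    exact Complex.conj_eq_iff_im.2 (by simpa [hv] using congrFun h1 i)
  obtain ⟨n, A, hAs, hAv⟩ := exists_equiv_prod_of_star_eq hvs hv0
  set κ : (Fin n → ℂ) × ℂ → ((Fin n → ℝ) × ℝ) × ℝ :=
    fun z => ((fun i => (z.1 i).re, z.2.re), z.2.im) with hκ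
  have hκc : Continuous κ := by fun_prop
  have hjκ : ∀ z, star z.1 = z.1 → realSlice n (κ z) = z := by
    intro z hz
    rw [realSlice_apply]
    refine Prod.ext (funext fun i => Complex.conj_eq_iff_re.1 (congrFun hz i)) ?_
    simp [hκ, mul_comm I, Complex.re_add_im]
  have hκj : ∀ q, κ (realSlice n q) = q := by
    intro q
    rw [realSlice_apply]
    simp [hκ]
  set Ω₀ : Set ((Fin n → ℂ) × ℂ) := A ⁻¹' Metric.ball 0 δ with hΩ₀
  have hΩ₀o : IsOpen Ω₀ := Metric.isOpen_ball.preimage A.continuous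
  have hΩ₀c : Convex ℝ Ω₀ :=
    (convex_ball (0 : Fin m → ℂ) δ).linear_preimage (A.toLinearMap.restrictScalars ℝ)
  have hjΩ : ∃ q ∈ realSlice n ⁻¹' Ω₀, u (A (realSlice n q)) ≠ 0 := by
    refine ⟨κ (A.symm (fun i => ((q i).re : ℂ)) + I • (0, 1)), ?_⟩
    have h1 : star (A.symm (fun i => ((q i).re : ℂ))) = A.symm (fun i => ((q i).re : ℂ)) := by
      apply A.injective
      rw [hAs, A.apply_symm_apply]
      exact funext fun i => Complex.conj_ofReal _
    have h2 : A (realSlice n (κ (A.symm (fun i => ((q i).re : ℂ)) + I • (0, 1)))) = q := by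
      rw [hjκ _ (by
        have := congrArg Prod.fst h1
        simpa using this), map_add, map_smul, hAv, A.apply_symm_apply]
      ext i
      simp [hv, mul_comm I, Complex.re_add_im]
    rw [Set.mem_preimage, hΩ₀, Set.mem_preimage, h2]
    exact ⟨hq, hqu⟩
  have hja : AnalyticOnNhd ℝ (fun q => u (A (realSlice n q))) (realSlice n ⁻¹' Ω₀) := by
    intro q hq
    have h2 : AnalyticAt ℝ (fun q => A (realSlice n q)) q :=
      ((A : (Fin n → ℂ) × ℂ →L[ℂ] (Fin m → ℂ)).restrictScalars ℝ).comp (realSlice n) |>.analyticAt q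
    exact AnalyticAt.fun_comp (g := u) (hu _ hq) h2
  have hmem : ((0 : (Fin n → ℝ) × ℝ), (0 : ℝ)) ∈ realSlice n ⁻¹' Ω₀ := by
    have h1 : realSlice n ((0 : (Fin n → ℝ) × ℝ), (0 : ℝ)) = 0 := map_zero (realSlice n)
    have h2 : A 0 ∈ Metric.ball (0 : Fin m → ℂ) δ := by
      rw [map_zero]
      exact Metric.mem_ball_self hδ0
    rw [Set.mem_preimage, h1]
    exact h2
  have hpre : IsPreconnected (realSlice n ⁻¹' Ω₀) :=
    (hΩ₀c.linear_preimage (realSlice n).toLinearMap).isPreconnected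
  obtain ⟨y, hy, hyz⟩ := exists_zero_subset_hyperplane (hΩ₀o.preimage (realSlice n).continuous)
    hpre hja hmem hjΩ
  set p : (Fin n → ℂ) × ℂ := realSlice n (y, 0) with hp
  have hps : star p = p := by
    rw [hp, realSlice_apply]
    exact Prod.ext (funext fun i => Complex.conj_ofReal _) (by simp)
  have hp2 : Tendsto κ (𝓝 p) (𝓝 (y, 0)) := hκc.tendsto' _ _ (hκj _)
  refine ⟨n, A, p, hAs, hps, hy, ?_⟩
  filter_upwards [hp2.eventually hyz] with z hz hs hzu
  simp only [hjκ z hs, hzu, true_implies] at hz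
  exact Prod.ext hs (Complex.conj_eq_iff_im.2 hz)

theorem exists_levi_chart {N m : ℕ} {U H : Set (CN N)} (hH : IsLeviFlatHypervariety N U H)
    (hN : 1 ≤ N) {φ : (Fin m → ℂ) → CN N} (hφ : AnalyticAt ℂ φ 0) {S : CN N →L[ℂ] (Fin m → ℂ)}
    (hS : ∀ w, fderiv ℂ φ 0 (S w) = w) (h0U : φ 0 ∈ U)
    (hreal : ∀ᶠ x in 𝓝 0, star x = x → φ x ∈ H) {W : Set (Fin m → ℂ)} (hW : W ∈ 𝓝 0) :
    ∃ (n : ℕ) (A : ((Fin n → ℂ) × ℂ) ≃L[ℂ] (Fin m → ℂ)) (Ω : Set ((Fin n → ℂ) × ℂ))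
      (R : ((Fin n → ℂ) × ℂ) × ((Fin n → ℂ) × ℂ) → ℂ) (p : (Fin n → ℂ) × ℂ),
      (∀ z, A (star z) = star (A z)) ∧ IsOpen Ω ∧ Convex ℝ Ω ∧ (∀ z ∈ Ω, star z ∈ Ω) ∧
      (∀ z ∈ Ω, A z ∈ W) ∧
      (∀ z ∈ Ω, AnalyticAt ℂ (fun z => φ (A z)) z ∧
        Function.Surjective (fderiv ℂ (fun z => φ (A z)) z)) ∧
      (∀ z ∈ Ω, φ (A z) ∈ U) ∧ AnalyticOnNhd ℂ R (Ω ×ˢ Ω) ∧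
      (∀ z ∈ Ω, (R (z, star z)).im = 0) ∧ (∀ z ∈ Ω, R (z, star z) = 0 ↔ φ (A z) ∈ H) ∧
      (∀ z ∈ Ω, star z.1 = z.1 → φ (A z) ∈ H → star z = z) ∧ p ∈ Ω ∧ star p = p := by
  obtain ⟨V, hVo, h0V, hVU, k, f, hf, hHV⟩ := hH.2.1.2.2 _ h0U
  have hfa : ∀ i, AnalyticOnNhd ℝ (f i) V := fun i => hVo.analyticOn_iff_analyticOnNhd.1 (hf i)
  set ρ : CN N → ℝ := fun w => ∑ i, f i w ^ 2 with hρ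
  have hρa : AnalyticOnNhd ℝ ρ V := fun w hw =>
    Finset.analyticAt_fun_sum _ fun i _ => (hfa i w hw).fun_pow 2
  have hρH : ∀ w ∈ V, ρ w = 0 ↔ w ∈ H := by
    intro w hw
    have h1 : w ∈ H ↔ w ∈ H ∩ V := ⟨fun h => ⟨h, hw⟩, fun h => h.1⟩
    rw [h1, hHV, hρ]
    simp only [Finset.sum_eq_zero_iff_of_nonneg fun i _ => sq_nonneg (f i w), Finset.mem_univ,
      true_implies, sq_eq_zero_iff, Set.mem_ofPred_eq, hw, true_and]
  have hρφ : AnalyticAt ℝ (fun z => ρ (φ z)) 0 :=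
    AnalyticAt.fun_comp (g := ρ) (hρa _ h0V) (hφ.restrictScalars (𝕜 := ℝ))
  obtain ⟨R, hR, hRρ⟩ := AnalyticAt.exists_polarization (f := fun z => (ρ (φ z) : ℂ))
    ((Complex.ofRealCLM.analyticAt _).comp hρφ)
  obtain ⟨ε, hε, hball⟩ := Metric.eventually_nhds_iff_ball.1
    (Filter.Eventually.and (hφ.continuousAt.eventually (hVo.mem_nhds h0V))
      (hφ.eventually_analyticAt.and ((hφ.eventually_surjective_fderiv hS).and
        (hreal.and (hRρ.and (Filter.eventually_of_mem hW fun x hx => hx))))))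
  obtain ⟨ε', hε', hball'⟩ := Metric.eventually_nhds_iff_ball.1 hR.eventually_analyticAt
  set δ := min ε ε' with hδ
  have hδ0 : 0 < δ := lt_min hε hε'
  have hB : ∀ z ∈ Metric.ball (0 : Fin m → ℂ) δ, z ∈ Metric.ball (0 : Fin m → ℂ) ε := fun z hz =>
    Metric.ball_subset_ball (min_le_left _ _) hz
  have hB' : ∀ z ∈ Metric.ball (0 : Fin m → ℂ) δ, ∀ w ∈ Metric.ball (0 : Fin m → ℂ) δ,
      AnalyticAt ℂ R (z, w) := by
    intro z hz w hw
    refine hball' _ ?_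
    rw [← ball_prod_same]
    exact ⟨Metric.ball_subset_ball (min_le_right _ _) hz,
      Metric.ball_subset_ball (min_le_right _ _) hw⟩
  obtain ⟨q, hqH, hq⟩ : ∃ q, φ q ∉ H ∧ q ∈ Metric.ball (0 : Fin m → ℂ) δ := by
    have h1 := frequently_notMem_of_dimH hN hH.2.2.1 (φ 0)
    rw [← hφ.map_nhds_eq_of_surjective fun w => ⟨S w, hS w⟩, frequently_map] at h1
    exact (h1.and_eventually (Metric.ball_mem_nhds 0 hδ0)).exists
  obtain ⟨n, A, p, hAs, hps, hy, hyz⟩ := exists_normal_hyperplane (u := fun z => ρ (φ z)) hδ0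
    (fun z hz => AnalyticAt.fun_comp (g := ρ) (hρa _ (hball z (hB z hz)).1)
      ((hball z (hB z hz)).2.1.restrictScalars (𝕜 := ℝ)))
    (fun z hz hs => (hρH _ (hball z (hB z hz)).1).2 ((hball z (hB z hz)).2.2.2.1 hs))
    ⟨q, hq, fun h => hqH ((hρH _ (hball q (hB q hq)).1).1 h)⟩
  set Ω₀ : Set ((Fin n → ℂ) × ℂ) := A ⁻¹' Metric.ball 0 δ with hΩ₀
  have hΩ₀o : IsOpen Ω₀ := Metric.isOpen_ball.preimage A.continuous
  have hΩ₀c : Convex ℝ Ω₀ :=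
    (convex_ball (0 : Fin m → ℂ) δ).linear_preimage (A.toLinearMap.restrictScalars ℝ)
  obtain ⟨τ, hτ, hτb⟩ := Metric.eventually_nhds_iff_ball.1 (hyz)
  have hAA : AnalyticOnNhd ℂ (A : (Fin n → ℂ) × ℂ → Fin m → ℂ) univ := fun z _ =>
    (A : (Fin n → ℂ) × ℂ →L[ℂ] (Fin m → ℂ)).analyticAt z
  have hRΩ : ∀ z ∈ Ω₀, R (A z, A (star z)) = ρ (φ (A z)) := fun z hz => by
    rw [hAs]
    exact (hball _ (hB _ hz)).2.2.2.2.1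
  refine ⟨n, A, Ω₀ ∩ Metric.ball p τ, fun q => R (A q.1, A q.2), p, hAs,
    hΩ₀o.inter Metric.isOpen_ball, hΩ₀c.inter (convex_ball _ _), ?_,
    fun z hz => (hball _ (hB _ hz.1)).2.2.2.2.2, ?_,
    fun z hz => hVU (hball _ (hB _ hz.1)).1, ?_, ?_, ?_, ?_, ⟨hy, Metric.mem_ball_self hτ⟩, hps⟩
  · rintro z ⟨hz1, hz2⟩
    refine ⟨?_, star_mem_ball_of_star_eq hps hz2⟩
    rw [hΩ₀, Set.mem_preimage, hAs]
    exact star_mem_ball_of_star_eq (star_zero _) hz1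
  · rintro z ⟨hz1, -⟩
    have h1 := hball _ (hB _ hz1)
    refine ⟨AnalyticAt.fun_comp (g := φ) h1.2.1 (hAA z trivial), ?_⟩
    have h2 : HasFDerivAt (fun z => φ (A z))
        ((fderiv ℂ φ (A z)).comp (A : (Fin n → ℂ) × ℂ →L[ℂ] (Fin m → ℂ))) z :=
      h1.2.1.differentiableAt.hasFDerivAt.comp z A.hasFDerivAt
    rw [h2.fderiv]
    exact h1.2.2.1.comp A.surjective
  · rintro q ⟨⟨h1, -⟩, ⟨h2, -⟩⟩
    exact AnalyticAt.fun_comp (g := R) (hB' _ h1 _ h2)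
      ((AnalyticAt.fun_comp (g := A) (hAA _ trivial) analyticAt_fst).prod
        (AnalyticAt.fun_comp (g := A) (hAA _ trivial) analyticAt_snd))
  · rintro z ⟨hz, -⟩
    simp only [hRΩ z hz, Complex.ofReal_im]
  · rintro z ⟨hz, -⟩
    simp only [hRΩ z hz, Complex.ofReal_eq_zero]
    exact hρH _ (hball _ (hB _ hz)).1
  · rintro z ⟨hz, hzτ⟩ hs hzH
    exact hτb z hzτ hs ((hρH _ (hball _ (hB _ hz)).1).2 hzH)

theorem fderiv_eq_zero_of_im_eq_zero {N : ℕ} {G : CN N → ℂ} {f : CN N → ℝ} {a : CN N}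
    (hG : AnalyticAt ℂ G a) (hd : fderiv ℂ G a ≠ 0) (h0 : (G a).im = 0)
    (hf : DifferentiableAt ℝ f a) (h : ∀ᶠ w in 𝓝 a, (G w).im = 0 → f w = 0) {v : CN N}
    (hv : (fderiv ℂ G a v).im = 0) : fderiv ℝ f a v = 0 := by
  obtain ⟨Ψ, hΨ, hΨ0, hΨd, hGΨ, -⟩ := hG.exists_straightening hd
  have hc : Tendsto (fun t : ℝ => a + t • v) (𝓝 0) (𝓝 a) :=
    (by fun_prop : Continuous fun t : ℝ => a + t • v).tendsto' _ _ (by simp)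
  have hγ : HasDerivAt (fun t : ℝ => a + t • v) v 0 := by
    simpa using ((hasDerivAt_id (0 : ℝ)).smul_const v).const_add a
  have h1 : HasDerivAt (fun t : ℝ => Ψ (a + t • v)) v 0 := by
    have h2 : HasFDerivAt Ψ ((ContinuousLinearMap.id ℂ (CN N)).restrictScalars ℝ)
        (a + (0 : ℝ) • v) := by
      rw [zero_smul, add_zero]; exact hΨd.restrictScalars ℝ
    exact HasFDerivAt.comp_hasDerivAt (l := Ψ) (f := fun t : ℝ => a + t • v) 0 h2 hγ
  have h3 : HasDerivAt (fun t : ℝ => f (Ψ (a + t • v))) (fderiv ℝ f a v) 0 := by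
    have h2 : HasFDerivAt f (fderiv ℝ f a) (Ψ (a + (0 : ℝ) • v)) := by
      rw [zero_smul, add_zero, hΨ0]; exact hf.hasFDerivAt
    exact HasFDerivAt.comp_hasDerivAt (l := f) (f := fun t : ℝ => Ψ (a + t • v)) 0 h2 h1
  have hΨt : Tendsto Ψ (𝓝 a) (𝓝 a) := by
    have := hΨ.continuousAt.tendsto; rwa [hΨ0] at this
  refine h3.unique ((hasDerivAt_const (0 : ℝ) (0 : ℝ)).congr_of_eventuallyEq ?_)
  filter_upwards [hc.eventually hGΨ, (hΨt.comp hc).eventually h] with t h4 h5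
  refine h5 ?_
  simp only [Function.comp_apply]
  rw [h4, add_sub_cancel_left]
  have h6 : fderiv ℂ G a (t • v) = t • fderiv ℂ G a v :=
    ((fderiv ℂ G a).restrictScalars ℝ).map_smul t v
  rw [h6]
  simp [h0, hv]

theorem exists_rightInverse_prod {N : ℕ} {l₁ l₂ : CN N →L[ℂ] ℂ}
    (h : ∀ a b : ℂ, a • l₁ + b • l₂ = 0 → a = 0 ∧ b = 0) :
    ∃ S : ℂ × ℂ →L[ℂ] CN N, ∀ w, l₁.prod l₂ (S w) = w := by
  have hs : Function.Surjective (l₁.prod l₂) := by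
    by_contra hs
    obtain ⟨l, hl0, hl⟩ := Submodule.exists_le_ker_of_lt_top
      (LinearMap.range (l₁.prod l₂ : CN N →ₗ[ℂ] ℂ × ℂ))
      (lt_top_iff_ne_top.2 fun h => hs (LinearMap.range_eq_top.1 h))
    have h1 : ∀ x : ℂ × ℂ, l x = l (1, 0) * x.1 + l (0, 1) * x.2 := by
      intro x
      have h2 : x = x.1 • ((1, 0) : ℂ × ℂ) + x.2 • ((0, 1) : ℂ × ℂ) := by
        ext <;> simp
      conv_lhs => rw [h2]
      rw [map_add, map_smul, map_smul, smul_eq_mul, smul_eq_mul, mul_comm, mul_comm x.2]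
    obtain ⟨ha, hb⟩ := h (l (1, 0)) (l (0, 1)) (ContinuousLinearMap.ext fun v => by
      have h2 : l (l₁ v, l₂ v) = 0 := hl ⟨v, rfl⟩
      rw [h1] at h2
      simpa using h2)
    refine hl0 (LinearMap.ext fun x => ?_)
    rw [h1, ha, hb]
    simp
  obtain ⟨S, hS⟩ := (l₁.prod l₂ : CN N →ₗ[ℂ] ℂ × ℂ).exists_rightInverse_of_surjective
    (LinearMap.range_eq_top.2 hs)
  exact ⟨S.toContinuousLinearMap, fun w => congrArg (fun f => f w) hS⟩

theorem frequently_hypStar_im_ne_zero {N : ℕ} {U H : Set (CN N)} {G : CN N → ℂ} {e : CN N}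
    (he : e ∈ singSet N (closure (hypStar N H) ∩ U)) (hG : AnalyticAt ℂ G e)
    (hd : fderiv ℂ G e ≠ 0)
    (hX : ∀ᶠ w in 𝓝 e, (G w).im = 0 → w ∈ closure (hypStar N H) ∩ U) :
    ∃ᶠ w in 𝓝 e, w ∈ hypStar N H ∧ (G w).im ≠ 0 := by
  intro h
  refine he.2 ⟨he.1, _, exists_isSubmanifold_of_im hG hd ?_⟩
  filter_upwards [hX, h.eventually_nhds, hG.eventually_analyticAt] with w h1 h2 h3
  refine ⟨fun hw => ?_, h1⟩
  have h4 : ∃ᶠ w' in 𝓝 w, (G w').im ∈ ({0} : Set ℝ) := by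
    refine ((mem_closure_iff_frequently.1 hw.1).and_eventually h2).mono ?_
    rintro w' ⟨h5, h6⟩
    exact not_not.1 fun h7 => h6 ⟨h5, h7⟩
  exact isClosed_singleton.mem_of_frequently_of_tendsto h4
    (Complex.continuous_im.continuousAt.comp h3.continuousAt).tendsto

theorem mem_singSet_of_im_eq_zero {N : ℕ} {U H : Set (CN N)}
    (hH : IsLeviFlatHypervariety N U H) (hN : 1 ≤ N) {Γ : CN N → ℂ × ℂ} {a : CN N}
    (hΓ : AnalyticAt ℂ Γ a) (hs : Function.Surjective (fderiv ℂ Γ a))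
    (h1 : (Γ a).1.im = 0) (h2 : (Γ a).2.im = 0)
    (hX1 : ∀ᶠ w in 𝓝 a, (Γ w).1.im = 0 → w ∈ closure (hypStar N H) ∩ U)
    (hX2 : ∀ᶠ w in 𝓝 a, (Γ w).2.im = 0 → w ∈ closure (hypStar N H) ∩ U) :
    a ∈ singSet N (closure (hypStar N H) ∩ U) := by
  refine ⟨hX1.self_of_nhds h1, ?_⟩
  rintro ⟨-, d, V, f, hVo, haV, hf, hlin, hXV⟩
  have hfa : ∀ i, DifferentiableAt ℝ (f i) a := fun i =>
    ((hVo.analyticOn_iff_analyticOnNhd.1 (hf i)) a haV).differentiableAt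
  have hd1 : HasFDerivAt (fun w => (Γ w).1) ((ContinuousLinearMap.fst ℂ ℂ ℂ).comp (fderiv ℂ Γ a)) a :=
    (ContinuousLinearMap.fst ℂ ℂ ℂ).hasFDerivAt.comp a hΓ.differentiableAt.hasFDerivAt
  have hd2 : HasFDerivAt (fun w => (Γ w).2) ((ContinuousLinearMap.snd ℂ ℂ ℂ).comp (fderiv ℂ Γ a)) a :=
    (ContinuousLinearMap.snd ℂ ℂ ℂ).hasFDerivAt.comp a hΓ.differentiableAt.hasFDerivAt
  have hf0 : ∀ i, fderiv ℝ (f i) a = 0 := by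
    intro i
    have hXf : ∀ᶠ w in 𝓝 a, w ∈ closure (hypStar N H) ∩ U → f i w = 0 := by
      filter_upwards [hVo.mem_nhds haV] with w hw hwX
      have : w ∈ closure (hypStar N H) ∩ U ∩ V := ⟨hwX, hw⟩
      rw [hXV] at this
      exact this.2 i
    refine ContinuousLinearMap.ext fun v => ?_
    obtain ⟨u, hu⟩ := hs (0, (fderiv ℂ Γ a v).2)
    have h3 : fderiv ℝ (f i) a u = 0 := by
      refine fderiv_eq_zero_of_im_eq_zero (G := fun w => (Γ w).1)
        (analyticAt_fst.comp hΓ) ?_ h1 (hfa i) ?_ ?_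
      · rw [hd1.fderiv]
        intro h0
        obtain ⟨u', hu'⟩ := hs (1, 0)
        have := congrArg (fun T : CN N →L[ℂ] ℂ => T u') h0
        simp [hu'] at this
      · filter_upwards [hX1, hXf] with w h3 h4 h5
        exact h4 (h3 h5)
      · rw [hd1.fderiv]
        simp [hu]
    have h4 : fderiv ℝ (f i) a (v - u) = 0 := by
      refine fderiv_eq_zero_of_im_eq_zero (G := fun w => (Γ w).2)
        (analyticAt_snd.comp hΓ) ?_ h2 (hfa i) ?_ ?_
      · rw [hd2.fderiv]
        intro h0
        obtain ⟨u', hu'⟩ := hs (0, 1)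
        have := congrArg (fun T : CN N →L[ℂ] ℂ => T u') h0
        simp [hu'] at this
      · filter_upwards [hX2, hXf] with w h3 h4 h5
        exact h4 (h3 h5)
      · rw [hd2.fderiv]
        simp [hu]
    rw [map_sub, h3, sub_zero] at h4
    simpa using h4
  by_cases hι : Nonempty (Fin (2 * N - d))
  · exact (hlin a haV).ne_zero hι.some (hf0 _)
  · refine frequently_notMem_of_dimH hN hH.2.2.1 a ?_
    filter_upwards [hVo.mem_nhds haV] with w hw
    have h3 : w ∈ {z ∈ V | ∀ i, f i z = 0} := ⟨hw, fun i => (hι ⟨i⟩).elim⟩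
    rw [← hXV] at h3
    exact not_not.2 (hH.2.1.closure_hypStar_subset h3.1)

theorem exists_fderiv_ne_zero_of_frequently_im_ne_zero {n : ℕ} {g : (Fin n → ℂ) → ℂ}
    {x : Fin n → ℂ} (hg : AnalyticAt ℂ g x) (hx : star x = x) (hgx : (g x).im = 0)
    (h : ∃ᶠ x' in 𝓝 x, (g x').im ≠ 0) : ∃ᶠ x' in 𝓝 x, star x' = x' ∧ fderiv ℂ g x' ≠ 0 := by
  intro h0
  obtain ⟨ε, hε, hb⟩ := Metric.eventually_nhds_iff_ball.1 (h0.and hg.eventually_analyticAt)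
  have h1 : EqOn (fderiv ℂ g) 0 (Metric.ball x ε) := by
    refine DifferentiableOn.eqOn_zero_of_real (convex_ball x ε) Metric.isOpen_ball
      (fun z hz => star_mem_ball_of_star_eq hx hz)
      (fun z hz => (hb z hz).2.fderiv.differentiableAt.differentiableWithinAt) ?_
    intro z hz hzs
    exact not_not.1 fun h2 => (hb z hz).1 ⟨hzs, h2⟩
  have h2 : ∀ z ∈ Metric.ball x ε, g z = g x := fun z hz =>
    Metric.isOpen_ball.is_const_of_fderiv_eq_zero (𝕜 := ℂ) (convex_ball x ε).isPreconnected
      (fun z hz => (hb z hz).2.differentiableAt.differentiableWithinAt) h1 hz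
      (Metric.mem_ball_self hε)
  refine h ?_
  filter_upwards [Metric.ball_mem_nhds x hε] with z hz
  rw [h2 z hz, hgx]
  simp

theorem eventually_mem_singSet_iff {N m : ℕ} {U H : Set (CN N)}
    (hH : IsLeviFlatHypervariety N U H) (hN : 1 ≤ N) {φ : (Fin m → ℂ) → CN N}
    {T : CN N →L[ℝ] (Fin m → ℂ)} (hTs : ∀ v, star (T v) = T v) {p : CN N} {x : Fin m → ℂ}
    (hTx : T (φ x - p) = x)
    (hET : ∀ᶠ w in 𝓝 (φ x), w ∈ singSet N (closure (hypStar N H) ∩ U) → φ (T (w - p)) = w)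
    {G₁ G₂ : CN N → ℂ} (h₁ : AnalyticAt ℂ G₁ (φ x)) (h₂ : AnalyticAt ℂ G₂ (φ x))
    {S : ℂ × ℂ →L[ℂ] CN N}
    (hS : ∀ w, fderiv ℂ (fun w => (G₁ w, G₂ w)) (φ x) (S w) = w)
    (hX₁ : ∀ᶠ w in 𝓝 (φ x), (G₁ w).im = 0 → w ∈ closure (hypStar N H) ∩ U)
    (hX₂ : ∀ᶠ w in 𝓝 (φ x), (G₂ w).im = 0 → w ∈ closure (hypStar N H) ∩ U)
    (hs₁ : ∀ᶠ z in 𝓝 x, G₁ (φ (star z)) = star (G₁ (φ z)))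
    (hs₂ : ∀ᶠ z in 𝓝 x, G₂ (φ (star z)) = star (G₂ (φ z))) :
    ∀ᶠ w in 𝓝 (φ x), w ∈ singSet N (closure (hypStar N H) ∩ U) ↔
      (G₁ w).im = 0 ∧ (G₂ w).im = 0 := by
  have hΓ : AnalyticAt ℂ (fun w => (G₁ w, G₂ w)) (φ x) := h₁.prod h₂
  have hT : Tendsto (fun w => T (w - p)) (𝓝 (φ x)) (𝓝 x) :=
    (by fun_prop : Continuous fun w => T (w - p)).tendsto' _ _ hTx
  filter_upwards [hET, hT.eventually hs₁, hT.eventually hs₂, hX₁.eventually_nhds,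
    hX₂.eventually_nhds, hΓ.eventually_analyticAt, hΓ.eventually_surjective_fderiv hS]
    with w h3 h4 h5 h6 h7 h8 h9
  constructor
  · intro hw
    rw [hTs, h3 hw] at h4 h5
    exact ⟨Complex.conj_eq_iff_im.1 h4.symm, Complex.conj_eq_iff_im.1 h5.symm⟩
  · rintro ⟨h10, h11⟩
    exact mem_singSet_of_im_eq_zero hH hN h8 h9 h10 h11 h6 h7

theorem exists_levi_pair {N m : ℕ} {U H : Set (CN N)} (hH : IsLeviFlatHypervariety N U H)
    (hN : 1 ≤ N) {φ : (Fin m → ℂ) → CN N} (hφ : AnalyticAt ℂ φ 0) {S : CN N →L[ℂ] (Fin m → ℂ)}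
    (hS : ∀ w, fderiv ℂ φ 0 (S w) = w) {T : CN N →L[ℝ] (Fin m → ℂ)}
    (hTs : ∀ v, star (T v) = T v) {p : CN N} (hp : φ 0 = p)
    (hpE : p ∈ singSet N (closure (hypStar N H) ∩ U))
    (hET : ∀ᶠ w in 𝓝 p, w ∈ singSet N (closure (hypStar N H) ∩ U) → φ (T (w - p)) = w)
    (hφE : ∀ᶠ x in 𝓝 0, star x = x →
      φ x ∈ singSet N (closure (hypStar N H) ∩ U) ∧ T (φ x - p) = x)
    {W : Set (Fin m → ℂ)} (hW : W ∈ 𝓝 0) :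
    ∃ x ∈ W, star x = x ∧ ∃ G₁ G₂ : CN N → ℂ, AnalyticAt ℂ G₁ (φ x) ∧ AnalyticAt ℂ G₂ (φ x) ∧
      (∃ S : ℂ × ℂ →L[ℂ] CN N,
        ∀ w, (fderiv ℂ G₁ (φ x)).prod (fderiv ℂ G₂ (φ x)) (S w) = w) ∧
      (∀ᶠ w in 𝓝 (φ x), w ∈ singSet N (closure (hypStar N H) ∩ U) ↔
        (G₁ w).im = 0 ∧ (G₂ w).im = 0) ∧
      (∀ᶠ z in 𝓝 x, G₁ (φ (star z)) = star (G₁ (φ z))) ∧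
      ∀ᶠ z in 𝓝 x, G₂ (φ (star z)) = star (G₂ (φ z)) := by
  have hET' : ∀ᶠ x in 𝓝 (0 : Fin m → ℂ), ∀ᶠ w in 𝓝 (φ x),
      w ∈ singSet N (closure (hypStar N H) ∩ U) → φ (T (w - p)) = w := by
    have h1 : Tendsto φ (𝓝 0) (𝓝 p) := hp ▸ hφ.continuousAt.tendsto
    exact h1.eventually hET.eventually_nhds
  obtain ⟨n, A, Ω, R, b, hAs, hΩo, hΩc, hΩs, hΩW, hφΩ, hφU, hR, hRre, hRH, hyp, hb, hbs⟩ :=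
    exists_levi_chart hH hN hφ hS (by rw [hp]; exact hpE.1.2)
      (hφE.mono fun x hx hxs => hH.2.1.closure_hypStar_subset (hx hxs).1.1)
      (Filter.inter_mem hW (Filter.Eventually.and hφE hET'))
  have hΩE : ∀ z ∈ Ω, star z = z → φ (A z) ∈ singSet N (closure (hypStar N H) ∩ U) ∧
      T (φ (A z) - p) = A z := fun z hz hzs =>
    (hΩW z hz).2.1 (by rw [← hAs, hzs])
  obtain ⟨x₁, η₁, G₁, -, hz₁, hzs₁, hG₁, hGd₁, hGX₁, hGs₁, -, -, -⟩ :=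
    exists_levi_step hH hN (Q := fun _ => 1) hΩo hΩc hΩs hφΩ hφU hR hRre hRH hyp
      (fun _ _ => analyticAt_const) hb hbs (fun z hz hzs => by
        refine (mem_closure_iff_frequently.1 (hΩE z hz hzs).1.1.1).mono fun w hw => ?_
        exact ⟨hw, one_ne_zero⟩)
  have hc₁ : ContinuousAt (fun z => φ (A z)) (x₁, η₁ x₁) := (hφΩ _ hz₁).1.continuousAt
  have hGd₁' : ∀ᶠ w in 𝓝 (φ (A (x₁, η₁ x₁))), fderiv ℂ G₁ w ≠ 0 :=
    hG₁.fderiv.continuousAt.eventually_ne hGd₁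
  obtain ⟨τ, hτ, hball⟩ := Metric.eventually_nhds_iff_ball.1
    ((hc₁.eventually (hG₁.eventually_analyticAt.and (hGd₁'.and hGX₁.eventually_nhds))).and
      hGs₁.eventually_nhds)
  set Ω₂ : Set ((Fin n → ℂ) × ℂ) := Ω ∩ Metric.ball (x₁, η₁ x₁) τ with hΩ₂
  have hΩ₂o : IsOpen Ω₂ := hΩo.inter Metric.isOpen_ball
  obtain ⟨x₂, η₂, G₂, hη₂, hz₂, hzs₂, hG₂, hGd₂, hGX₂, hGs₂, hGη₂, hηs₂, hQ₂⟩ :=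
    exists_levi_step hH hN (φ := fun z => φ (A z)) (Q := fun w => (G₁ w).im) hΩ₂o
      (hΩc.inter (convex_ball _ _))
      (fun z hz => ⟨hΩs z hz.1, star_mem_ball_of_star_eq hzs₁ hz.2⟩)
      (fun z hz => hφΩ z hz.1) (fun z hz => hφU z hz.1)
      (hR.mono (Set.prod_mono Set.inter_subset_left Set.inter_subset_left))
      (fun z hz => hRre z hz.1) (fun z hz => hRH z hz.1) (fun z hz => hyp z hz.1)
      (fun z hz => AnalyticAt.fun_comp (g := Complex.imCLM)
        (Complex.imCLM.analyticAt _) ((hball z hz.2).1.1.restrictScalars (𝕜 := ℝ)))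
      ⟨hz₁, Metric.mem_ball_self hτ⟩ hzs₁ (fun z hz hzs =>
        frequently_hypStar_im_ne_zero (hΩE z hz.1 hzs).1 (hball z hz.2).1.1
          (hball z hz.2).1.2.1 (hball z hz.2).1.2.2)
  have hx₂s : star x₂ = x₂ := congrArg Prod.fst hzs₂
  have hpair : AnalyticAt ℂ (fun x => (x, η₂ x)) x₂ := analyticAt_id.prod hη₂
  have hℓ : AnalyticAt ℂ (fun x => G₁ (φ (A (x, η₂ x)))) x₂ :=
    AnalyticAt.fun_comp (g := G₁) (hball _ hz₂.2).1.1
      (AnalyticAt.fun_comp (g := fun z => φ (A z)) (f := fun x => (x, η₂ x)) (hφΩ _ hz₂.1).1 hpair)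
  have hℓ2 : (G₁ (φ (A (x₂, η₂ x₂)))).im = 0 := by
    have h1 := (hball _ hz₂.2).2.self_of_nhds
    rw [hzs₂] at h1
    exact Complex.conj_eq_iff_im.1 h1.symm
  have hc₂ : ContinuousAt (fun x => φ (A (x, η₂ x))) x₂ :=
    (AnalyticAt.fun_comp (g := fun z => φ (A z)) (f := fun x => (x, η₂ x)) (hφΩ _ hz₂.1).1 hpair).continuousAt
  have hGd₂' : ∀ᶠ w in 𝓝 (φ (A (x₂, η₂ x₂))), fderiv ℂ G₂ w ≠ 0 :=
    hG₂.fderiv.continuousAt.eventually_ne hGd₂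
  obtain ⟨x₃, ⟨hx₃s, hℓ3⟩, hη₃, hηs₃, hz₃, hGη₃, ⟨hG₂₃, hGd₃, hGX₃⟩, hGs₃⟩ :=
    ((exists_fderiv_ne_zero_of_frequently_im_ne_zero hℓ hx₂s hℓ2 hQ₂).and_eventually
      (hη₂.eventually_analyticAt.and (hηs₂.and
        (Filter.Eventually.and (hpair.continuousAt.eventually (hΩ₂o.mem_nhds hz₂))
        (hGη₂.eventually_nhds.and
        ((hc₂.eventually (hG₂.eventually_analyticAt.and (hGd₂'.and hGX₂.eventually_nhds))).and
          (hpair.continuousAt.eventually hGs₂.eventually_nhds))))))).exists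
  have hz₃s : star (x₃, η₂ x₃) = (x₃, η₂ x₃) := Prod.ext hx₃s (hηs₃ hx₃s)
  set z₃ : (Fin n → ℂ) × ℂ := (x₃, η₂ x₃) with hz₃d
  have htr : ∀ {G : CN N → ℂ}, (∀ᶠ z in 𝓝 z₃, G (φ (A (star z))) = star (G (φ (A z)))) →
      ∀ᶠ z in 𝓝 (A z₃), G (φ (star z)) = star (G (φ z)) := by
    intro G h
    have h1 : Tendsto A.symm (𝓝 (A z₃)) (𝓝 z₃) :=
      A.symm.continuous.tendsto' _ _ (A.symm_apply_apply z₃)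
    filter_upwards [h1.eventually h] with z h2
    rwa [hAs, A.apply_symm_apply] at h2
  have hG₁₃ : AnalyticAt ℂ G₁ (φ (A z₃)) := (hball _ hz₃.2).1.1
  have hγ : DifferentiableAt ℂ (fun x => φ (A (x, η₂ x))) x₃ :=
    (AnalyticAt.fun_comp (g := fun z => φ (A z)) (f := fun x => (x, η₂ x)) (hφΩ _ hz₃.1).1
      (analyticAt_id.prod hη₃)).differentiableAt
  have hd₁ : HasFDerivAt (fun x => G₁ (φ (A (x, η₂ x)))) ((fderiv ℂ G₁ (φ (A z₃))).comp
      (fderiv ℂ (fun x => φ (A (x, η₂ x))) x₃)) x₃ :=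
    HasFDerivAt.comp x₃ (g := G₁) hG₁₃.differentiableAt.hasFDerivAt hγ.hasFDerivAt
  have hd₂ : HasFDerivAt (fun x => G₂ (φ (A (x, η₂ x)))) ((fderiv ℂ G₂ (φ (A z₃))).comp
      (fderiv ℂ (fun x => φ (A (x, η₂ x))) x₃)) x₃ :=
    HasFDerivAt.comp x₃ (g := G₂) hG₂₃.differentiableAt.hasFDerivAt hγ.hasFDerivAt
  have hd₂0 : (fderiv ℂ G₂ (φ (A z₃))).comp (fderiv ℂ (fun x => φ (A (x, η₂ x))) x₃) = 0 :=
    hd₂.unique ((hasFDerivAt_const (0 : ℂ) x₃).congr_of_eventuallyEq hGη₃)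
  rw [hd₁.fderiv] at hℓ3
  obtain ⟨SΓ, hSΓ⟩ := exists_rightInverse_prod (l₁ := fderiv ℂ G₁ (φ (A z₃)))
    (l₂ := fderiv ℂ G₂ (φ (A z₃))) (fun a b hab => by
      have hab' : ∀ v, a * fderiv ℂ G₁ (φ (A z₃)) v + b * fderiv ℂ G₂ (φ (A z₃)) v = 0 :=
        fun v => congrArg (fun l : CN N →L[ℂ] ℂ => l v) hab
      have ha : a = 0 := by
        by_contra ha
        refine hℓ3 (ContinuousLinearMap.ext fun v => ?_)
        have h1 := hab' (fderiv ℂ (fun x => φ (A (x, η₂ x))) x₃ v)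
        have h2 : fderiv ℂ G₂ (φ (A z₃)) (fderiv ℂ (fun x => φ (A (x, η₂ x))) x₃ v) = 0 :=
          congrArg (fun l : (Fin n → ℂ) →L[ℂ] ℂ => l v) hd₂0
        rw [h2, mul_zero, add_zero] at h1
        exact (mul_eq_zero.1 h1).resolve_left ha
      refine ⟨ha, ?_⟩
      by_contra hb
      refine hGd₃ (ContinuousLinearMap.ext fun v => ?_)
      have h1 := hab' v
      rw [ha, zero_mul, zero_add] at h1
      exact (mul_eq_zero.1 h1).resolve_left hb)
  refine ⟨A z₃, (hΩW z₃ hz₃.1).1, by rw [← hAs, hz₃s], G₁, G₂, hG₁₃, hG₂₃, ⟨SΓ, hSΓ⟩, ?_,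
    htr (hball _ hz₃.2).2, htr hGs₃⟩
  refine eventually_mem_singSet_iff hH hN hTs (hΩE z₃ hz₃.1 hz₃s).2 (hΩW z₃ hz₃.1).2.2
    hG₁₃ hG₂₃ (S := SΓ) (fun w => ?_) (hball _ hz₃.2).1.2.2 hGX₃
    (htr (hball _ hz₃.2).2) (htr hGs₃)
  rw [(hG₁₃.differentiableAt.hasFDerivAt.prodMk hG₂₃.differentiableAt.hasFDerivAt).fderiv]
  exact hSΓ w

theorem AnalyticAt.fderiv_apply_eq_zero_of_zero_subset {E F F' : Type*} [NormedAddCommGroup E]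
    [NormedSpace ℝ E] [CompleteSpace E] [NormedAddCommGroup F] [NormedSpace ℝ F]
    [NormedAddCommGroup F'] [NormedSpace ℝ F'] {f : E → F} {g : E → F'} {a : E}
    (hf : AnalyticAt ℝ f a) {S : F →L[ℝ] E} (hS : ∀ w, fderiv ℝ f a (S w) = w) (h0 : f a = 0)
    (hg : DifferentiableAt ℝ g a) (h : ∀ᶠ w in 𝓝 a, f w = 0 → g w = 0) {v : E}
    (hv : fderiv ℝ f a v = 0) : fderiv ℝ g a v = 0 := by
  obtain ⟨Ψ, -, hΨ, -, hΨ0, -, hΨd, -, -, -, hfΨ, -⟩ := hf.exists_linear_straightening hS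
  have hc : Tendsto (fun t : ℝ => a + t • v) (𝓝 0) (𝓝 a) :=
    (by fun_prop : Continuous fun t : ℝ => a + t • v).tendsto' _ _ (by simp)
  have hγ : HasDerivAt (fun t : ℝ => a + t • v) v 0 := by
    simpa using ((hasDerivAt_id (0 : ℝ)).smul_const v).const_add a
  have h1 : HasDerivAt (fun t : ℝ => Ψ (a + t • v)) v 0 := by
    have h2 : HasFDerivAt Ψ (ContinuousLinearMap.id ℝ E) (a + (0 : ℝ) • v) := by
      rw [zero_smul, add_zero]; exact hΨd
    exact HasFDerivAt.comp_hasDerivAt (l := Ψ) (f := fun t : ℝ => a + t • v) 0 h2 hγ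
  have h3 : HasDerivAt (fun t : ℝ => g (Ψ (a + t • v))) (fderiv ℝ g a v) 0 := by
    have h2 : HasFDerivAt g (fderiv ℝ g a) (Ψ (a + (0 : ℝ) • v)) := by
      rw [zero_smul, add_zero, hΨ0]; exact hg.hasFDerivAt
    exact HasFDerivAt.comp_hasDerivAt (l := g) (f := fun t : ℝ => Ψ (a + t • v)) 0 h2 h1
  have hΨt : Tendsto Ψ (𝓝 a) (𝓝 a) := by
    have := hΨ.continuousAt.tendsto; rwa [hΨ0] at this
  refine h3.unique ((hasDerivAt_const (0 : ℝ) (0 : F')).congr_of_eventuallyEq ?_)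
  filter_upwards [hc.eventually hfΨ, (hΨt.comp hc).eventually h] with t h4 h5
  refine h5 ?_
  simp only [Function.comp_apply]
  rw [h4, add_sub_cancel_left, map_smul, hv, h0, smul_zero, add_zero]

theorem finrank_eq_of_zero_eq {E F F' : Type*} [NormedAddCommGroup E]
    [NormedSpace ℝ E] [FiniteDimensional ℝ E] [NormedAddCommGroup F] [NormedSpace ℝ F]
    [FiniteDimensional ℝ F] [NormedAddCommGroup F'] [NormedSpace ℝ F'] [FiniteDimensional ℝ F']
    {f : E → F} {g : E → F'} {a : E} (hf : AnalyticAt ℝ f a) (hg : AnalyticAt ℝ g a)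
    (hfs : Function.Surjective (fderiv ℝ f a)) (hgs : Function.Surjective (fderiv ℝ g a))
    (h0 : f a = 0) (h : ∀ᶠ w in 𝓝 a, f w = 0 ↔ g w = 0) :
    Module.finrank ℝ F = Module.finrank ℝ F' := by
  have : CompleteSpace E := FiniteDimensional.complete ℝ E
  obtain ⟨S, hS⟩ := (fderiv ℝ f a : E →ₗ[ℝ] F).exists_rightInverse_of_surjective
    (LinearMap.range_eq_top.2 hfs)
  obtain ⟨S', hS'⟩ := (fderiv ℝ g a : E →ₗ[ℝ] F').exists_rightInverse_of_surjective
    (LinearMap.range_eq_top.2 hgs)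
  have hker : (fderiv ℝ f a : E →ₗ[ℝ] F).ker = (fderiv ℝ g a : E →ₗ[ℝ] F').ker := by
    refine le_antisymm (fun v hv => ?_) fun v hv => ?_
    · exact hf.fderiv_apply_eq_zero_of_zero_subset (S := S.toContinuousLinearMap)
        (fun w => congrArg (fun f => f w) hS) h0 hg.differentiableAt (h.mono fun _ => Iff.mp) hv
    · exact hg.fderiv_apply_eq_zero_of_zero_subset (S := S'.toContinuousLinearMap)
        (fun w => congrArg (fun f => f w) hS') (h.self_of_nhds.1 h0) hf.differentiableAt
        (h.mono fun _ => Iff.mpr) hv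
  have h1 := LinearMap.finrank_range_add_finrank_ker (fderiv ℝ f a : E →ₗ[ℝ] F)
  have h2 := LinearMap.finrank_range_add_finrank_ker (fderiv ℝ g a : E →ₗ[ℝ] F')
  rw [LinearMap.range_eq_top.2 hfs, finrank_top] at h1
  rw [LinearMap.range_eq_top.2 hgs, finrank_top] at h2
  rw [hker] at h1
  omega

theorem card_eq_two_of_im {N k : ℕ} {E : Set (CN N)} {e : CN N} {r : Fin k → CN N → ℝ}
    {G₁ G₂ : CN N → ℂ} (hr : ∀ i, AnalyticAt ℝ (r i) e)
    (hlin : LinearIndependent ℝ fun i => fderiv ℝ (r i) e) (he : e ∈ E)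
    (hE : ∀ᶠ w in 𝓝 e, w ∈ E ↔ ∀ i, r i w = 0)
    (h₁ : AnalyticAt ℂ G₁ e) (h₂ : AnalyticAt ℂ G₂ e) {S : ℂ × ℂ →L[ℂ] CN N}
    (hS : ∀ w, (fderiv ℂ G₁ e).prod (fderiv ℂ G₂ e) (S w) = w)
    (hG : ∀ᶠ w in 𝓝 e, w ∈ E ↔ (G₁ w).im = 0 ∧ (G₂ w).im = 0) : k = 2 := by
  have hfd : HasFDerivAt (fun w i => r i w) (ContinuousLinearMap.pi fun i => fderiv ℝ (r i) e) e :=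
    hasFDerivAt_pi.2 fun i => (hr i).differentiableAt.hasFDerivAt
  have hg₁ := Complex.imCLM.hasFDerivAt.comp e (h₁.differentiableAt.hasFDerivAt.restrictScalars ℝ)
  have hg₂ := Complex.imCLM.hasFDerivAt.comp e (h₂.differentiableAt.hasFDerivAt.restrictScalars ℝ)
  have h := finrank_eq_of_zero_eq (f := fun w i => r i w)
    (g := fun w => ((G₁ w).im, (G₂ w).im)) (a := e) (analyticAt_pi_iff.2 hr)
    (((Complex.imCLM.analyticAt _).comp (h₁.restrictScalars (𝕜 := ℝ))).prod
      ((Complex.imCLM.analyticAt _).comp (h₂.restrictScalars (𝕜 := ℝ))))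
    (by rw [hfd.fderiv]; exact surjective_of_linearIndependent hlin)
    (by
      have hgd : HasFDerivAt (fun w => ((G₁ w).im, (G₂ w).im)) _ e := hg₁.prodMk hg₂
      rw [hgd.fderiv]
      intro w
      refine ⟨S (I * w.1, I * w.2), ?_⟩
      have h3 := hS (I * w.1, I * w.2)
      have h4 := congrArg Prod.fst h3
      have h5 := congrArg Prod.snd h3
      simp only [ContinuousLinearMap.prod_apply] at h4 h5
      ext <;> simp [h4, h5])
    (funext fun i => hE.self_of_nhds.1 he i)
    (by
      filter_upwards [hE, hG] with w h3 h4
      rw [Prod.mk_eq_zero, ← h4, h3, funext_iff]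
      rfl)
  simpa using h

theorem AnalyticAt.eventually_eq_zero_of_leaves {m : ℕ} {E : Type*} [NormedAddCommGroup E]
    [NormedSpace ℂ E] {φ : (Fin m → ℂ) → E} (hφ : AnalyticAt ℂ φ 0) {ρ : E → ℝ}
    (hρ : AnalyticAt ℝ ρ (φ 0)) {Ψ Χ : (Fin m → ℂ) → (Fin m → ℂ)} (hΨ : AnalyticAt ℂ Ψ 0)
    (hΧ : AnalyticAt ℂ Χ 0) (hΨ0 : Ψ 0 = 0) (hΧ0 : Χ 0 = 0) {P : (Fin m → ℂ) →L[ℂ] (Fin m → ℂ)}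
    (h : ∀ W ∈ 𝓝 (0 : Fin m → ℂ), ∃ x ∈ W, star x = x ∧
      ∀ᶠ q in 𝓝 (x, (0 : Fin m → ℂ)), star q.1 = q.1 → ρ (φ (Ψ (Χ q.1 + P q.2))) = 0) :
    ∀ᶠ q in 𝓝 (0 : (Fin m → ℂ) × (Fin m → ℂ)), star q.1 = q.1 →
      ρ (φ (Ψ (Χ q.1 + P q.2))) = 0 := by
  set L : (Fin m → ℂ) × (Fin m → ℂ) →L[ℝ] (Fin m → ℂ) :=
    ((2⁻¹ : ℝ) • (ContinuousLinearMap.id ℝ (Fin m → ℂ) +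
      ((starL' ℝ : (Fin m → ℂ) ≃L[ℝ] (Fin m → ℂ)) : (Fin m → ℂ) →L[ℝ] (Fin m → ℂ)))).comp
      (ContinuousLinearMap.fst ℝ _ _) with hL
  have hLa : ∀ q, L q = (2⁻¹ : ℝ) • (q.1 + star q.1) := fun q => rfl
  have hLs : ∀ q, star (L q) = L q := by
    intro q
    rw [hLa, star_smul, star_add, star_star, add_comm]
    simp
  have hLr : ∀ q : (Fin m → ℂ) × (Fin m → ℂ), star q.1 = q.1 → L q = q.1 := by
    intro q hq
    rw [hLa, hq, ← two_smul ℝ, smul_smul]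
    norm_num
  set κ : (Fin m → ℂ) × (Fin m → ℂ) → ℝ := fun q => ρ (φ (Ψ (Χ (L q) + P q.2))) with hκ
  have hκa : AnalyticAt ℝ κ 0 := by
    have h1 : AnalyticAt ℝ (fun q => Χ (L q)) (0 : (Fin m → ℂ) × (Fin m → ℂ)) :=
      AnalyticAt.fun_comp (g := Χ) (f := L) (by rw [map_zero]; exact hΧ.restrictScalars)
        (L.analyticAt 0)
    have h2 : AnalyticAt ℝ (fun q : (Fin m → ℂ) × (Fin m → ℂ) => P q.2) 0 :=
      ((P.restrictScalars ℝ).analyticAt _).comp analyticAt_snd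
    have h30 : Χ (L 0) + P (0 : (Fin m → ℂ) × (Fin m → ℂ)).2 = 0 := by simp [hΧ0]
    have h3 : AnalyticAt ℝ (fun q => Ψ (Χ (L q) + P q.2)) (0 : (Fin m → ℂ) × (Fin m → ℂ)) :=
      AnalyticAt.fun_comp (g := Ψ) (f := fun q => Χ (L q) + P q.2)
        (by rw [h30]; exact hΨ.restrictScalars) (h1.add h2)
    have h4 : AnalyticAt ℝ (fun q => φ (Ψ (Χ (L q) + P q.2)))
        (0 : (Fin m → ℂ) × (Fin m → ℂ)) :=
      AnalyticAt.fun_comp (g := φ) (f := fun q => Ψ (Χ (L q) + P q.2))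
        (by rw [h30, hΨ0]; exact hφ.restrictScalars) h3
    exact AnalyticAt.fun_comp (g := ρ) (f := fun q => φ (Ψ (Χ (L q) + P q.2)))
      (by rw [h30, hΨ0]; exact hρ) h4
  obtain ⟨ε, hε, hball⟩ := Metric.eventually_nhds_iff_ball.1 hκa.eventually_analyticAt
  obtain ⟨x, hx, hxs, hxκ⟩ := h _ (Metric.ball_mem_nhds 0 hε)
  have hxb : (x, (0 : Fin m → ℂ)) ∈ Metric.ball (0 : (Fin m → ℂ) × (Fin m → ℂ)) ε := by
    rw [← Prod.mk_zero_zero, ← ball_prod_same]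
    exact ⟨hx, Metric.mem_ball_self hε⟩
  have hκ0 : ∀ᶠ q in 𝓝 (x, (0 : Fin m → ℂ)), κ q = 0 := by
    have h1 : Tendsto (fun q : (Fin m → ℂ) × (Fin m → ℂ) => (L q, q.2))
        (𝓝 (x, (0 : Fin m → ℂ))) (𝓝 (x, (0 : Fin m → ℂ))) :=
      (by fun_prop : Continuous fun q : (Fin m → ℂ) × (Fin m → ℂ) => (L q, q.2)).tendsto' _ _
        (by rw [hLr _ hxs])
    filter_upwards [h1.eventually hxκ] with q hq
    exact hq (hLs q)
  have key := AnalyticOnNhd.eqOn_zero_of_preconnected_of_eventuallyEq_zero hball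
    (convex_ball (0 : (Fin m → ℂ) × (Fin m → ℂ)) ε).isPreconnected hxb hκ0
  filter_upwards [Metric.ball_mem_nhds (0 : (Fin m → ℂ) × (Fin m → ℂ)) hε] with q hq hqs
  have h1 := key hq
  simp only [hκ, hLr q hqs] at h1
  exact h1

theorem eventually_im_eq_zero_of_leaves {N m : ℕ} {φ : (Fin m → ℂ) → CN N} {x : Fin m → ℂ}
    {ρ : CN N → ℝ} {Ψ Χ : (Fin m → ℂ) → (Fin m → ℂ)}
    {l : (Fin m → ℂ) →L[ℂ] CN N} {P : (Fin m → ℂ) →L[ℂ] (Fin m → ℂ)} {b : CN N}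
    (hφ : ContinuousAt φ x) (hΨ : ContinuousAt Ψ (Χ x)) (hΧ : ContinuousAt Χ x)
    (hΨΧ : Ψ (Χ x) = x)
    (hfΨ : ∀ᶠ y in 𝓝 (Χ x), star (φ (star (Ψ y))) = b + l y)
    (hΧl : ∀ z, l (Χ z) = star (φ (star z)) - b) (hP : ∀ c, l (P c) = 0) {G₁ G₂ : CN N → ℂ}
    (hρ : ∀ᶠ w in 𝓝 (φ x), (G₁ w).im = 0 ∧ (G₂ w).im = 0 → ρ w = 0)
    (hs₁ : ∀ᶠ z in 𝓝 x, G₁ (φ (star z)) = star (G₁ (φ z)))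
    (hs₂ : ∀ᶠ z in 𝓝 x, G₂ (φ (star z)) = star (G₂ (φ z))) :
    ∀ᶠ q in 𝓝 (x, (0 : Fin m → ℂ)), star q.1 = q.1 → ρ (φ (Ψ (Χ q.1 + P q.2))) = 0 := by
  have h1 : Tendsto (fun q : (Fin m → ℂ) × (Fin m → ℂ) => Χ q.1 + P q.2)
      (𝓝 (x, (0 : Fin m → ℂ))) (𝓝 (Χ x)) := by
    have h2 : ContinuousAt (fun q : (Fin m → ℂ) × (Fin m → ℂ) => Χ q.1 + P q.2)
        (x, (0 : Fin m → ℂ)) :=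
      (ContinuousAt.comp (g := Χ) (f := Prod.fst) hΧ continuousAt_fst).add
        (P.continuous.comp continuous_snd).continuousAt
    simpa using h2.tendsto
  have h2 : Tendsto (fun q : (Fin m → ℂ) × (Fin m → ℂ) => Ψ (Χ q.1 + P q.2))
      (𝓝 (x, (0 : Fin m → ℂ))) (𝓝 x) := by
    have := hΨ.tendsto.comp h1
    rwa [hΨΧ] at this
  have h3 : Tendsto (fun q : (Fin m → ℂ) × (Fin m → ℂ) => q.1)
      (𝓝 (x, (0 : Fin m → ℂ))) (𝓝 x) := continuousAt_fst
  filter_upwards [h1.eventually hfΨ, h2.eventually hs₁, h2.eventually hs₂, h3.eventually hs₁,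
    h3.eventually hs₂, (hφ.tendsto.comp h2).eventually hρ] with q h4 h5 h6 h7 h8 h9 hq
  have h10 : φ (star (Ψ (Χ q.1 + P q.2))) = φ q.1 := by
    apply star_injective
    rw [h4, map_add, hP, hΧl, hq]
    abel
  rw [h10] at h5 h6
  rw [hq] at h7 h8
  have h11 : ∀ {a b : ℂ}, a = star a → a = star b → b.im = 0 := by
    intro a b ha hb
    rw [← Complex.conj_eq_iff_im]
    have h12 : star b = b := by rw [← hb, ha, hb, star_star]
    exact h12
  exact h9 ⟨h11 h7 h5, h11 h8 h6⟩

theorem exists_real_frame {N m : ℕ} {A : (Fin m → ℂ) →L[ℂ] CN N} (hA : Function.Surjective A)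
    {l : CN N →L[ℂ] (Fin 2 → ℂ)} (hl : Function.Surjective l)
    (hreal : ∀ x, star x = x → ∀ j, (l (A x) j).re = 0) {As : (Fin m → ℂ) →L[ℂ] CN N}
    (hAs : ∀ v, As v = star (A (star v))) (hinj : ∀ x, star x = x → A x = 0 → x = 0)
    (hm : m + 2 = 2 * N) :
    ∃ X : (Fin 2 → ℂ) →L[ℂ] (Fin m → ℂ), (∀ s, star (X s) = X (star s)) ∧
      (∀ s c, As c = 0 → l (A (X s + c)) = -I • s) ∧
      ∃ L : ((Fin 2 → ℂ) × (As : (Fin m → ℂ) →ₗ[ℂ] CN N).ker) ≃L[ℂ] CN N,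
        ∀ q, L q = A (X q.1 + q.2) := by
  have hsplit : ∀ x : Fin m → ℂ, ∃ a b : Fin m → ℂ, star a = a ∧ star b = b ∧ x = a + I • b ∧
      a = (2⁻¹ : ℂ) • (x + star x) ∧ b = (-(2⁻¹ : ℂ) * I) • (x - star x) := by
    intro x
    refine ⟨_, _, ?_, ?_, ?_, rfl, rfl⟩
    · rw [star_smul, star_add, star_star, add_comm (star x)]
      simp
    · rw [star_smul, star_sub, star_star]
      simp only [star_mul', star_neg, star_inv₀, star_ofNat, Complex.star_def, Complex.conj_I]
      module
    · rw [smul_smul, show I * (-(2⁻¹ : ℂ) * I) = 2⁻¹ by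
        linear_combination (-(2⁻¹ : ℂ)) * I_mul_I]
      module
  set B : (Fin m → ℂ) →L[ℂ] (Fin 2 → ℂ) := I • l.comp A with hB
  have hBx : ∀ x, B x = I • l (A x) := fun x => rfl
  have hBr : ∀ x, star x = x → star (B x) = B x := by
    intro x hx
    funext j
    refine Complex.conj_eq_iff_im.2 ?_
    simp [hBx, hreal x hx j]
  have hBs : ∀ x, star (B x) = B (star x) := by
    intro x
    obtain ⟨a, b, ha, hb, hx, -, -⟩ := hsplit x
    rw [hx, star_add, star_smul, map_add, map_add, map_smul, map_smul, star_add, star_smul, ha, hb,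
      hBr a ha, hBr b hb]
  obtain ⟨S, hS⟩ := (B : (Fin m → ℂ) →ₗ[ℂ] (Fin 2 → ℂ)).exists_rightInverse_of_surjective
    (LinearMap.range_eq_top.2 fun w => by
      obtain ⟨u, hu⟩ := hl (-I • w)
      obtain ⟨v, hv⟩ := hA u
      refine ⟨v, ?_⟩
      rw [ContinuousLinearMap.coe_coe, hBx, hv, hu, smul_smul]
      simp)
  have hBS : ∀ s, B (S s) = s := fun s => congrArg (fun f => f s) hS
  set S' : (Fin 2 → ℂ) →L[ℂ] (Fin m → ℂ) := S.toContinuousLinearMap with hS'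
  set X : (Fin 2 → ℂ) →L[ℂ] (Fin m → ℂ) := (2⁻¹ : ℂ) • (S' +
    (starL ℂ : (Fin m → ℂ) ≃L⋆[ℂ] (Fin m → ℂ)).toContinuousLinearMap.comp
      (S'.comp (starL ℂ : (Fin 2 → ℂ) ≃L⋆[ℂ] (Fin 2 → ℂ)).toContinuousLinearMap)) with hX
  have hXs : ∀ s, X s = (2⁻¹ : ℂ) • (S s + star (S (star s))) := fun s => rfl
  have hBX : ∀ s, B (X s) = s := by
    intro s
    rw [hXs, map_smul, map_add, ← hBs, hBS, hBS, star_star]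
    module
  have hBc : ∀ c, As c = 0 → B c = 0 := by
    intro c hc
    rw [hAs, star_eq_zero] at hc
    have h1 : B (star c) = 0 := by rw [hBx, hc, map_zero, smul_zero]
    rwa [← hBs, star_eq_zero] at h1
  have hlA : ∀ s c, As c = 0 → l (A (X s + c)) = -I • s := by
    intro s c hc
    have h1 : I • l (A (X s + c)) = s := by rw [← hBx, map_add, hBX, hBc c hc, add_zero]
    conv_rhs => rw [← h1, smul_smul]
    simp
  have hAsurj : Function.Surjective As := fun w => by
    obtain ⟨v, hv⟩ := hA (star w)
    exact ⟨star v, by rw [hAs, star_star, hv, star_star]⟩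
  have hdim : Module.finrank ℂ ((Fin 2 → ℂ) × (As : (Fin m → ℂ) →ₗ[ℂ] CN N).ker) =
      Module.finrank ℂ (CN N) := by
    have h1 := LinearMap.finrank_range_add_finrank_ker (As : (Fin m → ℂ) →ₗ[ℂ] CN N)
    rw [LinearMap.range_eq_top.2 hAsurj, finrank_top] at h1
    simp only [CN, Module.finrank_fin_fun, Module.finrank_prod] at h1 ⊢
    omega
  set L₀ : ((Fin 2 → ℂ) × (As : (Fin m → ℂ) →ₗ[ℂ] CN N).ker) →ₗ[ℂ] CN N :=
    (A : (Fin m → ℂ) →ₗ[ℂ] CN N).comp ((X : (Fin 2 → ℂ) →ₗ[ℂ] (Fin m → ℂ)).coprod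
      (As : (Fin m → ℂ) →ₗ[ℂ] CN N).ker.subtype) with hL₀
  have hL₀a : ∀ q, L₀ q = A (X q.1 + q.2) := fun q => rfl
  have hL₀i : Function.Injective L₀ := by
    rw [← LinearMap.ker_eq_bot, LinearMap.ker_eq_bot']
    rintro ⟨s, c, hc⟩ h
    rw [hL₀a] at h
    have hc' : As c = 0 := hc
    have hs : s = 0 := by
      have h1 := hlA s c hc'
      rw [show A (X s + c) = 0 from h, map_zero] at h1
      simpa using h1.symm
    have hc0 : A c = 0 := by simpa [hs] using h
    have hcs : A (star c) = 0 := by rwa [hAs, star_eq_zero] at hc'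
    obtain ⟨a, b, ha, hb, hx, ha', hb'⟩ := hsplit c
    have ha0 : a = 0 := hinj a ha (by rw [ha', map_smul, map_add, hc0, hcs]; simp)
    have hb0 : b = 0 := hinj b hb (by rw [hb', map_smul, map_sub, hc0, hcs]; simp)
    have : c = 0 := by rw [hx, ha0, hb0]; simp
    subst hs this
    rfl
  refine ⟨X, fun s => ?_, hlA, (L₀.linearEquivOfInjective hL₀i hdim).toContinuousLinearEquiv,
    fun q => rfl⟩
  rw [hXs, hXs, star_smul, star_add, star_star, star_star, add_comm]
  simp

/-- The complex linear map with components `delForm N (r i) p`. -/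
def delFormCLM {N k : ℕ} (r : Fin k → CN N → ℝ) (p : CN N) : CN N →L[ℂ] (Fin k → ℂ) :=
  LinearMap.toContinuousLinearMap
    { toFun := fun v i => delForm N (r i) p v
      map_add' := fun v w => funext fun i => by
        simp only [delForm, smul_add, map_add, Complex.ofReal_add, Pi.add_apply]
        ring
      map_smul' := fun c v => funext fun i => by
        have h1 : ∀ u : CN N, fderiv ℝ (r i) p (c • u) =
            c.re * fderiv ℝ (r i) p u + c.im * fderiv ℝ (r i) p (I • u) := by
          intro u
          have h2 : c • u = c.re • u + c.im • (I • u) := by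
            conv_lhs => rw [← Complex.re_add_im c, add_smul, mul_smul]
            rfl
          rw [h2, map_add, map_smul, map_smul, smul_eq_mul, smul_eq_mul]
        simp only [delForm, RingHom.id_apply, Pi.smul_apply, smul_eq_mul]
        rw [smul_comm I c v, h1, h1, smul_smul, I_mul_I, neg_one_smul, map_neg]
        conv_rhs => rw [← Complex.re_add_im c]
        push_cast
        linear_combination ((c.im : ℂ) * fderiv ℝ (r i) p (I • v)) * I_mul_I }

theorem delFormCLM_apply {N k : ℕ} (r : Fin k → CN N → ℝ) (p v : CN N) (i : Fin k) :
    delFormCLM r p v i = delForm N (r i) p v := rfl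

theorem re_delFormCLM {N k : ℕ} (r : Fin k → CN N → ℝ) (p v : CN N) (i : Fin k) :
    (delFormCLM r p v i).re = fderiv ℝ (r i) p v := by
  simp [delFormCLM_apply, delForm]

theorem delFormCLM_surjective {N k : ℕ} {r : Fin k → CN N → ℝ} {p : CN N}
    (hcx : LinearIndependent ℂ fun i => delForm N (r i) p) :
    Function.Surjective (delFormCLM r p) := by
  by_contra hs
  obtain ⟨l, hl0, hl⟩ := Submodule.exists_le_ker_of_lt_top
    (LinearMap.range (delFormCLM r p : CN N →ₗ[ℂ] (Fin k → ℂ)))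
    (lt_top_iff_ne_top.2 fun h => hs (LinearMap.range_eq_top.1 h))
  refine hl0 (LinearMap.pi_ext' fun i => LinearMap.ext_ring ?_)
  refine Fintype.linearIndependent_iff.1 hcx (fun i => l (Pi.single i 1)) ?_ i
  ext v
  have h1 : l (delFormCLM r p v) = 0 := hl ⟨v, rfl⟩
  rw [LinearMap.pi_apply_eq_sum_univ] at h1
  simp only [smul_eq_mul] at h1
  simp only [Finset.sum_apply, Pi.smul_apply, smul_eq_mul, Pi.zero_apply]
  rw [← h1]
  refine Finset.sum_congr rfl fun i _ => ?_
  rw [mul_comm, delFormCLM_apply]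
  congr 2
  ext j
  simp [Pi.single_apply, eq_comm]

/-- A parametrization whose first two coordinates are real exactly on the zero set of `r` is
obtained from one that sends real first coordinates to the zero set, with the expected
derivative. -/
theorem eventually_forall_eq_zero_iff_im {N : ℕ} {K : Type*} [NormedAddCommGroup K]
    [NormedSpace ℂ K] [FiniteDimensional ℂ K] {r : Fin 2 → CN N → ℝ}
    {M : (Fin 2 → ℂ) × K → CN N} (hM : AnalyticAt ℂ M 0) (hr : ∀ i, AnalyticAt ℝ (r i) (M 0))
    {L : ((Fin 2 → ℂ) × K) →L[ℂ] CN N} (hML : HasFDerivAt M L 0)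
    (hL : ∀ q, delFormCLM r (M 0) (L q) = -I • q.1)
    (hMr : ∀ᶠ q in 𝓝 (0 : (Fin 2 → ℂ) × K), star q.1 = q.1 → ∀ i, r i (M q) = 0) :
    ∀ᶠ q in 𝓝 (0 : (Fin 2 → ℂ) × K), (∀ i, r i (M q) = 0) ↔ ∀ j, (q.1 j).im = 0 := by
  have hK : CompleteSpace K := FiniteDimensional.complete ℂ K
  have hst : ∀ q : (Fin 2 → ℂ) × K, (∀ j, (q.1 j).im = 0) ↔ star q.1 = q.1 := fun q => by
    rw [funext_iff]
    exact forall_congr' fun j => Complex.conj_eq_iff_im.symm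
  set F : (Fin 2 → ℂ) × K → (Fin 2 → ℂ) × K :=
    fun q => (fun j => ((q.1 j).re : ℂ) + I * (r j (M q) : ℂ), q.2) with hF
  have hMℝ : AnalyticAt ℝ M 0 := hM.restrictScalars
  have hrM : ∀ j, AnalyticAt ℝ (fun q => (r j (M q) : ℂ)) 0 := fun j =>
    (Complex.ofRealCLM.analyticAt _).comp (AnalyticAt.fun_comp (g := r j) (hr j) hMℝ)
  have hrMd : ∀ j, HasFDerivAt (fun q => (r j (M q) : ℂ)) (Complex.ofRealCLM.comp
      ((fderiv ℝ (r j) (M 0)).comp (L.restrictScalars ℝ))) 0 := fun j =>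
    Complex.ofRealCLM.hasFDerivAt.comp (0 : (Fin 2 → ℂ) × K)
      ((hr j).differentiableAt.hasFDerivAt.comp (0 : (Fin 2 → ℂ) × K) (hML.restrictScalars ℝ))
  set D : Fin 2 → ((Fin 2 → ℂ) × K) →L[ℝ] ℂ := fun j => Complex.ofRealCLM.comp
    (Complex.reCLM.comp ((ContinuousLinearMap.proj j).comp
      (ContinuousLinearMap.fst ℝ (Fin 2 → ℂ) K))) with hD
  have hFa : AnalyticAt ℝ F 0 := by
    refine AnalyticAt.prod (analyticAt_pi_iff.2 fun j => ?_) analyticAt_snd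
    exact ((D j).analyticAt 0).add (analyticAt_const.mul (hrM j))
  have hFd : HasFDerivAt F
      (ContinuousLinearEquiv.refl ℝ ((Fin 2 → ℂ) × K) : ((Fin 2 → ℂ) × K) →L[ℝ] _) 0 := by
    have h1 : HasFDerivAt F ((ContinuousLinearMap.pi fun j => D j + I • Complex.ofRealCLM.comp
      ((fderiv ℝ (r j) (M 0)).comp (L.restrictScalars ℝ))).prod
        (ContinuousLinearMap.snd ℝ (Fin 2 → ℂ) K)) 0 :=
      HasFDerivAt.prodMk (hasFDerivAt_pi.2 fun j => (D j).hasFDerivAt.add ((hrMd j).const_mul I))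
        hasFDerivAt_snd
    refine h1.congr_fderiv (ContinuousLinearMap.ext fun q => Prod.ext (funext fun j => ?_) rfl)
    have h2 : fderiv ℝ (r j) (M 0) (L q) = (q.1 j).im := by
      rw [← re_delFormCLM, hL]
      simp
    change ((q.1 j).re : ℂ) + I * ((fderiv ℝ (r j) (M 0) (L q) : ℝ) : ℂ) = q.1 j
    rw [h2, mul_comm, Complex.re_add_im]
  obtain ⟨Ψ, -, -, -, -, hΨ⟩ := hFa.exists_local_inverse hFd
  set ϖ : (Fin 2 → ℂ) × K → (Fin 2 → ℂ) × K := fun q => (fun j => ((q.1 j).re : ℂ), q.2) with hϖ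
  have hϖc : Tendsto ϖ (𝓝 0) (𝓝 0) :=
    (by fun_prop : Continuous ϖ).tendsto' _ _ (Prod.ext (funext fun j => by simp [hϖ]) rfl)
  filter_upwards [hMr, hϖc.eventually hMr, hΨ, hϖc.eventually hΨ] with q h1 h2 h3 h4
  rw [hst]
  refine ⟨fun h => ?_, h1⟩
  have h5 : star (ϖ q).1 = (ϖ q).1 := funext fun j => Complex.conj_ofReal _
  have h6 : F q = F (ϖ q) := by
    refine Prod.ext (funext fun j => ?_) rfl
    change ((q.1 j).re : ℂ) + I * (r j (M q) : ℂ) =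
      (((q.1 j).re : ℂ).re : ℂ) + I * (r j (M (ϖ q)) : ℂ)
    rw [h j, h2 h5 j, Complex.ofReal_re]
  have h7 : q = ϖ q := h3.symm.trans (by rw [h6, h4])
  rw [h7]
  exact h5

theorem exists_flat_param {N m : ℕ} {U H : Set (CN N)} (hH : IsLeviFlatHypervariety N U H)
    (hN : 1 ≤ N) {φ : (Fin m → ℂ) → CN N} (hφ : AnalyticAt ℂ φ 0) {S : CN N →L[ℂ] (Fin m → ℂ)}
    (hS : ∀ w, fderiv ℂ φ 0 (S w) = w) {T : CN N →L[ℝ] (Fin m → ℂ)}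
    (hTs : ∀ v, star (T v) = T v) {p : CN N} (hp : φ 0 = p)
    (hpE : p ∈ singSet N (closure (hypStar N H) ∩ U))
    (hET : ∀ᶠ w in 𝓝 p, w ∈ singSet N (closure (hypStar N H) ∩ U) → φ (T (w - p)) = w)
    (hφE : ∀ᶠ x in 𝓝 0, star x = x →
      φ x ∈ singSet N (closure (hypStar N H) ∩ U) ∧ T (φ x - p) = x)
    {r : Fin 2 → CN N → ℝ} (hr : ∀ i, AnalyticAt ℝ (r i) p)
    (hcx : LinearIndependent ℂ fun i => delForm N (r i) p)
    (hE : ∀ᶠ w in 𝓝 p, w ∈ singSet N (closure (hypStar N H) ∩ U) ↔ ∀ i, r i w = 0)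
    (hm : m + 2 = 2 * N) :
    ∃ (K : Submodule ℂ (Fin m → ℂ)) (M : (Fin 2 → ℂ) × K → CN N)
      (L : ((Fin 2 → ℂ) × K) ≃L[ℂ] CN N), AnalyticAt ℂ M 0 ∧ M 0 = p ∧
      HasFDerivAt M (L : ((Fin 2 → ℂ) × K) →L[ℂ] CN N) 0 ∧
      ∀ᶠ q in 𝓝 0, M q ∈ singSet N (closure (hypStar N H) ∩ U) ↔ ∀ j, (q.1 j).im = 0 := by
  -- real directions
  have hcurve : ∀ x : Fin m → ℂ, star x = x → ∀ᶠ t : ℝ in 𝓝 0,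
      φ (t • x) ∈ singSet N (closure (hypStar N H) ∩ U) ∧ T (φ (t • x) - p) = t • x := by
    intro x hx
    have h1 : Tendsto (fun t : ℝ => t • x) (𝓝 0) (𝓝 0) :=
      (by fun_prop : Continuous fun t : ℝ => t • x).tendsto' _ _ (by simp)
    filter_upwards [h1.eventually hφE] with t ht
    exact ht (by rw [star_smul, hx]; simp)
  have hcd : ∀ x : Fin m → ℂ, HasDerivAt (fun t : ℝ => φ (t • x)) (fderiv ℂ φ 0 x) 0 := by
    intro x
    have h1 : HasDerivAt (fun t : ℝ => t • x) x 0 := by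
      simpa using (hasDerivAt_id (0 : ℝ)).smul_const x
    have h2 : HasFDerivAt φ ((fderiv ℂ φ 0).restrictScalars ℝ) ((0 : ℝ) • x) := by
      rw [zero_smul]; exact hφ.differentiableAt.hasFDerivAt.restrictScalars ℝ
    exact HasFDerivAt.comp_hasDerivAt (l := φ) (f := fun t : ℝ => t • x) 0 h2 h1
  have hinj : ∀ x : Fin m → ℂ, star x = x → fderiv ℂ φ 0 x = 0 → x = 0 := by
    intro x hx h0
    have h1 : HasDerivAt (fun t : ℝ => T (φ (t • x) - p)) (T (fderiv ℂ φ 0 x)) 0 :=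
      T.hasFDerivAt.comp_hasDerivAt 0 ((hcd x).sub_const p)
    have h2 : HasDerivAt (fun t : ℝ => t • x) x 0 := by
      simpa using (hasDerivAt_id (0 : ℝ)).smul_const x
    have h3 := h1.unique (h2.congr_of_eventuallyEq ((hcurve x hx).mono fun t ht => ht.2))
    rw [← h3, h0, map_zero]
  have htan : ∀ x : Fin m → ℂ, star x = x → ∀ i, fderiv ℝ (r i) p (fderiv ℂ φ 0 x) = 0 := by
    intro x hx i
    have h0 : φ ((0 : ℝ) • x) = p := by rw [zero_smul, hp]
    have h1 : HasDerivAt (fun t : ℝ => r i (φ (t • x))) (fderiv ℝ (r i) p (fderiv ℂ φ 0 x)) 0 := by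
      have h2 : HasFDerivAt (r i) (fderiv ℝ (r i) p) (φ ((0 : ℝ) • x)) := by
        rw [h0]; exact (hr i).differentiableAt.hasFDerivAt
      exact HasFDerivAt.comp_hasDerivAt (l := r i) (f := fun t : ℝ => φ (t • x)) 0 h2 (hcd x)
    refine h1.unique ((hasDerivAt_const (0 : ℝ) (0 : ℝ)).congr_of_eventuallyEq ?_)
    have h3 : Tendsto (fun t : ℝ => φ (t • x)) (𝓝 0) (𝓝 p) := by
      have := (hcd x).continuousAt.tendsto
      rwa [h0] at this
    filter_upwards [hcurve x hx, h3.eventually hE] with t h4 h5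
    exact h5.1 h4.1 i
  -- the conjugate submersion
  set φs : (Fin m → ℂ) → CN N := fun z => star (φ (star z)) with hφs
  have hφsa : AnalyticAt ℂ φs 0 := AnalyticAt.star_comp_star (by rwa [star_zero])
  set As : (Fin m → ℂ) →L[ℂ] CN N := fderiv ℂ φs 0 with hAsd
  have hAs : ∀ v, As v = star (fderiv ℂ φ 0 (star v)) := by
    intro v
    have h1 := hφ.differentiableAt.hasFDerivAt.star_star
    rw [star_zero] at h1
    exact congrArg (fun l : (Fin m → ℂ) →L[ℂ] CN N => l v) h1.fderiv
  have hSurj : Function.Surjective (fderiv ℂ φ 0) := fun w => ⟨S w, hS w⟩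
  obtain ⟨Ss, hSs⟩ := (As : (Fin m → ℂ) →ₗ[ℂ] CN N).exists_rightInverse_of_surjective
    (LinearMap.range_eq_top.2 fun w =>
      ⟨star (S (star w)), by rw [ContinuousLinearMap.coe_coe, hAs, star_star, hS, star_star]⟩)
  have hSs' : ∀ w, As (Ss.toContinuousLinearMap w) = w := fun w => congrArg (fun f => f w) hSs
  obtain ⟨Ψ, Χ, hΨ, hΧ, hΨ0, hΧ0, hΨd, hΧd, -, hΨΧ, hfΨ, hΧl⟩ :=
    hφsa.exists_linear_straightening hSs'
  simp only [sub_zero] at hfΨ hΧl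
  set P : (Fin m → ℂ) →L[ℂ] (Fin m → ℂ) :=
    ContinuousLinearMap.id ℂ _ - Ss.toContinuousLinearMap.comp As with hP
  have hPa : ∀ c, P c = c - Ss.toContinuousLinearMap (As c) := fun c => rfl
  have hAP : ∀ c, As (P c) = 0 := fun c => by rw [hPa, map_sub, hSs', sub_self]
  have hleaf : ∀ i, ∀ᶠ q in 𝓝 (0 : (Fin m → ℂ) × (Fin m → ℂ)), star q.1 = q.1 →
      r i (φ (Ψ (Χ q.1 + P q.2))) = 0 := by
    intro i
    refine hφ.eventually_eq_zero_of_leaves (by rw [hp]; exact hr i) hΨ hΧ hΨ0 hΧ0 fun W hW => ?_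
    have hφp : Tendsto φ (𝓝 0) (𝓝 p) := hp ▸ hφ.continuousAt.tendsto
    have hΧt : Tendsto Χ (𝓝 0) (𝓝 0) := by
      have := hΧ.continuousAt.tendsto; rwa [hΧ0] at this
    have hall : ∀ᶠ x in 𝓝 (0 : Fin m → ℂ), AnalyticAt ℂ φ x ∧ AnalyticAt ℂ Ψ (Χ x) ∧
        AnalyticAt ℂ Χ x ∧ Ψ (Χ x) = x ∧ (∀ᶠ y in 𝓝 (Χ x), φs (Ψ y) = φs 0 + As y) ∧
        ∀ᶠ w in 𝓝 (φ x), w ∈ singSet N (closure (hypStar N H) ∩ U) ↔ ∀ i, r i w = 0 :=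
      hφ.eventually_analyticAt.and ((hΧt.eventually hΨ.eventually_analyticAt).and
        (hΧ.eventually_analyticAt.and (hΨΧ.and ((hΧt.eventually hfΨ.eventually_nhds).and
          (hφp.eventually hE.eventually_nhds)))))
    obtain ⟨x, hx, hxs, G₁, G₂, -, -, -, hGE, hs₁, hs₂⟩ :=
      exists_levi_pair hH hN hφ hS hTs hp hpE hET hφE (Filter.inter_mem hW hall)
    obtain ⟨h1, h2, h3, h4, h5, h6⟩ := hx.2
    refine ⟨x, hx.1, hxs, ?_⟩
    refine eventually_im_eq_zero_of_leaves h1.continuousAt h2.continuousAt h3.continuousAt h4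
      h5 hΧl hAP ?_ hs₁ hs₂
    filter_upwards [hGE, h6] with w h7 h8 h9
    exact h8.1 (h7.2 h9) i
  -- the parametrization
  set K := (As : (Fin m → ℂ) →ₗ[ℂ] CN N).ker with hK
  obtain ⟨X, hXs, hlX, L, hL⟩ := exists_real_frame hSurj (delFormCLM_surjective hcx)
    (fun x hx j => by rw [re_delFormCLM]; exact htan x hx j) hAs hinj hm
  have hKP : ∀ c : K, P c = c := fun c => by
    have : As c = 0 := c.2
    rw [hPa, this, map_zero, sub_zero]
  set X' : (Fin 2 → ℂ) × K →L[ℂ] (Fin m → ℂ) := X.comp (ContinuousLinearMap.fst ℂ _ _) with hX'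
  set C : (Fin 2 → ℂ) × K →L[ℂ] (Fin m → ℂ) :=
    K.subtypeL.comp (ContinuousLinearMap.snd ℂ _ _) with hC
  set M : (Fin 2 → ℂ) × K → CN N := fun q => φ (Ψ (Χ (X' q) + C q)) with hM
  have h0 : Χ (X' 0) + C 0 = 0 := by rw [map_zero, map_zero, hΧ0, add_zero]
  have hin : AnalyticAt ℂ (fun q => Χ (X' q) + C q) 0 :=
    (AnalyticAt.fun_comp (g := Χ) (by rwa [map_zero]) (X'.analyticAt 0)).add (C.analyticAt 0)
  have hmid : AnalyticAt ℂ (fun q => Ψ (Χ (X' q) + C q)) 0 :=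
    AnalyticAt.fun_comp (g := Ψ) (f := fun q => Χ (X' q) + C q) (by rwa [h0]) hin
  have hMa : AnalyticAt ℂ M 0 :=
    AnalyticAt.fun_comp (g := φ) (f := fun q => Ψ (Χ (X' q) + C q)) (by rwa [h0, hΨ0]) hmid
  have hM0 : M 0 = p := by simp only [hM, h0, hΨ0, hp]
  have hMd : HasFDerivAt M (L : ((Fin 2 → ℂ) × K) →L[ℂ] CN N) 0 := by
    have h0' : HasFDerivAt (fun q => Χ (X' q)) X' 0 :=
      (HasFDerivAt.comp (0 : (Fin 2 → ℂ) × K) (g := Χ) (f := X')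
        (g' := ContinuousLinearMap.id ℂ _) (by rw [map_zero]; exact hΧd)
        X'.hasFDerivAt).congr_fderiv (ContinuousLinearMap.id_comp _)
    have h1 : HasFDerivAt (fun q => Χ (X' q) + C q) (X' + C) 0 := h0'.add C.hasFDerivAt
    have h2 : HasFDerivAt (fun q => Ψ (Χ (X' q) + C q)) (X' + C) 0 :=
      (HasFDerivAt.comp (0 : (Fin 2 → ℂ) × K) (g := Ψ) (f := fun q => Χ (X' q) + C q)
        (g' := ContinuousLinearMap.id ℂ _) (by rw [h0]; exact hΨd) h1).congr_fderiv
        (ContinuousLinearMap.id_comp _)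
    have h3 : HasFDerivAt M ((fderiv ℂ φ 0).comp (X' + C)) 0 :=
      HasFDerivAt.comp (0 : (Fin 2 → ℂ) × K) (g := φ) (f := fun q => Ψ (Χ (X' q) + C q))
        (by rw [h0, hΨ0]; exact hφ.differentiableAt.hasFDerivAt) h2
    exact h3.congr_fderiv (ContinuousLinearMap.ext fun q => (hL q).symm)
  refine ⟨K, M, L, hMa, hM0, hMd, ?_⟩
  have hMr : ∀ᶠ q in 𝓝 (0 : (Fin 2 → ℂ) × K), star q.1 = q.1 → ∀ i, r i (M q) = 0 := by
    have h1 : Tendsto (fun q => (X' q, C q)) (𝓝 (0 : (Fin 2 → ℂ) × K)) (𝓝 0) :=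
      (by fun_prop : Continuous fun q => (X' q, C q)).tendsto' _ _ (by simp)
    filter_upwards [h1.eventually (Filter.eventually_all.2 hleaf)] with q hq hqs i
    have h2 : P (C q) = C q := hKP q.2
    have h3 := hq i (by change star (X q.1) = X q.1; rw [hXs, hqs])
    simp only [h2] at h3
    exact h3
  have hMt : Tendsto M (𝓝 0) (𝓝 p) := hM0 ▸ hMa.continuousAt.tendsto
  filter_upwards [hMt.eventually hE, eventually_forall_eq_zero_iff_im hMa
    (fun i => by rw [hM0]; exact hr i) hMd
    (fun q => by rw [hM0, ContinuousLinearEquiv.coe_coe, hL]; exact hlX q.1 q.2 q.2.2) hMr]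
    with q h1 h2
  rw [h1, h2]

theorem exists_coordinate_equiv {N : ℕ} {F : Type*} [NormedAddCommGroup F] [NormedSpace ℂ F]
    (L : ((Fin 2 → ℂ) × F) ≃L[ℂ] CN N) :
    2 ≤ N ∧ ∃ ι : ((Fin 2 → ℂ) × F) ≃L[ℂ] CN N,
      ∀ q, (∀ j, (q.1 j).im = 0) ↔ ∀ i : Fin N, (i : ℕ) < 2 → (ι q i).im = 0 := by
  have : FiniteDimensional ℂ ((Fin 2 → ℂ) × F) := L.symm.toLinearEquiv.finiteDimensional
  have : FiniteDimensional ℂ F :=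
    FiniteDimensional.of_surjective (LinearMap.snd ℂ (Fin 2 → ℂ) F) LinearMap.snd_surjective
  obtain ⟨n, hn⟩ : ∃ n, Module.finrank ℂ F = n := ⟨_, rfl⟩
  obtain rfl : N = 2 + n := by
    have := L.toLinearEquiv.finrank_eq
    rw [Module.finrank_prod, hn, Module.finrank_fin_fun, Module.finrank_fin_fun] at this
    exact this.symm
  refine ⟨by lia, ?_⟩
  have e : F ≃ₗ[ℂ] (Fin n → ℂ) := LinearEquiv.ofFinrankEq _ _ (by simp [hn])
  set ι : ((Fin 2 → ℂ) × F) ≃ₗ[ℂ] (Fin (2 + n) → ℂ) :=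
    (LinearEquiv.prodCongr (LinearEquiv.refl ℂ _) e).trans
      ((LinearEquiv.sumArrowLequivProdArrow (Fin 2) (Fin n) ℂ ℂ).symm.trans
        (LinearEquiv.funCongrLeft ℂ ℂ finSumFinEquiv.symm)) with hι
  have hl : ∀ q (j : Fin 2), ι q (Fin.castAdd n j) = q.1 j := by
    intro q j
    simp [hι, LinearEquiv.funCongrLeft, LinearMap.funLeft]
  refine ⟨ι.toContinuousLinearEquiv, fun q => ?_⟩
  change _ ↔ ∀ i : Fin (2 + n), (i : ℕ) < 2 → (ι q i).im = 0
  constructor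
  · intro h i hi
    have h1 := hl q ⟨i, hi⟩
    have h2 : Fin.castAdd n (⟨i, hi⟩ : Fin 2) = i := rfl
    rw [← h2, h1, h]
  · intro h j
    rw [← hl]
    exact h _ j.2

theorem isGenericLeviFlat2At_of_param {N : ℕ} {E : Set (CN N)} {p : CN N} {F : Type*}
    [NormedAddCommGroup F] [NormedSpace ℂ F] {M : (Fin 2 → ℂ) × F → CN N}
    {L : ((Fin 2 → ℂ) × F) ≃L[ℂ] CN N} (hM : AnalyticAt ℂ M 0) (hMp : M 0 = p)
    (hL : HasFDerivAt M (L : ((Fin 2 → ℂ) × F) →L[ℂ] CN N) 0)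
    (hE : ∀ᶠ q in 𝓝 0, M q ∈ E ↔ ∀ j, (q.1 j).im = 0) : IsGenericLeviFlat2At N E p := by
  obtain ⟨-, ι, hι⟩ := exists_coordinate_equiv L
  set M' : CN N → CN N := fun z => M (ι.symm z) with hM'
  have hM'a : AnalyticAt ℂ M' 0 :=
    AnalyticAt.fun_comp (g := M) (f := ι.symm) (by rwa [map_zero]) (ι.symm.analyticAt 0)
  have hM'd : HasFDerivAt M' ((ι.symm.trans L : CN N ≃L[ℂ] CN N) : CN N →L[ℂ] CN N) 0 :=
    HasFDerivAt.comp (0 : CN N) (g := M) (f := ι.symm)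
      (g' := (L : ((Fin 2 → ℂ) × F) →L[ℂ] CN N)) (by rwa [map_zero]) ι.symm.hasFDerivAt
  have hM'0 : M' 0 = p := by simp only [hM', map_zero, hMp]
  obtain ⟨Φ, hΦ, hΦ0, hΦd, hr, -⟩ := hM'a.exists_local_inverse hM'd
  rw [hM'0] at hΦ hΦ0 hΦd hr
  have hΦt : Tendsto (fun z => ι.symm (Φ z)) (𝓝 p) (𝓝 0) := by
    have h1 := (ι.symm.continuous.continuousAt (x := Φ p)).tendsto.comp hΦ.continuousAt.tendsto
    rwa [hΦ0, map_zero] at h1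
  have hbij : ∀ᶠ z in 𝓝 p, Function.Bijective (fderiv ℂ Φ z) := by
    have h1 : ContinuousAt (fderiv ℂ Φ) p := hΦ.fderiv.continuousAt
    have h2 := Tendsto.eventually (f := fderiv ℂ Φ) h1 (p := fun l => l ∈ range ((↑) : (CN N ≃L[ℂ] CN N) → _))
      (by rw [hΦd.fderiv]; exact ContinuousLinearEquiv.nhds _)
    filter_upwards [h2] with z hz
    obtain ⟨e, he⟩ := hz
    rw [← he]
    exact e.bijective
  obtain ⟨V, hV, hVo, hpV⟩ := eventually_nhds_iff.1 (hΦ.eventually_analyticAt.and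
    (hbij.and (hr.and (hΦt.eventually hE))))
  refine ⟨V, Φ, hVo, hpV, fun z hz => (hV z hz).1.analyticWithinAt, fun z hz w hw hzw => ?_,
    fun z hz => (hV z hz).2.1, ?_⟩
  · rw [← (hV z hz).2.2.1, ← (hV w hw).2.2.1, hzw]
  · ext z
    simp only [mem_inter_iff, mem_ofPred_eq]
    rw [and_comm]
    refine and_congr_right fun hz => ?_
    obtain ⟨-, -, h1, h2⟩ := hV z hz
    rw [hι, ContinuousLinearEquiv.apply_symm_apply] at h2
    rw [← h2]
    exact iff_of_eq (congrArg (· ∈ E) h1.symm)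

theorem dimH_submodule_inter {F : Type*} [NormedAddCommGroup F] [NormedSpace ℝ F]
    [FiniteDimensional ℝ F] (D : Submodule ℝ F) {x : F} (hx : x ∈ D) {W : Set F} (hW : W ∈ 𝓝 x) :
    dimH ((D : Set F) ∩ W) = Module.finrank ℝ D := by
  have h1 : (D : Set F) ∩ W = D.subtypeL '' (D.subtypeL ⁻¹' W) := by
    rw [image_preimage_eq_range_inter]
    simp
  have h2 : Isometry D.subtypeL := isometry_subtype_coe
  rw [h1, h2.dimH_image]
  refine Real.dimH_of_mem_nhds (x := (⟨x, hx⟩ : D)) ?_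
  exact D.subtypeL.continuous.continuousAt.preimage_mem_nhds hW

theorem exists_flat_submodule {N : ℕ} (hN : 2 ≤ N) : ∃ D : Submodule ℝ (CN N),
    Module.finrank ℝ D = 2 * N - 2 ∧ ∀ z, z ∈ D ↔ ∀ i : Fin N, (i : ℕ) < 2 → (z i).im = 0 := by
  set l : CN N →ₗ[ℝ] (Fin 2 → ℝ) :=
    LinearMap.pi fun j => Complex.imLm ∘ₗ LinearMap.proj (Fin.castLE hN j) with hl
  have hlz : ∀ z j, l z j = (z (Fin.castLE hN j)).im := fun z j => rfl
  have hs : Function.Surjective l := by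
    intro s
    refine ⟨fun i => if h : (i : ℕ) < 2 then (s ⟨i, h⟩ : ℂ) * I else 0, ?_⟩
    funext j
    rw [hlz, dif_pos (show ((Fin.castLE hN j : Fin N) : ℕ) < 2 from j.2)]
    simp
  refine ⟨l.ker, ?_, fun z => ?_⟩
  · have h1 := l.finrank_range_add_finrank_ker
    rw [LinearMap.range_eq_top.2 hs, finrank_top] at h1
    have h2 : Module.finrank ℝ (CN N) = 2 * N := by
      simp [Module.finrank_pi_fintype, mul_comm]
    rw [h2, Module.finrank_fin_fun] at h1
    lia
  · rw [LinearMap.mem_ker]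
    constructor
    · intro h i hi
      exact congrFun h ⟨i, hi⟩
    · intro h
      funext j
      exact h _ j.2

theorem exists_nhds_dimH_eq {N : ℕ} (hN : 2 ≤ N) {E : Set (CN N)} {p : CN N} (hp : p ∈ E)
    (h : IsGenericLeviFlat2At N E p) :
    ∃ t ∈ 𝓝 p, dimH (E ∩ t) = ((2 * N - 2 : ℕ) : ℝ≥0∞) := by
  obtain ⟨V, Φ, hV, hpV, hΦ, -, hbij, hE⟩ := h
  obtain ⟨D, hD, hDz⟩ := exists_flat_submodule hN
  have hEV : ∀ z ∈ V, z ∈ E ↔ Φ z ∈ D := by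
    intro z hz
    rw [hDz]
    have h1 : z ∈ E ∩ V ↔ z ∈ {z ∈ V | ∀ i : Fin N, (i : ℕ) < 2 → (Φ z i).im = 0} := by rw [hE]
    simpa [hz] using h1
  have hΦp : AnalyticAt ℂ Φ p := hV.analyticOn_iff_analyticOnNhd.1 hΦ p hpV
  have hL : HasFDerivAt Φ ((LinearEquiv.ofBijective (fderiv ℂ Φ p : CN N →ₗ[ℂ] CN N)
      (hbij p hpV)).toContinuousLinearEquiv : CN N →L[ℂ] CN N) p :=
    hΦp.differentiableAt.hasFDerivAt.congr_fderiv (ContinuousLinearMap.ext fun _ => rfl)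
  obtain ⟨Ψ, hΨ, hΨ0, -, hΦΨ, hΨΦ⟩ := hΦp.exists_local_inverse hL
  obtain ⟨C, s, hs, hsL⟩ := (hΦp.contDiffAt (n := 1)).exists_lipschitzOnWith
  obtain ⟨C', s', hs', hsL'⟩ := (hΨ.contDiffAt (n := 1)).exists_lipschitzOnWith
  have hΨt : Tendsto Ψ (𝓝 (Φ p)) (𝓝 p) := by
    have := hΨ.continuousAt.tendsto; rwa [hΨ0] at this
  obtain ⟨t, ht, hto, hpt⟩ := eventually_nhds_iff.1 (hΨΦ.and
    (Filter.Eventually.and hs (Filter.Eventually.and (hV.mem_nhds hpV) (hΦp.continuousAt.eventually hs'))))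
  obtain ⟨W, hW, hWo, hpW⟩ := eventually_nhds_iff.1 (hΦΨ.and
    (hΨt.eventually (hto.mem_nhds hpt)))
  have hpD : Φ p ∈ D := (hEV p hpV).1 hp
  refine ⟨t, hto.mem_nhds hpt, le_antisymm ?_ ?_⟩
  · have h1 : E ∩ t ⊆ Ψ '' ((D : Set (CN N)) ∩ s') := by
      rintro z ⟨hzE, hzt⟩
      obtain ⟨h1, -, h3, h4⟩ := ht z hzt
      exact ⟨Φ z, ⟨(hEV z h3).1 hzE, h4⟩, h1⟩
    rw [← hD, ← dimH_submodule_inter D hpD hs']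
    exact (dimH_mono h1).trans (hsL'.mono inter_subset_right).dimH_image_le
  · have h1 : (D : Set (CN N)) ∩ W ⊆ Φ '' (E ∩ t) := by
      rintro y ⟨hyD, hyW⟩
      obtain ⟨h1, h2⟩ := hW y hyW
      refine ⟨Ψ y, ⟨(hEV _ (ht _ h2).2.2.1).2 ?_, h2⟩, h1⟩
      rwa [h1]
    rw [← hD, ← dimH_submodule_inter D hpD (hWo.mem_nhds hpW)]
    exact (dimH_mono h1).trans (hsL.mono fun z hz => (ht z hz.2).2.1).dimH_image_le

theorem dimH_eq_of_isGenericLeviFlat2At {N : ℕ} (hN : 2 ≤ N) {E : Set (CN N)} (hne : E.Nonempty)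
    (h : ∀ p ∈ E, IsGenericLeviFlat2At N E p) : dimH E = ((2 * N - 2 : ℕ) : ℝ≥0∞) := by
  refine le_antisymm (not_lt.1 fun hlt => ?_) ?_
  · obtain ⟨p, hp, hpd⟩ := exists_mem_nhdsWithin_lt_dimH_of_lt_dimH hlt
    obtain ⟨t, ht, htd⟩ := exists_nhds_dimH_eq hN hp (h p hp)
    have := hpd (E ∩ t) (inter_mem_nhdsWithin E ht)
    exact this.ne' htd
  · obtain ⟨p, hp⟩ := hne
    obtain ⟨t, -, htd⟩ := exists_nhds_dimH_eq hN hp (h p hp)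
    rw [← htd]
    exact dimH_mono inter_subset_left

theorem two_le_and_isGenericLeviFlat2At {N : ℕ} {U H : Set (CN N)}
    (hH : IsLeviFlatHypervariety N U H) (hN : 1 ≤ N) {p : CN N}
    (hpE : p ∈ singSet N (closure (hypStar N H) ∩ U))
    (hgen : IsGenericSubmanifoldAt N (singSet N (closure (hypStar N H) ∩ U)) p) :
    2 ≤ N ∧ IsGenericLeviFlat2At N (singSet N (closure (hypStar N H) ∩ U)) p := by
  obtain ⟨V, k, r, hV, hpV, hr, hreal, hcx, hEV⟩ := hgen
  have hEV' : ∀ z ∈ V, z ∈ singSet N (closure (hypStar N H) ∩ U) ↔ ∀ i, r i z = 0 := by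
    intro z hz
    have h1 : z ∈ singSet N (closure (hypStar N H) ∩ U) ∩ V ↔ z ∈ {z ∈ V | ∀ i, r i z = 0} := by
      rw [hEV]
    simpa [hz] using h1
  have hra : ∀ z ∈ V, ∀ i, AnalyticAt ℝ (r i) z := fun z hz i =>
    hV.analyticOn_iff_analyticOnNhd.1 (hr i) z hz
  obtain ⟨m, φ, T, S, hm, hφ, hφ0, hS, hTs, hTφ, hφr⟩ :=
    exists_generic_param (hra p hpV) ((hEV' p hpV).1 hpE) (hreal p hpV) (hcx p hpV)
  have hpVm : ∀ᶠ w in 𝓝 p, w ∈ V := hV.mem_nhds hpV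
  have hφt : Tendsto φ (𝓝 0) (𝓝 p) := hφ0 ▸ hφ.continuousAt.tendsto
  have hET : ∀ᶠ w in 𝓝 p, w ∈ singSet N (closure (hypStar N H) ∩ U) → φ (T (w - p)) = w := by
    filter_upwards [hpVm, hTφ] with w hw h1 h2
    exact h1 ((hEV' w hw).1 h2)
  have hφE : ∀ᶠ x in 𝓝 0, star x = x →
      φ x ∈ singSet N (closure (hypStar N H) ∩ U) ∧ T (φ x - p) = x := by
    filter_upwards [hφt.eventually hpVm, hφr] with x hx h1 hxs
    exact ⟨(hEV' _ hx).2 (h1 hxs).1, (h1 hxs).2⟩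
  obtain rfl : k = 2 := by
    obtain ⟨x, ⟨hxV, hxE⟩, hxs, G₁, G₂, h₁, h₂, ⟨S', hS'⟩, hG, -, -⟩ :=
      exists_levi_pair hH hN hφ hS hTs hφ0 hpE hET hφE
        (W := {x | φ x ∈ V} ∩ {x | star x = x → φ x ∈ singSet N (closure (hypStar N H) ∩ U)})
        (Filter.inter_mem (hφt.eventually hpVm) (hφE.mono fun x hx hs => (hx hs).1))
    refine card_eq_two_of_im (hra _ hxV) (hreal _ hxV) (hxE hxs) ?_ h₁ h₂ hS' hG
    filter_upwards [hV.mem_nhds hxV] with w hw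
    exact hEV' w hw
  obtain ⟨K, M, L, hM, hMp, hML, hME⟩ := exists_flat_param hH hN hφ hS hTs hφ0 hpE hET hφE
    (hra p hpV) (hcx p hpV) (hpVm.mono fun w hw => hEV' w hw) hm
  exact ⟨(exists_coordinate_equiv L).1, isGenericLeviFlat2At_of_param hM hMp hML hME⟩

theorem singSet_zero_eq_empty (X : Set (CN 0)) : singSet 0 X = ∅ := by
  refine eq_empty_of_forall_notMem fun p hp => hp.2 ⟨hp.1, 0, univ, fun i => Fin.elim0 i,
    isOpen_univ, mem_univ p, fun i => Fin.elim0 i, fun z _ => linearIndependent_iff'.2 fun _ _ _ i => Fin.elim0 i, ?_⟩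
  ext z
  have : z = p := Subsingleton.elim _ _
  simp [this, hp.1]

/-- if `E = (closure H* ∩ U)_s` is a connected generic real-analytic
submanifold, then `E` is a generic Levi-flat submanifold of real dimension `2N - 2`. -/
theorem stmt15 (N : ℕ) (U H : Set (CN N)) (hH : IsLeviFlatHypervariety N U H)
    (hEconn : IsConnected (singSet N (closure (hypStar N H) ∩ U)))
    (hEman : ∃ d, ∀ p ∈ singSet N (closure (hypStar N H) ∩ U),
      IsSubmanifoldAtDim N d (singSet N (closure (hypStar N H) ∩ U)) p)
    (hEgen : ∀ p ∈ singSet N (closure (hypStar N H) ∩ U),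
      IsGenericSubmanifoldAt N (singSet N (closure (hypStar N H) ∩ U)) p) :
    dimH (singSet N (closure (hypStar N H) ∩ U)) = ((2 * N - 2 : ℕ) : ℝ≥0∞) ∧
    ∀ p ∈ singSet N (closure (hypStar N H) ∩ U),
      IsGenericLeviFlat2At N (singSet N (closure (hypStar N H) ∩ U)) p := by
  have hN : 1 ≤ N := by
    rcases Nat.eq_zero_or_pos N with rfl | h
    · rw [singSet_zero_eq_empty] at hEconn
      exact absurd hEconn.nonempty (by simp)
    · exact h
  have hflat := fun p hp => two_le_and_isGenericLeviFlat2At hH hN hp (hEgen p hp)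
  obtain ⟨p, hp⟩ := hEconn.nonempty
  exact ⟨dimH_eq_of_isGenericLeviFlat2At (hflat p hp).1 ⟨p, hp⟩ fun p hp => (hflat p hp).2,
    fun p hp => (hflat p hp).2⟩
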